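/- For x → ∞, ∑_{n ≤ x} φ(⌊x/n⌋) = (6/π²) x log x + O(x (log x)^{2/3} (log log x)^{1/3}). -/

import Mathlib

open Filter Finset Real

namespace TotientFloor

/-- The `j`-th elementary symmetric function of a finite family. -/
def elemSymm {ι R : Type*} [Fintype ι] [CommRing R] (f : ι → R) (j : ℕ) : R :=
  ∑ t ∈ powersetCard j (univ : Finset ι), ∏ i ∈ t, f i

theorem elemSymm_zero {ι R : Type*} [Fintype ι] [CommRing R] (f : ι → R) : elemSymm f 0 = 1 := by
  simp [elemSymm]

theorem mul_elemSymm {ι R : Type*} [Fintype ι] [CommRing R] (f : ι → R) (j : ℕ) :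
    (j : R) * elemSymm f j = (-1) ^ (j + 1) *
      ∑ a ∈ range j, (-1) ^ a * elemSymm f a * ∑ i, f i ^ (j - a) := by
  classical
  have h := congrArg (MvPolynomial.aeval f) (MvPolynomial.mul_esymm_eq_sum ι R j)
  have he : ∀ m, MvPolynomial.aeval f (MvPolynomial.esymm ι R m) = elemSymm f m := by
    intro m
    simp [MvPolynomial.esymm, elemSymm]
  have hp : ∀ m, MvPolynomial.aeval f (MvPolynomial.psum ι R m) = ∑ i, f i ^ m := by
    intro m
    simp [MvPolynomial.psum]
  simp only [map_mul, map_sum, map_pow, map_neg, map_one, map_natCast, he, hp] at h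
  rw [h]
  congr 1
  rw [sum_filter, Nat.sum_antidiagonal_eq_sum_range_succ_mk, sum_range_succ]
  simp only [lt_irrefl, if_false, add_zero]
  exact sum_congr rfl fun a ha => if_pos (mem_range.1 ha)

theorem elemSymm_congr {ι κ R : Type*} [Fintype ι] [Fintype κ] [CommRing R] (f : ι → R)
    (g : κ → R) (k : ℕ) (hk : ∀ j, 1 ≤ j → j ≤ k → IsUnit (j : R))
    (h : ∀ j, 1 ≤ j → j ≤ k → ∑ i, f i ^ j = ∑ i, g i ^ j) :
    ∀ j ≤ k, elemSymm f j = elemSymm g j := by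
  intro j
  induction j using Nat.strong_induction_on with
  | _ j ih =>
    intro hj
    rcases Nat.eq_zero_or_pos j with rfl | hj0
    · simp [elemSymm_zero]
    · apply (hk j hj0 hj).mul_left_cancel
      rw [mul_elemSymm, mul_elemSymm]
      congr 1
      refine sum_congr rfl fun a ha => ?_
      have ha' := mem_range.1 ha
      rw [ih a ha' (by omega), h (j - a) (by omega) (by omega)]

theorem prod_sub_eq_of_elemSymm {ι R : Type*} [Fintype ι] [CommRing R] (f : ι → R) (y : R) :
    ∏ i, (y - f i) = ∑ j ∈ range (Fintype.card ι + 1),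
      (-1) ^ j * elemSymm f j * y ^ (Fintype.card ι - j) := by
  classical
  have h := congrArg (Polynomial.eval y)
    (Multiset.prod_X_sub_X_eq_sum_esymm ((univ : Finset ι).val.map f))
  simp only [Multiset.map_map, Function.comp_def] at h
  rw [show (Multiset.map (fun x => Polynomial.X - Polynomial.C (f x)) (univ : Finset ι).val).prod
    = ∏ i, (Polynomial.X - Polynomial.C (f i)) from rfl] at h
  simp only [Polynomial.eval_prod, Polynomial.eval_sub, Polynomial.eval_X, Polynomial.eval_C,
    Polynomial.eval_finsetSum, Polynomial.eval_mul, Polynomial.eval_pow, Polynomial.eval_neg,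
    Polynomial.eval_one, Multiset.card_map, Finset.card_val, Finset.esymm_map_val,
    Finset.card_univ] at h
  rw [h]
  exact sum_congr rfl fun j _ => by rw [elemSymm, mul_assoc]

/-- If two families of integers of size `k < p` have the same first `k` power sums modulo `p ^ k`,
and the first one is injective modulo `p`, then each member of the second family is congruent
modulo `p ^ k` to a member of the first one. -/
theorem exists_dvd_sub_of_powerSums {ι κ : Type*} [Fintype ι] [Fintype κ] {p k : ℕ}
    (hp : p.Prime) (hk : 0 < k) (hkp : k < p) (f : ι → ℤ) (g : κ → ℤ)
    (hι : Fintype.card ι = k) (hκ : Fintype.card κ = k)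
    (hinj : ∀ i i', (p : ℤ) ∣ f i - f i' → i = i')
    (h : ∀ j, 1 ≤ j → j ≤ k → ((p : ℤ) ^ k) ∣ ∑ i, f i ^ j - ∑ i, g i ^ j) (b : κ) :
    ∃ i, ((p : ℤ) ^ k) ∣ g b - f i := by
  classical
  have hsum : ∀ j, 1 ≤ j → j ≤ k →
      ∑ i, ((f i : ℤ) : ZMod (p ^ k)) ^ j = ∑ i, ((g i : ℤ) : ZMod (p ^ k)) ^ j := by
    intro j h1 h2
    have := (ZMod.intCast_zmod_eq_zero_iff_dvd (∑ i, f i ^ j - ∑ i, g i ^ j) (p ^ k)).2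
      (by exact_mod_cast h j h1 h2)
    push_cast at this
    exact sub_eq_zero.1 this
  have hunit : ∀ j, 1 ≤ j → j ≤ k → IsUnit ((j : ℕ) : ZMod (p ^ k)) := by
    intro j h1 h2
    rw [ZMod.isUnit_iff_coprime]
    apply Nat.Coprime.pow_right
    exact Nat.Coprime.symm ((Nat.Prime.coprime_iff_not_dvd hp).2 fun hd =>
      absurd (Nat.le_of_dvd h1 hd) (by omega))
  have hE := elemSymm_congr _ _ k hunit hsum
  have h0 : ∏ i, (((g b : ℤ) : ZMod (p ^ k)) - ((f i : ℤ) : ZMod (p ^ k))) = 0 := by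
    rw [prod_sub_eq_of_elemSymm]
    have h1 : ∏ i, (((g b : ℤ) : ZMod (p ^ k)) - ((g i : ℤ) : ZMod (p ^ k))) = 0 :=
      prod_eq_zero (mem_univ b) (sub_self _)
    rw [prod_sub_eq_of_elemSymm] at h1
    rw [← h1, hι, hκ]
    exact sum_congr rfl fun j hj => by rw [hE j (by have := mem_range.1 hj; omega)]
  have hdvd : ((p : ℤ) ^ k) ∣ ∏ i, (g b - f i) := by
    have := (ZMod.intCast_zmod_eq_zero_iff_dvd (∏ i, (g b - f i)) (p ^ k)).1
      (by push_cast; exact h0)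
    exact_mod_cast this
  have hpZ : Prime (p : ℤ) := Nat.prime_iff_prime_int.1 hp
  obtain ⟨i, -, hi⟩ := (hpZ.dvd_finsetProd_iff _).1
    ((dvd_pow_self (p : ℤ) hk.ne').trans hdvd)
  refine ⟨i, ?_⟩
  rw [← mul_prod_erase univ _ (mem_univ i)] at hdvd
  refine IsCoprime.dvd_of_dvd_mul_right (IsCoprime.pow_left ?_) hdvd
  apply IsCoprime.prod_right
  intro l hl
  rw [Prime.coprime_iff_not_dvd hpZ]
  intro hd
  have : (p : ℤ) ∣ f i - f l := by
    have := dvd_sub hd hi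
    rwa [show g b - f l - (g b - f i) = f i - f l by ring] at this
  exact (mem_erase.1 hl).1 (hinj i l this).symm

/-- Either a sum is small compared with its square function, or it is controlled by the
elementary symmetric function of its terms. -/
theorem norm_sum_pow_le_elemSymm {ι : Type*} [Fintype ι] (f : ι → ℂ) (k : ℕ) (hk : 0 < k)
    {σ : ℝ} (hσ0 : 0 ≤ σ) (hσ : ∑ i, ‖f i‖ ^ 2 = σ ^ 2) (hF : 4 * k * σ ≤ ‖∑ i, f i‖) :
    ‖∑ i, f i‖ ^ k ≤ 2 ^ k * k.factorial * ‖elemSymm f k‖ := by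
  set F := ‖∑ i, f i‖ with hFdef
  have hF0 : 0 ≤ F := norm_nonneg _
  have hk1 : (1 : ℝ) ≤ k := by exact_mod_cast hk
  have hle : ∀ i, ‖f i‖ ≤ σ := by
    intro i
    apply le_of_sq_le_sq _ hσ0
    rw [← hσ]
    exact single_le_sum (f := fun i => ‖f i‖ ^ 2) (fun i _ => by positivity) (mem_univ i)
  have hps : ∀ m, ‖∑ i, f i ^ (m + 2)‖ ≤ σ ^ (m + 2) := by
    intro m
    calc ‖∑ i, f i ^ (m + 2)‖ ≤ ∑ i, σ ^ m * ‖f i‖ ^ 2 := by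
          refine norm_sum_le_of_le _ fun i _ => ?_
          rw [norm_pow, pow_add]
          gcongr
          exact hle i
      _ = σ ^ (m + 2) := by rw [← mul_sum, hσ, pow_add]
  have key : ∀ j, 1 ≤ j → j ≤ k → ‖elemSymm f (j - 1)‖ * F ≤ 2 * j * ‖elemSymm f j‖ := by
    intro j
    induction j using Nat.strong_induction_on with
    | _ j ih =>
      intro hj1 hjk
      obtain ⟨j, rfl⟩ : ∃ i, j = i + 1 := ⟨j - 1, by omega⟩
      simp only [Nat.add_sub_cancel]
      have hchain : ∀ b ≤ j, ‖elemSymm f (j - b)‖ * F ^ b ≤ (2 * k) ^ b * ‖elemSymm f j‖ := by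
        intro b
        induction b with
        | zero => intro _; simp
        | succ b ihb =>
          intro hb
          have h1 := ih (j - b) (by omega) (by omega) (by omega)
          have h2 := ihb (by omega)
          have h3 : ((j - b : ℕ) : ℝ) ≤ k := by exact_mod_cast (by omega : j - b ≤ k)
          calc ‖elemSymm f (j - (b + 1))‖ * F ^ (b + 1)
              = (‖elemSymm f (j - b - 1)‖ * F) * F ^ b := by
                rw [show j - (b + 1) = j - b - 1 by omega]; ring
            _ ≤ (2 * k * ‖elemSymm f (j - b)‖) * F ^ b := by
                refine mul_le_mul_of_nonneg_right (h1.trans ?_) (by positivity)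
                gcongr
            _ = 2 * k * (‖elemSymm f (j - b)‖ * F ^ b) := by ring
            _ ≤ 2 * k * ((2 * k) ^ b * ‖elemSymm f j‖) := by gcongr
            _ = _ := by ring
      have hN := mul_elemSymm f (j + 1)
      rw [sum_range_succ] at hN
      have hlead : (-1 : ℂ) ^ (j + 1 + 1) * ((-1) ^ j * elemSymm f j * ∑ i, f i ^ (j + 1 - j))
          = elemSymm f j * ∑ i, f i := by
        have : (-1 : ℂ) ^ (j + 1 + 1) * (-1) ^ j = 1 := by
          rw [← pow_add, show j + 1 + 1 + j = 2 * (j + 1) by ring, pow_mul]; simp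
        rw [show j + 1 - j = 1 by omega]
        simp only [pow_one]
        linear_combination (elemSymm f j * ∑ i, f i) * this
      rw [mul_add, hlead] at hN
      have hrest : ‖∑ a ∈ range j, (-1 : ℂ) ^ a * elemSymm f a * ∑ i, f i ^ (j + 1 - a)‖
          ≤ ‖elemSymm f j‖ * F / 2 := by
        have hterm : ∀ a ∈ range j,
            ‖(-1 : ℂ) ^ a * elemSymm f a * ∑ i, f i ^ (j + 1 - a)‖ ≤
              ‖elemSymm f j‖ * F * ((1 / 2) * (1 / 2) ^ (j - a)) := by
          intro a ha
          have haj := mem_range.1 ha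
          obtain ⟨b, hb⟩ : ∃ b, j = a + b + 1 := ⟨j - a - 1, by omega⟩
          have e1 : j + 1 - a = b + 2 := by omega
          have e2 : j - a = b + 1 := by omega
          have e3 : a = j - (b + 1) := by omega
          rw [norm_mul, norm_mul, norm_pow, norm_neg, norm_one, one_pow, one_mul, e1, e2]
          have hσF : σ ≤ F / (4 * k) := by rw [le_div_iff₀ (by positivity)]; linarith
          have h1 := hchain (b + 1) (by omega)
          rw [← e3] at h1
          calc ‖elemSymm f a‖ * ‖∑ i, f i ^ (b + 2)‖
              ≤ ‖elemSymm f a‖ * (F / (4 * k)) ^ (b + 2) := by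
                gcongr
                exact (hps b).trans (by gcongr)
            _ = (‖elemSymm f a‖ * F ^ (b + 1)) * F / (4 * k) ^ (b + 2) := by
                rw [div_pow]; ring
            _ ≤ ((2 * k) ^ (b + 1) * ‖elemSymm f j‖) * F / (4 * k) ^ (b + 2) := by gcongr
            _ = ‖elemSymm f j‖ * F * ((1 / (4 * k)) * (1 / 2) ^ (b + 1)) := by
                rw [show (4 * (k : ℝ)) = 2 * (2 * k) by ring, pow_succ (2 * (2 * (k : ℝ))),
                  mul_pow 2 (2 * (k : ℝ)), one_div_pow]
                field_simp
            _ ≤ _ := by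
                gcongr
                linarith
        refine (norm_sum_le_of_le _ hterm).trans ?_
        rw [← mul_sum, ← mul_sum]
        have hgeo : ∑ a ∈ range j, ((1 : ℝ) / 2) ^ (j - a) ≤ 1 := by
          have : ∑ a ∈ range j, ((1 : ℝ) / 2) ^ (j - a) = ∑ a ∈ range j, ((1 : ℝ) / 2) ^ (a + 1) := by
            rw [← sum_range_reflect]
            refine sum_congr rfl fun a ha => ?_
            have := mem_range.1 ha
            congr 1
            omega
          rw [this]
          simp_rw [pow_succ]
          rw [← sum_mul, geom_sum_eq (by norm_num)]
          have : (0 : ℝ) < (1 / 2) ^ j := by positivity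
          rw [show ((1 : ℝ) / 2 - 1) = -(1 / 2) by norm_num, div_neg, neg_mul,
            div_mul_cancel₀ _ (by norm_num)]
          linarith
        have : 0 ≤ ‖elemSymm f j‖ * F := by positivity
        nlinarith
      have hmain : ‖elemSymm f j‖ * F ≤
          ‖((j + 1 : ℕ) : ℂ) * elemSymm f (j + 1)‖ + ‖elemSymm f j‖ * F / 2 := by
        have : elemSymm f j * ∑ i, f i = ((j + 1 : ℕ) : ℂ) * elemSymm f (j + 1) -
            (-1) ^ (j + 1 + 1) *
              ∑ a ∈ range j, (-1 : ℂ) ^ a * elemSymm f a * ∑ i, f i ^ (j + 1 - a) := by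
          rw [hN]; ring
        rw [hFdef, ← norm_mul, this]
        refine (norm_sub_le _ _).trans ?_
        gcongr
        rw [norm_mul, norm_pow, norm_neg, norm_one, one_pow, one_mul]
        rwa [← this, norm_mul, ← hFdef]
      rw [norm_mul, Complex.norm_natCast] at hmain
      linarith
  have hind : ∀ j ≤ k, F ^ j ≤ 2 ^ j * j.factorial * ‖elemSymm f j‖ := by
    intro j
    induction j with
    | zero => intro _; simp [elemSymm_zero]
    | succ j ihj =>
      intro hj
      have h1 := key (j + 1) (by omega) hj
      simp only [Nat.add_sub_cancel] at h1
      calc F ^ (j + 1) = F ^ j * F := pow_succ _ _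
        _ ≤ 2 ^ j * j.factorial * ‖elemSymm f j‖ * F := by gcongr; exact ihj (by omega)
        _ = 2 ^ j * j.factorial * (‖elemSymm f j‖ * F) := by ring
        _ ≤ 2 ^ j * j.factorial * (2 * (j + 1 : ℕ) * ‖elemSymm f (j + 1)‖) := by gcongr
        _ = _ := by rw [Nat.factorial_succ]; push_cast; ring
  exact hind k le_rfl

open Classical in
/-- The number of pairs of elements of `s` on which `u` takes the same value. -/
noncomputable def coincidences {ι M : Type*} (s : Finset ι) (u : ι → M) : ℕ :=
  #{q ∈ s ×ˢ s | u q.1 = u q.2}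

/-- The vector `(x, x ^ 2, …, x ^ k)`. -/
def powVec (k : ℕ) (x : ℤ) : Fin k → ℤ := fun j => x ^ (j.val + 1)

/-- The number of solutions of the Vinogradov system of degree `k` in `2 * s` variables taken
from `{0, …, P - 1}`. -/
noncomputable def vinogradovCount (k s P : ℕ) : ℕ :=
  coincidences (Fintype.piFinset fun _ : Fin s => range P)
    fun x => ∑ i, powVec k (x i)

theorem coincidences_mono_of_imp {ι M N : Type*} {s t : Finset ι} {u : ι → M} {v : ι → N}
    (hst : s ⊆ t) (h : ∀ a ∈ s, ∀ b ∈ s, u a = u b → v a = v b) :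
    coincidences s u ≤ coincidences t v := by
  classical
  apply card_le_card
  intro q hq
  simp only [mem_filter, mem_product] at hq ⊢
  exact ⟨⟨hst hq.1.1, hst hq.1.2⟩, h _ hq.1.1 _ hq.1.2 hq.2⟩

theorem coincidences_le_card {ι M : Type*} (s : Finset ι) (u : ι → M) :
    coincidences s u ≤ #s * #s := by
  classical
  exact (card_filter_le _ _).trans (card_product _ _).le

theorem vinogradovCount_mono (k s : ℕ) {P P' : ℕ} (h : P ≤ P') :
    vinogradovCount k s P ≤ vinogradovCount k s P' :=
  coincidences_mono_of_imp (Fintype.piFinset_subset _ _ fun _ => range_subset_range.2 h)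
    fun _ _ _ _ hh => hh

theorem vinogradovCount_le (k s P : ℕ) : vinogradovCount k s P ≤ P ^ (2 * s) := by
  refine (coincidences_le_card _ _).trans ?_
  rw [Fintype.card_piFinset]
  simp [← pow_add, two_mul]

theorem sum_addChar_norm_sq {G ι : Type*} [AddCommGroup G] [Fintype G] (s : Finset ι)
    (u : ι → G) :
    ∑ ψ : AddChar G ℂ, ‖∑ i ∈ s, ψ (u i)‖ ^ 2 = Fintype.card G * (coincidences s u : ℝ) := by
  classical
  have h : ∀ ψ : AddChar G ℂ, ((‖∑ i ∈ s, ψ (u i)‖ ^ 2 : ℝ) : ℂ) =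
      ∑ q ∈ s ×ˢ s, ψ (u q.1 - u q.2) := by
    intro ψ
    rw [Complex.ofReal_pow, ← Complex.mul_conj', map_sum, sum_mul_sum, sum_product]
    refine sum_congr rfl fun a _ => sum_congr rfl fun b _ => ?_
    rw [AddChar.map_sub_eq_div, div_eq_mul_inv, ← AddChar.map_neg_eq_inv,
      AddChar.map_neg_eq_conj]
  apply Complex.ofReal_injective
  rw [Complex.ofReal_sum]
  simp_rw [h]
  rw [sum_comm]
  simp_rw [AddChar.sum_apply_eq_ite, sub_eq_zero]
  rw [← sum_filter, sum_const, coincidences]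
  push_cast
  rw [nsmul_eq_mul, mul_comm]

theorem eventually_coincidences_cast {ι : Type*} {k : ℕ} (s : Finset ι) (u : ι → Fin k → ℤ) :
    ∀ᶠ q : ℕ in atTop, coincidences s (fun i j => (u i j : ZMod q)) ≤ coincidences s u := by
  have : ∀ᶠ q : ℕ in atTop, ∀ a ∈ s, ∀ b ∈ s,
      (fun j => (u a j : ZMod q)) = (fun j => (u b j : ZMod q)) → u a = u b := by
    rw [Filter.eventually_all_finset]
    intro a _
    rw [Filter.eventually_all_finset]
    intro b _
    by_cases hab : u a = u b
    · exact Eventually.of_forall fun _ _ => hab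
    · obtain ⟨j, hj⟩ := Function.ne_iff.1 hab
      filter_upwards [eventually_gt_atTop (u a j - u b j).natAbs] with q hq h
      exfalso
      have h1 := congrFun h j
      have h2 : (((u a j - u b j : ℤ)) : ZMod q) = 0 := by
        push_cast
        exact sub_eq_zero.2 h1
      rw [ZMod.intCast_zmod_eq_zero_iff_dvd] at h2
      have h3 := Int.natAbs_dvd_natAbs.2 h2
      rw [Int.natAbs_natCast] at h3
      have h4 := Nat.le_of_dvd (Int.natAbs_pos.2 (sub_ne_zero.2 hj)) h3
      omega
  filter_upwards [this] with q hq
  exact coincidences_mono_of_imp subset_rfl hq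

open Classical in
theorem card_sub_eq_le_coincidences {ι M : Type*} [AddCommGroup M] (s : Finset ι)
    (u : ι → M) (c : M) : #{q ∈ s ×ˢ s | u q.1 - u q.2 = c} ≤ coincidences s u := by
  let n : M → ℕ := fun g => #{a ∈ s | u a = g}
  have key : ∀ e : M, #{q ∈ s ×ˢ s | u q.1 - u q.2 = e} = ∑ g ∈ s.image u, n g * n (g - e) := by
    intro e
    rw [card_eq_sum_card_fiberwise (f := fun q => u q.1) (t := s.image u)]
    · refine sum_congr rfl fun g _ => ?_
      rw [← card_product]
      congr 1
      ext q
      simp only [mem_filter, mem_product]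
      constructor
      · rintro ⟨⟨⟨h1, h2⟩, h3⟩, h4⟩
        exact ⟨⟨h1, h4⟩, h2, by rw [← h3, ← h4]; abel⟩
      · rintro ⟨⟨h1, h4⟩, h2, h3⟩
        exact ⟨⟨⟨h1, h2⟩, by rw [h3, h4]; abel⟩, h4⟩
    · intro q hq
      simp only [coe_filter, mem_product, Set.mem_ofPred_eq] at hq
      exact mem_coe.2 (mem_image_of_mem u hq.1.1)
  have h0 : coincidences s u = ∑ g ∈ s.image u, n g * n g := by
    have := key 0
    simp only [sub_eq_zero, sub_zero] at this
    exact this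
  rw [key c, h0]
  have hshift : ∑ g ∈ s.image u, n (g - c) * n (g - c) ≤ ∑ g ∈ s.image u, n g * n g := by
    rw [← sum_image (s := s.image u) (g := fun g => g - c) (f := fun g => n g * n g)
      (fun a _ b _ h => sub_left_injective h)]
    apply sum_le_sum_of_ne_zero
    intro g _ hg
    by_contra hgs
    apply hg
    have : n g = 0 := by
      apply card_eq_zero.2
      rw [filter_eq_empty_iff]
      intro a ha hag
      exact hgs (hag ▸ mem_image_of_mem u ha)
    rw [this, zero_mul]
  have h2 : ∑ g ∈ s.image u, 2 * (n g * n (g - c)) ≤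
      ∑ g ∈ s.image u, (n g * n g + n (g - c) * n (g - c)) := by
    apply sum_le_sum
    intro g _
    nlinarith [two_mul_le_add_sq (n g) (n (g - c))]
  rw [← mul_sum, sum_add_distrib] at h2
  omega

open Classical in
theorem coincidences_product_le {ι κ M : Type*} [AddCommGroup M] (S : Finset ι) (T : Finset κ)
    (w : ι → M) (u : κ → M) (R : ι → ι → Prop) (A B : ℕ)
    (hR : ∀ i ∈ S, ∀ i' ∈ S, ∀ y ∈ T, ∀ y' ∈ T, w i + u y = w i' + u y' → R i i')
    (hA : ∀ i' ∈ S, #{i ∈ S | R i i'} ≤ A)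
    (hB : ∀ i ∈ S, ∀ i' ∈ S, #{q ∈ T ×ˢ T | w i + u q.1 = w i' + u q.2} ≤ B) :
    coincidences (S ×ˢ T) (fun a => w a.1 + u a.2) ≤ #S * A * B := by
  let Z : Finset (ι × ι) := S.biUnion fun i' => {i ∈ S | R i i'}.image fun i => (i, i')
  have hZ : #Z ≤ #S * A := by
    refine card_biUnion_le_card_mul _ _ _ fun i' hi' => ?_
    exact card_image_le.trans (hA i' hi')
  have hsub : ({q ∈ (S ×ˢ T) ×ˢ (S ×ˢ T) | w q.1.1 + u q.1.2 = w q.2.1 + u q.2.2}) ⊆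
      Z.biUnion fun i => {q ∈ T ×ˢ T | w i.1 + u q.1 = w i.2 + u q.2}.image
        fun q => ((i.1, q.1), (i.2, q.2)) := by
    rintro ⟨⟨i, y⟩, ⟨i', y'⟩⟩ hq
    simp only [mem_filter, mem_product] at hq
    obtain ⟨⟨⟨hi, hy⟩, hi', hy'⟩, he⟩ := hq
    simp only [mem_biUnion, mem_image, mem_filter, mem_product, Z]
    exact ⟨(i, i'), ⟨i', hi', i, ⟨hi, hR i hi i' hi' y hy y' hy' he⟩, rfl⟩,
      (y, y'), ⟨⟨hy, hy'⟩, he⟩, rfl⟩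
  refine (card_le_card hsub).trans ?_
  refine (card_biUnion_le_card_mul _ _ B ?_).trans (Nat.mul_le_mul_right _ hZ)
  rintro ⟨i, i'⟩ hi
  simp only [mem_biUnion, mem_image, mem_filter, Z] at hi
  obtain ⟨i1, hi1, i2, ⟨hi2, -⟩, he⟩ := hi
  obtain ⟨rfl, rfl⟩ := Prod.mk.inj he
  exact card_image_le.trans (hB _ hi2 _ hi1)

theorem sum_sub_pow_expand {τ : Type*} (T : Finset τ) (f : τ → ℤ) (r : ℤ) (j : ℕ) :
    ∑ i ∈ T, (f i - r) ^ j =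
      ∑ m ∈ range (j + 1), (-r) ^ (j - m) * (j.choose m : ℤ) * ∑ i ∈ T, f i ^ m := by
  simp_rw [sub_eq_add_neg, add_pow, mul_sum]
  rw [sum_comm]
  exact sum_congr rfl fun _ _ => sum_congr rfl fun _ _ => by ring

theorem sum_sub_pow_eq {α β γ δ : Type*} (k : ℕ) (A : Finset α) (B : Finset β) (C : Finset γ)
    (D : Finset δ) (a : α → ℤ) (b : β → ℤ) (c : γ → ℤ) (d : δ → ℤ) (r : ℤ)
    (h : ∀ j ≤ k, ∑ i ∈ A, a i ^ j + ∑ i ∈ B, b i ^ j = ∑ i ∈ C, c i ^ j + ∑ i ∈ D, d i ^ j) :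
    ∀ j ≤ k, ∑ i ∈ A, (a i - r) ^ j + ∑ i ∈ B, (b i - r) ^ j =
      ∑ i ∈ C, (c i - r) ^ j + ∑ i ∈ D, (d i - r) ^ j := by
  intro j hj
  simp only [sum_sub_pow_expand, ← sum_add_distrib, ← mul_add]
  refine sum_congr rfl fun m hm => ?_
  rw [h m (by have := mem_range.1 hm; omega)]

theorem pow_sum_le_card_pow_mul {ι : Type*} (s : Finset ι) (f : ι → ℝ) (hf : ∀ i ∈ s, 0 ≤ f i)
    (n : ℕ) (hn : 0 < n) : (∑ i ∈ s, f i) ^ n ≤ (#s : ℝ) ^ (n - 1) * ∑ i ∈ s, f i ^ n := by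
  obtain ⟨n, rfl⟩ : ∃ m, n = m + 1 := ⟨n - 1, by omega⟩
  rcases s.eq_empty_or_nonempty with rfl | hs
  · simp
  have h := pow_sum_div_card_le_sum_pow (s := s) (f := f) hf n
  have hc : (0 : ℝ) < (#s : ℝ) ^ n := by
    have : 0 < #s := card_pos.2 hs
    positivity
  rw [div_le_iff₀ hc] at h
  simpa [mul_comm] using h

/-- The integers chosen, one in each residue class `c ∈ t` modulo `p`, by the digits `i.2`. -/
def residueLift {p : ℕ} (i : (t : Finset (Fin p)) × ((c : Fin p) → c ∈ t → ℕ))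
    (c : {c // c ∈ i.1}) : ℤ := (c.1 : ℕ) + p * i.2 c.1 c.2

/-- All choices of one element of `{0, …, p * m - 1}` in each of `k` distinct residue classes
modulo `p`. -/
def residueChoices (p k m : ℕ) : Finset ((t : Finset (Fin p)) × ((c : Fin p) → c ∈ t → ℕ)) :=
  (powersetCard k (univ : Finset (Fin p))).sigma fun t => t.pi fun _ => range m

theorem card_residueChoices_le (p k m : ℕ) : #(residueChoices p k m) ≤ (p * m) ^ k := by
  rw [residueChoices, card_sigma]
  have : ∀ t ∈ powersetCard k (univ : Finset (Fin p)), #(t.pi fun _ => range m) = m ^ k := by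
    intro t ht
    rw [card_pi]
    simp [(mem_powersetCard.1 ht).2]
  rw [sum_congr rfl this, sum_const, card_powersetCard, smul_eq_mul, mul_pow, card_univ,
    Fintype.card_fin]
  exact Nat.mul_le_mul_right _ (Nat.choose_le_pow p k)

theorem residueLift_sub_dvd_iff {p k m : ℕ} (hp : 0 < p) (hpm : p * m ≤ p ^ k)
    {i i' : (t : Finset (Fin p)) × ((c : Fin p) → c ∈ t → ℕ)} (hi : i ∈ residueChoices p k m)
    (hi' : i' ∈ residueChoices p k m) (c : {c // c ∈ i.1}) (c' : {c // c ∈ i'.1})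
    (h : ((p : ℤ) ^ k) ∣ residueLift i c - residueLift i' c') :
    residueLift i c = residueLift i' c' := by
  have bound : ∀ i ∈ residueChoices p k m, ∀ c, 0 ≤ residueLift i c ∧ residueLift i c < p ^ k := by
    intro i hi c
    have h1 : i.2 c.1 c.2 < m := by
      have := (mem_sigma.1 hi).2
      exact mem_range.1 (mem_pi.1 this c.1 c.2)
    have h2 : (c.1 : ℕ) < p := c.1.2
    refine ⟨by unfold residueLift; positivity, ?_⟩
    have h3 : (c.1 : ℕ) + p * i.2 c.1 c.2 < p * m := by nlinarith
    unfold residueLift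
    exact_mod_cast h3.trans_le hpm
  have b1 := bound i hi c
  have b2 := bound i' hi' c'
  have := Int.eq_zero_of_abs_lt_dvd h (by rw [abs_lt]; constructor <;> linarith)
  linarith

theorem residueLift_inj_of_dvd {p : ℕ} (i i' : (t : Finset (Fin p)) × ((c : Fin p) → c ∈ t → ℕ))
    (c : {c // c ∈ i.1}) (c' : {c // c ∈ i'.1}) (h : (p : ℤ) ∣ residueLift i c - residueLift i' c') :
    c.1 = c'.1 := by
  have h1 : (p : ℤ) ∣ ((c.1 : ℕ) : ℤ) - ((c'.1 : ℕ) : ℤ) := by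
    have := dvd_sub h (Dvd.intro ((i.2 c.1 c.2 : ℤ) - i'.2 c'.1 c'.2) rfl)
    refine (Eq.subst ?_ this)
    unfold residueLift
    ring
  have h2 := Int.eq_zero_of_abs_lt_dvd h1 (by
    have := c.1.2
    have := c'.1.2
    rw [abs_lt]; constructor <;> omega)
  exact Fin.ext (by omega)

theorem residueChoices_ext {p k m : ℕ} (hp : p.Prime) (hk : 0 < k) (hkp : k < p)
    (hpm : p * m ≤ p ^ k) {i i' : (t : Finset (Fin p)) × ((c : Fin p) → c ∈ t → ℕ)}
    (hi : i ∈ residueChoices p k m) (hi' : i' ∈ residueChoices p k m) (r : ℤ)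
    (h : ∀ j, 1 ≤ j → j ≤ k → ((p : ℤ) ^ k) ∣
      ∑ c, (residueLift i c - r) ^ j - ∑ c, (residueLift i' c - r) ^ j) : i = i' := by
  have card : ∀ i ∈ residueChoices p k m, #i.1 = k := fun i hi =>
    (mem_powersetCard.1 (mem_sigma.1 hi).1).2
  have key : ∀ c' : {c // c ∈ i'.1}, ∃ c : {c // c ∈ i.1},
      residueLift i' c' = residueLift i c := by
    intro c'
    obtain ⟨c, hc⟩ := exists_dvd_sub_of_powerSums hp hk hkp (fun c => residueLift i c - r)
      (fun c => residueLift i' c - r) (by simp [card i hi]) (by simp [card i' hi'])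
      (fun a b hab => Subtype.ext (residueLift_inj_of_dvd i i a b (by simpa using hab))) h c'
    exact ⟨c, residueLift_sub_dvd_iff hp.pos hpm hi' hi c' c (by simpa using hc)⟩
  have hsub : i'.1 ⊆ i.1 := by
    intro c' hc'
    obtain ⟨c, hc⟩ := key ⟨c', hc'⟩
    have := residueLift_inj_of_dvd i' i ⟨c', hc'⟩ c (by rw [hc, sub_self]; exact dvd_zero _)
    have hc2 : c' = c.1 := this
    rw [hc2]
    exact c.2
  have ht : i'.1 = i.1 := eq_of_subset_of_card_le hsub (by rw [card i hi, card i' hi'])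
  obtain ⟨t, g⟩ := i
  obtain ⟨t', g'⟩ := i'
  obtain rfl : t' = t := ht
  congr 1
  funext c hc
  obtain ⟨c', hc'⟩ := key ⟨c, hc⟩
  have hcc := residueLift_inj_of_dvd _ _ ⟨c, hc⟩ c' (by rw [hc', sub_self]; exact dvd_zero _)
  obtain rfl : c' = ⟨c, hc⟩ := Subtype.ext hcc.symm
  unfold residueLift at hc'
  have hp0 : (p : ℤ) ≠ 0 := by exact_mod_cast hp.ne_zero
  have := mul_left_cancel₀ hp0 (add_left_cancel hc')
  exact_mod_cast this.symm

open Classical in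
theorem card_compatible_le {p k m : ℕ} (hp : p.Prime) (hk : 0 < k) (hkp : k < p)
    (hpm : p * m ≤ p ^ k) (r : ℤ) (i' : (t : Finset (Fin p)) × ((c : Fin p) → c ∈ t → ℕ)) :
    #{i ∈ residueChoices p k m | ∀ j, 1 ≤ j → j ≤ k → ((p : ℤ) ^ j) ∣
      ∑ c, (residueLift i c - r) ^ j - ∑ c, (residueLift i' c - r) ^ j} ≤
      p ^ (k * (k - 1) / 2) := by
  have hcard : #(Fintype.piFinset fun j : Fin k => range (p ^ (k - 1 - j.val))) =
      p ^ (k * (k - 1) / 2) := by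
    rw [Fintype.card_piFinset]
    simp only [card_range]
    rw [prod_pow_eq_pow_sum, Fin.sum_univ_eq_sum_range (fun j => k - 1 - j) k]
    rw [sum_range_reflect (fun j => j) k, sum_range_id]
  rw [← hcard]
  let D : ((t : Finset (Fin p)) × ((c : Fin p) → c ∈ t → ℕ)) → ℕ → ℤ := fun i j =>
    ∑ c, (residueLift i c - r) ^ j - ∑ c, (residueLift i' c - r) ^ j
  have hpos : ∀ n : ℕ, (0 : ℤ) < (p : ℤ) ^ n := fun n => by
    have := hp.pos
    positivity
  refine card_le_card_of_injOn (fun i j => ((D i (j.val + 1) / (p : ℤ) ^ (j.val + 1)) %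
    ((p : ℤ) ^ (k - 1 - j.val))).toNat) ?_ ?_
  · intro i _
    simp only [Fintype.coe_piFinset, coe_range, Set.mem_pi, Set.mem_univ, Set.mem_Iio, true_imp_iff]
    intro j
    have h1 := Int.emod_nonneg (D i (j.val + 1) / (p : ℤ) ^ (j.val + 1)) (hpos (k - 1 - j.val)).ne'
    have h2 := Int.emod_lt_of_pos (D i (j.val + 1) / (p : ℤ) ^ (j.val + 1)) (hpos (k - 1 - j.val))
    zify
    rw [Int.toNat_of_nonneg h1]
    exact h2
  · intro i hi i2 hi2 heq
    simp only [coe_filter, Set.mem_ofPred_eq] at hi hi2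
    refine residueChoices_ext hp hk hkp hpm hi.1 hi2.1 r fun j hj1 hjk => ?_
    have h := congrFun heq ⟨j - 1, by omega⟩
    simp only [Nat.sub_add_cancel hj1] at h
    obtain ⟨a, ha⟩ : (p : ℤ) ^ j ∣ D i j := hi.2 j hj1 hjk
    obtain ⟨b, hb⟩ : (p : ℤ) ^ j ∣ D i2 j := hi2.2 j hj1 hjk
    rw [ha, hb, Int.mul_ediv_cancel_left _ (hpos j).ne', Int.mul_ediv_cancel_left _ (hpos j).ne'] at h
    have h1 := Int.emod_nonneg a (hpos (k - 1 - (j - 1))).ne'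
    have h2 := Int.emod_nonneg b (hpos (k - 1 - (j - 1))).ne'
    have h3 : a % (p : ℤ) ^ (k - 1 - (j - 1)) = b % (p : ℤ) ^ (k - 1 - (j - 1)) := by
      have := congrArg (Nat.cast : ℕ → ℤ) h
      rwa [Int.toNat_of_nonneg h1, Int.toNat_of_nonneg h2] at this
    have h4 := Int.ModEq.dvd (show b ≡ a [ZMOD _] from h3.symm)
    have h5 : ∑ c, (residueLift i c - r) ^ j - ∑ c, (residueLift i2 c - r) ^ j =
        (p : ℤ) ^ j * (a - b) := by
      have : D i j - D i2 j = (p : ℤ) ^ j * (a - b) := by rw [ha, hb]; ring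
      rw [← this]
      simp only [D]
      ring
    rw [h5, show k = j + (k - 1 - (j - 1)) by omega, pow_add]
    exact mul_dvd_mul_left _ h4

/-- The power sums of the two sides of the translated system. -/
theorem translated_powerSums {p k s : ℕ} {i i' : (t : Finset (Fin p)) × ((c : Fin p) → c ∈ t → ℕ)}
    (hcard : #i.1 = #i'.1) (r : ℕ) (y y' : Fin s → ℕ)
    (h : ∑ c, powVec k (residueLift i c) + ∑ l, powVec k (r + p * y l) =
      ∑ c, powVec k (residueLift i' c) + ∑ l, powVec k (r + p * y' l)) :
    ∀ j ≤ k, ∑ c, (residueLift i c - r) ^ j + (p : ℤ) ^ j * ∑ l, (y l : ℤ) ^ j =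
      ∑ c, (residueLift i' c - r) ^ j + (p : ℤ) ^ j * ∑ l, (y' l : ℤ) ^ j := by
  have h0 : ∀ j ≤ k, ∑ c, (residueLift i c) ^ j + ∑ l, ((r : ℤ) + p * y l) ^ j =
      ∑ c, (residueLift i' c) ^ j + ∑ l, ((r : ℤ) + p * y' l) ^ j := by
    intro j hj
    rcases Nat.eq_zero_or_pos j with rfl | hj0
    · simp [hcard]
    · have := congrFun h ⟨j - 1, by omega⟩
      simpa [powVec, Finset.sum_apply, Nat.sub_add_cancel hj0] using this
  intro j hj
  have := sum_sub_pow_eq k _ _ _ _ _ _ _ _ (r : ℤ) h0 j hj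
  simpa [mul_pow, mul_sum] using this

theorem coincidences_residueChoices_le {p k m s : ℕ} (hp : p.Prime) (hk : 0 < k) (hkp : k < p)
    (hpm : p * m ≤ p ^ k) (r : ℕ) :
    coincidences (residueChoices p k m ×ˢ Fintype.piFinset fun _ : Fin s => range m)
      (fun a => ∑ c, powVec k (residueLift a.1 c) + ∑ l, powVec k (r + p * a.2 l)) ≤
      (p * m) ^ k * p ^ (k * (k - 1) / 2) * vinogradovCount k s m := by
  classical
  have card : ∀ i ∈ residueChoices p k m, #i.1 = k := fun i hi =>
    (mem_powersetCard.1 (mem_sigma.1 hi).1).2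
  have hp0 : ∀ j, (p : ℤ) ^ j ≠ 0 := fun j => pow_ne_zero _ (by exact_mod_cast hp.ne_zero)
  refine (coincidences_product_le (residueChoices p k m)
    (Fintype.piFinset fun _ : Fin s => range m)
    (fun i => ∑ c, powVec k (residueLift i c)) (fun y => ∑ l, powVec k (r + p * y l))
    (fun i i' => ∀ j, 1 ≤ j → j ≤ k → ((p : ℤ) ^ j) ∣
      ∑ c, (residueLift i c - r) ^ j - ∑ c, (residueLift i' c - r) ^ j)
    (p ^ (k * (k - 1) / 2)) (vinogradovCount k s m) ?_ ?_ ?_).trans ?_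
  · intro i hi i' hi' y _ y' _ h j _ hjk
    have := translated_powerSums (by rw [card i hi, card i' hi']) r y y' h j hjk
    exact ⟨∑ l, (y' l : ℤ) ^ j - ∑ l, (y l : ℤ) ^ j, by linear_combination this⟩
  · intro i' _
    convert card_compatible_le hp hk hkp hpm (r : ℤ) i'
  · intro i hi i' hi'
    rcases Finset.eq_empty_or_nonempty ({q ∈ (Fintype.piFinset fun _ : Fin s => range m) ×ˢ
        (Fintype.piFinset fun _ : Fin s => range m) |
        ∑ c, powVec k (residueLift i c) + ∑ l, powVec k (r + p * q.1 l) =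
          ∑ c, powVec k (residueLift i' c) + ∑ l, powVec k (r + p * q.2 l)}) with he | ⟨q0, hq0⟩
    · refine (le_of_eq ?_).trans (Nat.zero_le _)
      rw [card_eq_zero]
      convert he
    · have hT := card_sub_eq_le_coincidences (Fintype.piFinset fun _ : Fin s => range m)
        (fun x => ∑ l, powVec k (x l)) (∑ l, powVec k (q0.1 l) - ∑ l, powVec k (q0.2 l))
      refine (card_le_card ?_).trans hT
      intro q hq
      simp only [mem_filter] at hq hq0 ⊢
      refine ⟨hq.1, ?_⟩
      have e1 := translated_powerSums (by rw [card i hi, card i' hi']) r _ _ hq.2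
      have e2 := translated_powerSums (by rw [card i hi, card i' hi']) r _ _ hq0.2
      funext j
      simp only [Pi.sub_apply, Finset.sum_apply, powVec]
      apply mul_left_cancel₀ (hp0 (j.val + 1))
      linear_combination e1 (j.val + 1) (by omega) - e2 (j.val + 1) (by omega)
  · gcongr
    exact card_residueChoices_le p k m

theorem coincidences_progression_le {p k m s : ℕ} (hp : 0 < p) (r : ℕ) :
    coincidences (Fintype.piFinset fun _ : Fin s => range m)
      (fun y => ∑ l, powVec k (r + p * y l)) ≤ vinogradovCount k s m := by
  refine coincidences_mono_of_imp subset_rfl fun y _ y' _ h => ?_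
  let i : (t : Finset (Fin p)) × ((c : Fin p) → c ∈ t → ℕ) := ⟨∅, fun _ _ => 0⟩
  have e := translated_powerSums (k := k) (i := i) (i' := i) rfl r y y' (by rw [h])
  funext j
  simp only [Finset.sum_apply, powVec]
  have hp0 : (p : ℤ) ^ (j.val + 1) ≠ 0 := pow_ne_zero _ (by exact_mod_cast hp.ne')
  exact mul_left_cancel₀ hp0 (add_left_cancel (e (j.val + 1) (by omega)))

theorem norm_sum_pow_le_of_norm_le {ι : Type*} [Fintype ι] (f : ι → ℂ) {k s : ℕ} (hk : 0 < k)
    (hs : 0 < s) {M : ℝ} (hM : ∀ i, ‖f i‖ ≤ M) :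
    ‖∑ i, f i‖ ^ (2 * (s + k)) ≤
      (4 * k) ^ (2 * (s + k)) * Fintype.card ι ^ (s + k - 1) * M ^ (2 * k) * ∑ i, ‖f i‖ ^ (2 * s) +
      4 ^ k * k.factorial ^ 2 * Fintype.card ι ^ (2 * s - 1) *
        ∑ i, ‖elemSymm f k * f i ^ s‖ ^ 2 := by
  set S := ∑ i, ‖f i‖ ^ 2 with hS
  have hS0 : 0 ≤ S := sum_nonneg fun i _ => by positivity
  have hT1 : 0 ≤ (4 * k : ℝ) ^ (2 * (s + k)) * Fintype.card ι ^ (s + k - 1) * M ^ (2 * k) *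
      ∑ i, ‖f i‖ ^ (2 * s) := by
    have : 0 ≤ M ^ (2 * k) := by rw [pow_mul]; positivity
    have : 0 ≤ ∑ i, ‖f i‖ ^ (2 * s) := sum_nonneg fun i _ => by positivity
    positivity
  have hT2 : 0 ≤ (4 : ℝ) ^ k * k.factorial ^ 2 * Fintype.card ι ^ (2 * s - 1) *
        ∑ i, ‖elemSymm f k * f i ^ s‖ ^ 2 := by
    have : 0 ≤ ∑ i, ‖elemSymm f k * f i ^ s‖ ^ 2 := sum_nonneg fun i _ => by positivity
    positivity
  rcases le_total (4 * k * √S) ‖∑ i, f i‖ with h | h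
  · refine le_trans ?_ (le_add_of_nonneg_left hT1)
    have h1 := norm_sum_pow_le_elemSymm f k hk (Real.sqrt_nonneg S) (Real.sq_sqrt hS0).symm h
    have h2 : ‖∑ i, f i‖ ^ (2 * s) ≤ Fintype.card ι ^ (2 * s - 1) * ∑ i, ‖f i‖ ^ (2 * s) :=
      (pow_le_pow_left₀ (norm_nonneg _) (norm_sum_le _ _) _).trans
        (pow_sum_le_card_pow_mul univ (fun i => ‖f i‖) (fun i _ => norm_nonneg _) (2 * s)
          (by omega))
    calc ‖∑ i, f i‖ ^ (2 * (s + k)) = (‖∑ i, f i‖ ^ k) ^ 2 * ‖∑ i, f i‖ ^ (2 * s) := by ring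
      _ ≤ (2 ^ k * k.factorial * ‖elemSymm f k‖) ^ 2 *
          (Fintype.card ι ^ (2 * s - 1) * ∑ i, ‖f i‖ ^ (2 * s)) := by gcongr
      _ = _ := by
        rw [mul_pow, mul_pow, ← pow_mul, mul_comm k 2, pow_mul, show (2 : ℝ) ^ 2 = 4 by norm_num]
        simp only [norm_mul, norm_pow, mul_pow, ← pow_mul, mul_comm s 2, ← mul_sum]
        ring
  · refine le_trans ?_ (le_add_of_nonneg_right hT2)
    calc ‖∑ i, f i‖ ^ (2 * (s + k)) ≤ (4 * k * √S) ^ (2 * (s + k)) := by gcongr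
      _ = (4 * k) ^ (2 * (s + k)) * S ^ (s + k) := by
        rw [mul_pow, pow_mul √S, Real.sq_sqrt hS0]
      _ ≤ (4 * k) ^ (2 * (s + k)) *
          (Fintype.card ι ^ (s + k - 1) * ∑ i, (‖f i‖ ^ 2) ^ (s + k)) := by
        gcongr
        exact pow_sum_le_card_pow_mul univ (fun i => ‖f i‖ ^ 2) (fun i _ => by positivity) _
          (by omega)
      _ ≤ (4 * k) ^ (2 * (s + k)) *
          (Fintype.card ι ^ (s + k - 1) * ∑ i, M ^ (2 * k) * ‖f i‖ ^ (2 * s)) := by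
        gcongr with i _
        rw [← pow_mul, mul_add, pow_add, mul_comm]
        gcongr
        exact hM i
      _ = _ := by rw [← mul_sum]; ring

theorem addChar_map_sum {M ι : Type*} [AddCommGroup M] (χ : AddChar M ℂ) (s : Finset ι)
    (g : ι → M) : χ (∑ i ∈ s, g i) = ∏ i ∈ s, χ (g i) := by
  classical
  induction s using Finset.induction_on with
  | empty => simp
  | insert a s ha ih => rw [sum_insert ha, prod_insert ha, AddChar.map_add_eq_mul, ih]

theorem addChar_sum_pow {M : Type*} [AddCommGroup M] (χ : AddChar M ℂ) (m n : ℕ) (g : ℕ → M) :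
    (∑ y ∈ range m, χ (g y)) ^ n =
      ∑ y ∈ Fintype.piFinset fun _ : Fin n => range m, χ (∑ l, g (y l)) := by
  have h := Finset.prod_univ_sum (fun _ : Fin n => range m) (fun _ y => χ (g y))
  rw [prod_const, card_univ, Fintype.card_fin] at h
  rw [h]
  exact sum_congr rfl fun y _ => (addChar_map_sum χ _ _).symm

theorem elemSymm_addChar {p k m : ℕ} (χ : AddChar (Fin k → ℤ) ℂ) :
    elemSymm (fun c : Fin p => ∑ y ∈ range m, χ (powVec k ((c : ℕ) + p * y))) k =
      ∑ i ∈ residueChoices p k m, χ (∑ c, powVec k (residueLift i c)) := by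
  rw [elemSymm, residueChoices, sum_sigma]
  refine sum_congr rfl fun t _ => ?_
  rw [Finset.prod_sum]
  refine sum_congr rfl fun y _ => ?_
  rw [addChar_map_sum]
  rfl

theorem sum_range_mul_eq {E : Type*} [AddCommMonoid E] (p m : ℕ) (g : ℕ → E) :
    ∑ x ∈ range (p * m), g x = ∑ c : Fin p, ∑ y ∈ range m, g (c + p * y) := by
  rw [mul_comm, Finset.sum_range, ← finProdFinEquiv.sum_comp, Fintype.sum_prod_type, sum_comm]
  refine sum_congr rfl fun c _ => ?_
  rw [Finset.sum_range]
  rfl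

theorem vinogradovCount_recurrence {p k m s : ℕ} (hp : p.Prime) (hk : 0 < k) (hkp : k < p)
    (hpm : p * m ≤ p ^ k) (hs : 0 < s) :
    (vinogradovCount k (s + k) (p * m) : ℝ) ≤
      ((4 * k) ^ (2 * (s + k)) * p ^ (s + k) * m ^ (2 * k) +
        4 ^ k * k.factorial ^ 2 * p ^ (2 * s) * ((p * m) ^ k * p ^ (k * (k - 1) / 2))) *
      vinogradovCount k s m := by
  have hev := ((eventually_all (l := atTop)).2 fun c : Fin p => (eventually_coincidences_cast
      (residueChoices p k m ×ˢ Fintype.piFinset fun _ : Fin s => range m)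
      (fun a => ∑ c, powVec k (residueLift a.1 c) + ∑ l, powVec k ((c : ℕ) + p * a.2 l))).and
    (eventually_coincidences_cast (Fintype.piFinset fun _ : Fin s => range m)
      (fun y => ∑ l, powVec k ((c : ℕ) + p * y l))))
  obtain ⟨q, hq, hq0⟩ := (hev.and (eventually_ge_atTop 1)).exists
  have : NeZero q := ⟨by omega⟩
  let ρ : (Fin k → ℤ) →+ (Fin k → ZMod q) := (Int.castAddHom (ZMod q)).compLeft (Fin k)
  have hρ : ∀ u : Fin k → ℤ, ρ u = fun j => (u j : ZMod q) := fun u => rfl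
  set G := Fin k → ZMod q
  have hG : (0 : ℝ) < Fintype.card G := by exact_mod_cast Fintype.card_pos
  let f : AddChar G ℂ → Fin p → ℂ := fun ψ c => ∑ y ∈ range m, ψ (ρ (powVec k ((c : ℕ) + p * y)))
  have hlow : (Fintype.card G : ℝ) * vinogradovCount k (s + k) (p * m) ≤
      ∑ ψ : AddChar G ℂ, ‖∑ c, f ψ c‖ ^ (2 * (s + k)) := by
    have h1 : ∀ ψ : AddChar G ℂ, ‖∑ c, f ψ c‖ ^ (2 * (s + k)) =
        ‖∑ x ∈ Fintype.piFinset fun _ : Fin (s + k) => range (p * m),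
          ψ (ρ (∑ i, powVec k (x i)))‖ ^ 2 := by
      intro ψ
      have h2 := addChar_sum_pow (ψ.compAddMonoidHom ρ) (p * m) (s + k) (fun x => powVec k x)
      simp only [AddChar.compAddMonoidHom_apply] at h2
      rw [← h2, sum_range_mul_eq, norm_pow, ← pow_mul, mul_comm 2]
      simp [f]
    simp_rw [h1]
    rw [sum_addChar_norm_sq]
    gcongr
    exact coincidences_mono_of_imp subset_rfl fun a _ b _ h => by rw [h]
  have hM : ∀ ψ c, ‖f ψ c‖ ≤ m := by
    intro ψ c
    refine (norm_sum_le _ _).trans ?_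
    simp [AddChar.norm_apply]
  have hsum1 : ∀ c, ∑ ψ : AddChar G ℂ, ‖f ψ c‖ ^ (2 * s) ≤
      Fintype.card G * vinogradovCount k s m := by
    intro c
    have h1 : ∀ ψ : AddChar G ℂ, ‖f ψ c‖ ^ (2 * s) =
        ‖∑ y ∈ Fintype.piFinset fun _ : Fin s => range m,
          ψ (ρ (∑ l, powVec k ((c : ℕ) + p * y l)))‖ ^ 2 := by
      intro ψ
      have h2 := addChar_sum_pow (ψ.compAddMonoidHom ρ) m s (fun x => powVec k ((c : ℕ) + p * x))
      simp only [AddChar.compAddMonoidHom_apply] at h2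
      rw [← h2, norm_pow, ← pow_mul, mul_comm 2]
    simp_rw [h1]
    rw [sum_addChar_norm_sq]
    gcongr
    exact (hq c).2.trans (coincidences_progression_le hp.pos _)
  have hsum2 : ∀ c, ∑ ψ : AddChar G ℂ, ‖elemSymm (f ψ) k * f ψ c ^ s‖ ^ 2 ≤
      Fintype.card G * ((p * m) ^ k * p ^ (k * (k - 1) / 2) * vinogradovCount k s m) := by
    intro c
    have h1 : ∀ ψ : AddChar G ℂ, elemSymm (f ψ) k * f ψ c ^ s =
        ∑ a ∈ residueChoices p k m ×ˢ Fintype.piFinset fun _ : Fin s => range m,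
          ψ (ρ (∑ c, powVec k (residueLift a.1 c) + ∑ l, powVec k ((c : ℕ) + p * a.2 l))) := by
      intro ψ
      have h2 := addChar_sum_pow (ψ.compAddMonoidHom ρ) m s (fun x => powVec k ((c : ℕ) + p * x))
      have h3 := elemSymm_addChar (p := p) (m := m) (ψ.compAddMonoidHom ρ)
      simp only [AddChar.compAddMonoidHom_apply] at h2 h3
      simp only [f]
      rw [h2, h3, sum_mul_sum, sum_product]
      simp only [map_add, AddChar.map_add_eq_mul]
    simp_rw [h1]
    rw [sum_addChar_norm_sq]
    gcongr
    exact_mod_cast (hq c).1.trans (coincidences_residueChoices_le hp hk hkp hpm _)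
  have hup : ∑ ψ : AddChar G ℂ, ‖∑ c, f ψ c‖ ^ (2 * (s + k)) ≤
      (4 * k) ^ (2 * (s + k)) * p ^ (s + k - 1) * m ^ (2 * k) *
        ∑ c : Fin p, (Fintype.card G * vinogradovCount k s m : ℝ) +
      4 ^ k * k.factorial ^ 2 * p ^ (2 * s - 1) * ∑ c : Fin p,
        (Fintype.card G * ((p * m) ^ k * p ^ (k * (k - 1) / 2) * vinogradovCount k s m) : ℝ) := by
    refine (sum_le_sum fun ψ _ => norm_sum_pow_le_of_norm_le (f ψ) hk hs (hM ψ)).trans ?_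
    rw [sum_add_distrib, ← mul_sum, ← mul_sum, sum_comm, Fintype.card_fin]
    rw [sum_comm (f := fun ψ c => ‖elemSymm (f ψ) k * f ψ c ^ s‖ ^ 2)]
    gcongr with c _ c _
    · exact hsum1 c
    · exact hsum2 c
  have := hlow.trans hup
  rw [sum_const, sum_const, card_univ, Fintype.card_fin, nsmul_eq_mul, nsmul_eq_mul] at this
  refine le_of_mul_le_mul_left (this.trans_eq ?_) hG
  obtain ⟨a, rfl⟩ : ∃ a, s = a + 1 := ⟨s - 1, by omega⟩
  rw [show a + 1 + k - 1 = a + k by omega, show 2 * (a + 1) - 1 = 2 * a + 1 by omega]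
  ring

/-- The number of variables after `τ` steps of the iteration. -/
def iterCount (k τ : ℕ) : ℕ := k * (k + τ)

/-- The exponent in the mean value theorem after `τ` steps of the iteration. -/
noncomputable def meanExponent (k τ : ℕ) : ℝ :=
  2 * iterCount k τ - k * (k + 1) / 2 * (1 - (1 - 1 / k) ^ τ)

theorem meanExponent_succ {k : ℕ} (hk : 0 < k) (τ : ℕ) :
    k * meanExponent k (τ + 1) =
      (2 * iterCount k τ + k * (k + 1) / 2) + (k - 1) * (k + meanExponent k τ) := by
  have : (k : ℝ) ≠ 0 := by positivity
  unfold meanExponent iterCount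
  push_cast
  rw [pow_succ]
  field_simp
  ring

theorem meanExponent_mem {k : ℕ} (hk : 0 < k) (τ : ℕ) :
    2 * iterCount k τ - (k : ℝ) * (k + 1) / 2 ≤ meanExponent k τ ∧
      meanExponent k τ ≤ 2 * iterCount k τ := by
  have hk1 : (1 : ℝ) ≤ k := by exact_mod_cast hk
  have h0 : 0 ≤ 1 - 1 / (k : ℝ) := by
    rw [sub_nonneg, div_le_one (by positivity)]
    exact hk1
  have h1 : (1 - 1 / (k : ℝ)) ^ τ ≤ 1 := pow_le_one₀ h0 (by simp)
  have h2 : 0 ≤ (1 - 1 / (k : ℝ)) ^ τ := pow_nonneg h0 _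
  have h3 : 0 ≤ (k : ℝ) * (k + 1) / 2 := by positivity
  unfold meanExponent
  constructor <;> nlinarith

theorem recurrence_bracket_le {p k m s : ℕ} (hk : 0 < k) (hp : 0 < p) (hm : m ≤ p ^ (k - 1))
    (hs : k * k ≤ s) :
    ((4 * k) ^ (2 * (s + k)) * p ^ (s + k) * m ^ (2 * k) +
        4 ^ k * k.factorial ^ 2 * p ^ (2 * s) * ((p * m) ^ k * p ^ (k * (k - 1) / 2)) : ℝ) ≤
      2 * (4 * k) ^ (2 * (s + k)) * p ^ (2 * s + k * (k + 1) / 2) * m ^ k := by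
  have hk1 : (1 : ℝ) ≤ k := by exact_mod_cast hk
  have hp1 : (1 : ℝ) ≤ p := by exact_mod_cast hp
  have h1 : ((4 * k) ^ (2 * (s + k)) * p ^ (s + k) * m ^ (2 * k) : ℝ) ≤
      (4 * k) ^ (2 * (s + k)) * p ^ (2 * s + k * (k + 1) / 2) * m ^ k := by
    have h2 : (m : ℝ) ^ k ≤ p ^ (k * (k - 1)) := by
      rw [mul_comm k, pow_mul]
      gcongr
      exact_mod_cast hm
    calc ((4 * k) ^ (2 * (s + k)) * p ^ (s + k) * m ^ (2 * k) : ℝ) =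
        (4 * k) ^ (2 * (s + k)) * (p ^ (s + k) * m ^ k) * m ^ k := by ring
      _ ≤ (4 * k) ^ (2 * (s + k)) * (p ^ (s + k) * p ^ (k * (k - 1))) * m ^ k := by gcongr
      _ = (4 * k) ^ (2 * (s + k)) * p ^ (s + k + k * (k - 1)) * m ^ k := by rw [pow_add _ (s + k)]
      _ ≤ _ := by
        have : k * (k - 1) + k = k * k := by
          rw [Nat.mul_sub, mul_one, Nat.sub_add_cancel (Nat.le_mul_self k)]
        have hle : s + k + k * (k - 1) ≤ 2 * s + k * (k + 1) / 2 := by omega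
        gcongr ?_ * ?_ * ?_
        exact pow_le_pow_right₀ hp1 hle
  have h3 : (4 ^ k * k.factorial ^ 2 * p ^ (2 * s) * ((p * m) ^ k * p ^ (k * (k - 1) / 2)) : ℝ) ≤
      (4 * k) ^ (2 * (s + k)) * p ^ (2 * s + k * (k + 1) / 2) * m ^ k := by
    have h4 : k + k * (k - 1) / 2 = k * (k + 1) / 2 := by
      obtain ⟨a, rfl⟩ : ∃ a, k = a + 1 := ⟨k - 1, by omega⟩
      simp only [Nat.add_sub_cancel]
      have h6 : (a + 1) * (a + 1 + 1) = (a + 1) * a + 2 * (a + 1) := by ring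
      omega
    have h5 : (4 ^ k * k.factorial ^ 2 : ℝ) ≤ (4 * k) ^ (2 * (s + k)) := by
      calc (4 ^ k * k.factorial ^ 2 : ℝ) ≤ 4 ^ k * (k ^ k) ^ 2 := by
            gcongr
            exact_mod_cast Nat.factorial_le_pow k
        _ ≤ (4 ^ 2) ^ k * (k ^ k) ^ 2 := by gcongr; norm_num
        _ = (4 * k) ^ (2 * k) := by rw [mul_pow, ← pow_mul, ← pow_mul, mul_comm k 2]
        _ ≤ _ := by
          gcongr
          · linarith
          · omega
    calc (4 ^ k * k.factorial ^ 2 * p ^ (2 * s) * ((p * m) ^ k * p ^ (k * (k - 1) / 2)) : ℝ) =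
        4 ^ k * k.factorial ^ 2 * p ^ (2 * s + (k + k * (k - 1) / 2)) * m ^ k := by
          rw [pow_add, pow_add]; ring
      _ ≤ _ := by
        rw [h4]
        gcongr
  linarith

theorem recurrence_const_le {k s : ℕ} (hk : 0 < k) :
    (2 * (4 * k) ^ (2 * (s + k)) * 4 ^ (3 * (s + k)) * 2 ^ (2 * (s + k)) : ℝ) ≤
      (100 * k) ^ (4 * (s + k)) := by
  have hk1 : (1 : ℝ) ≤ k := by exact_mod_cast hk
  have h2 : (2 : ℝ) ≤ 2 ^ (s + k) := le_self_pow₀ (by norm_num) (by omega)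
  calc (2 * (4 * k) ^ (2 * (s + k)) * 4 ^ (3 * (s + k)) * 2 ^ (2 * (s + k)) : ℝ) ≤
      2 ^ (s + k) * (4 * k) ^ (2 * (s + k)) * 4 ^ (3 * (s + k)) * 2 ^ (2 * (s + k)) := by
        gcongr
    _ = (2 * (4 * k) ^ 2 * 4 ^ 3 * 2 ^ 2) ^ (s + k) := by
      rw [pow_mul, pow_mul, pow_mul, ← mul_pow, ← mul_pow, ← mul_pow]
    _ ≤ ((100 * k) ^ 4) ^ (s + k) := by
      refine pow_le_pow_left₀ (by positivity) ?_ _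
      have : (k : ℝ) ^ 2 ≤ k ^ 4 := pow_le_pow_right₀ hk1 (by norm_num)
      nlinarith
    _ = _ := by rw [← pow_mul]

theorem rearrange_le {a c p m e p₁ p₂ m₁ m₂ : ℝ} (ha : 0 ≤ a) (hc : 0 ≤ c) (hp : 0 ≤ p)
    (hm : 0 ≤ m * e) (h₁ : p ≤ p₁ * p₂) (h₂ : m * e ≤ m₁ * m₂) :
    2 * a * p * m * (c * e) ≤ 2 * a * p₁ * m₁ * c * (p₂ * m₂) := by
  have := mul_le_mul h₁ h₂ hm (hp.trans h₁)
  have := mul_le_mul_of_nonneg_left this (mul_nonneg ha hc)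
  linarith

/-- Vinogradov's mean value theorem, in the form obtained by `p`-adic iteration. -/
theorem vinogradovCount_mean_value {k : ℕ} (hk : 2 ≤ k) (τ : ℕ) {P : ℕ} (hP : 1 ≤ P) :
    (vinogradovCount k (iterCount k τ) P : ℝ) ≤
      (100 * k) ^ (4 * iterCount k τ * (k + τ)) * (P : ℝ) ^ meanExponent k τ := by
  have hk0 : 0 < k := by omega
  have hk1 : (2 : ℝ) ≤ k := by exact_mod_cast hk
  induction τ generalizing P with
  | zero =>
    have h1 : (vinogradovCount k (iterCount k 0) P : ℝ) ≤ (P : ℝ) ^ (2 * iterCount k 0) := by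
      exact_mod_cast vinogradovCount_le k (iterCount k 0) P
    have h2 : (P : ℝ) ^ meanExponent k 0 = (P : ℝ) ^ (2 * iterCount k 0) := by
      rw [← Real.rpow_natCast]
      simp [meanExponent]
    rw [h2]
    refine h1.trans (le_mul_of_one_le_left (by positivity) (one_le_pow₀ (by linarith)))
  | succ τ ih =>
    set s := iterCount k τ with hs
    have hs' : iterCount k (τ + 1) = s + k := by rw [hs]; unfold iterCount; ring
    have hsk : k * k ≤ s := by rw [hs]; unfold iterCount; gcongr; omega
    have hP1 : (1 : ℝ) ≤ P := by exact_mod_cast hP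
    have hmem := meanExponent_mem hk0 τ
    have hmem' := meanExponent_mem hk0 (τ + 1)
    have hsucc := meanExponent_succ hk0 τ
    rw [← hs] at hmem hsucc
    rw [hs'] at hmem' ⊢
    push_cast at hmem'
    set E := meanExponent k τ
    clear_value s
    set E' := meanExponent k (τ + 1)
    clear_value E E'
    rcases lt_or_ge P (k ^ k) with hlt | hge
    · have h1 : (vinogradovCount k (s + k) P : ℝ) ≤ (P : ℝ) ^ (2 * (s + k)) := by
        exact_mod_cast vinogradovCount_le k (s + k) P
      have h2 : (P : ℝ) ^ (2 * (s + k)) ≤ (P : ℝ) ^ E' * (P : ℝ) ^ (k * k) := by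
        rw [← Real.rpow_natCast, ← Real.rpow_natCast, ← Real.rpow_add (by linarith)]
        apply Real.rpow_le_rpow_of_exponent_le hP1
        push_cast
        nlinarith
      have h3 : (P : ℝ) ^ (k * k) ≤ (100 * k) ^ (4 * (s + k) * (k + (τ + 1))) := by
        calc (P : ℝ) ^ (k * k) ≤ ((k : ℝ) ^ k) ^ (k * k) := by
              gcongr
              exact_mod_cast hlt.le
          _ = (k : ℝ) ^ (k * (k * k)) := by rw [← pow_mul]
          _ ≤ (100 * k) ^ (k * (k * k)) := by gcongr; linarith
          _ ≤ _ := by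
            refine pow_le_pow_right₀ (by linarith) ?_
            have : k * (k * k) ≤ (k + (τ + 1)) * (s + k) := Nat.mul_le_mul (by omega) (by omega)
            nlinarith
      calc _ ≤ _ := h1
        _ ≤ _ := h2
        _ ≤ (P : ℝ) ^ E' * (100 * k) ^ (4 * (s + k) * (k + (τ + 1))) := by gcongr
        _ = _ := mul_comm _ _
    · set X := (P : ℝ) ^ (1 / (k : ℝ)) with hX
      have hX1 : 1 ≤ X := Real.one_le_rpow hP1 (by positivity)
      have hXk : X ^ k = P := by
        rw [hX, ← Real.rpow_natCast, ← Real.rpow_mul (by linarith)]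
        rw [one_div_mul_cancel (by positivity), Real.rpow_one]
      have hkX : (k : ℝ) ≤ X := by
        refine le_of_pow_le_pow_left₀ hk0.ne' (by linarith) ?_
        rw [hXk]
        exact_mod_cast hge
      obtain ⟨p, hp, hyp, hpy⟩ := Nat.exists_prime_lt_and_le_two_mul ⌈X⌉₊
        (by have := Nat.ceil_pos.2 (by linarith : 0 < X); omega)
      have hXp : X < p := lt_of_le_of_lt (Nat.le_ceil X) (by exact_mod_cast hyp)
      have hpX : (p : ℝ) ≤ 4 * X := by
        have h1 := Nat.ceil_lt_add_one (by linarith : 0 ≤ X)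
        have h2 : (p : ℝ) ≤ 2 * ⌈X⌉₊ := by exact_mod_cast hpy
        linarith
      have hkp : k < p := by exact_mod_cast hkX.trans_lt hXp
      have hPp : P < p ^ k := by
        have : X ^ k < (p : ℝ) ^ k := pow_lt_pow_left₀ hXp (by linarith) hk0.ne'
        rw [hXk] at this
        exact_mod_cast this
      obtain ⟨m, hm⟩ : ∃ m, m = P / p + 1 := ⟨_, rfl⟩
      have hpp : p ^ k = p * p ^ (k - 1) := by
        rw [← pow_succ', Nat.sub_add_cancel hk0]
      have hmp : m ≤ p ^ (k - 1) := by
        have : P / p < p ^ (k - 1) := Nat.div_lt_of_lt_mul (by rwa [← hpp])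
        omega
      have hPm : P ≤ p * m := by
        have := Nat.lt_mul_div_succ P hp.pos
        rw [hm]
        exact this.le
      have hmX : (m : ℝ) ≤ 2 * X ^ (k - 1) := by
        have h1 : ((P / p : ℕ) : ℝ) ≤ P / p := Nat.cast_div_le
        have h2 : (P : ℝ) / p ≤ X ^ (k - 1) := by
          rw [div_le_iff₀ (by linarith), ← hXk]
          calc X ^ k = X ^ (k - 1) * X := by rw [← pow_succ, Nat.sub_add_cancel hk0]
            _ ≤ _ := by gcongr
        have h3 : 1 ≤ X ^ (k - 1) := one_le_pow₀ hX1
        rw [hm, Nat.cast_add, Nat.cast_one]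
        linarith
      have hrec := vinogradovCount_recurrence (m := m) (s := s) hp hk0 hkp
        (by rw [hpp]; exact Nat.mul_le_mul_left _ hmp)
        ((Nat.mul_pos hk0 hk0).trans_le hsk)
      have hm1 : 1 ≤ m := hm ▸ Nat.le_add_left 1 _
      have hbr := recurrence_bracket_le hk0 hp.pos hmp hsk
      set κ := k * (k + 1) / 2 with hκ
      have hκ2 : (κ : ℝ) = k * (k + 1) / 2 := by
        have : 2 * κ = k * (k + 1) := Nat.mul_div_cancel' (Nat.even_mul_succ_self k).two_dvd
        have : (2 * κ : ℝ) = k * (k + 1) := by exact_mod_cast this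
        linarith
      have hκs : κ ≤ s := by
        have : k * (k + 1) / 2 ≤ k * k := Nat.div_le_of_le_mul (by nlinarith)
        omega
      have hE0 : 0 ≤ E := by
        have : (κ : ℝ) ≤ s := by exact_mod_cast hκs
        rw [hκ2] at this
        have : (0 : ℝ) ≤ s := by positivity
        linarith
      have hmpow : (m : ℝ) ^ k * (m : ℝ) ^ E ≤ 2 ^ (2 * (s + k)) * X ^ ((k - 1) * (k + E)) := by
        rw [← Real.rpow_natCast, ← Real.rpow_add (by positivity)]
        calc (m : ℝ) ^ (k + E) ≤ (2 * X ^ (k - 1)) ^ (k + E) := by gcongr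
          _ = 2 ^ (k + E) * X ^ ((k - 1) * (k + E)) := by
            rw [Real.mul_rpow (by norm_num) (by positivity), ← Real.rpow_natCast X,
              ← Real.rpow_mul (by linarith), Nat.cast_sub (by omega), Nat.cast_one]
          _ ≤ _ := by
            gcongr
            rw [← Real.rpow_natCast]
            apply Real.rpow_le_rpow_of_exponent_le (by norm_num)
            push_cast
            linarith
      have hppow : (p : ℝ) ^ (2 * s + κ) ≤ 4 ^ (3 * (s + k)) * X ^ (2 * s + k * (k + 1) / 2 : ℝ) := by
        calc (p : ℝ) ^ (2 * s + κ) ≤ (4 * X) ^ (2 * s + κ) := by gcongr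
          _ = 4 ^ (2 * s + κ) * X ^ (2 * s + k * (k + 1) / 2 : ℝ) := by
            rw [mul_pow, ← Real.rpow_natCast X]
            push_cast
            rw [hκ2]
          _ ≤ _ := by
            gcongr
            · norm_num
            · omega
      have hXE : X ^ (2 * s + k * (k + 1) / 2 : ℝ) * X ^ ((k - 1) * (k + E)) = (P : ℝ) ^ E' := by
        rw [← Real.rpow_add (by linarith), ← hsucc, Real.rpow_mul (by linarith),
          Real.rpow_natCast, hXk]
      have hconst := recurrence_const_le (s := s) hk0
      calc (vinogradovCount k (s + k) P : ℝ) ≤ vinogradovCount k (s + k) (p * m) := by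
            exact_mod_cast vinogradovCount_mono k (s + k) hPm
        _ ≤ _ := hrec
        _ ≤ (2 * (4 * k) ^ (2 * (s + k)) * p ^ (2 * s + κ) * m ^ k) *
            ((100 * k) ^ (4 * s * (k + τ)) * (m : ℝ) ^ E) :=
          mul_le_mul hbr (ih hm1) (by positivity) (by positivity)
        _ ≤ (2 * (4 * k) ^ (2 * (s + k)) * 4 ^ (3 * (s + k)) * 2 ^ (2 * (s + k))) *
            (100 * k) ^ (4 * s * (k + τ)) * (P : ℝ) ^ E' := by
          rw [← hXE]
          exact rearrange_le (by positivity) (by positivity) (by positivity) (by positivity)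
            hppow hmpow
        _ ≤ (100 * k) ^ (4 * (s + k)) * (100 * k) ^ (4 * s * (k + τ)) * (P : ℝ) ^ E' := by gcongr
        _ ≤ _ := by
          rw [← pow_add]
          refine mul_le_mul_of_nonneg_right (pow_le_pow_right₀ (by linarith) ?_) (by positivity)
          have h1 : 4 * (s + k) + 4 * s * (k + τ) ≤ 4 * (s + k) + 4 * (s + k) * (k + τ) := by
            gcongr
            omega
          exact h1.trans_eq (by ring)

/-- The additive character `t ↦ exp (2πit)` of the real line. -/
noncomputable def expi (t : ℝ) : ℂ := Complex.exp ((2 * π * t : ℝ) * Complex.I)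

theorem expi_zero : expi 0 = 1 := by simp [expi]

theorem expi_add (a b : ℝ) : expi (a + b) = expi a * expi b := by
  rw [expi, expi, expi, ← Complex.exp_add]
  congr 1
  push_cast
  ring

theorem norm_expi (t : ℝ) : ‖expi t‖ = 1 := Complex.norm_exp_ofReal_mul_I _

theorem conj_expi (t : ℝ) : (starRingEnd ℂ) (expi t) = expi (-t) := by
  rw [expi, expi, ← Complex.exp_conj, map_mul, Complex.conj_ofReal, Complex.conj_I]
  congr 1
  push_cast
  ring

theorem expi_sum {ι : Type*} (s : Finset ι) (f : ι → ℝ) :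
    expi (∑ i ∈ s, f i) = ∏ i ∈ s, expi (f i) := by
  classical
  induction s using Finset.induction_on with
  | empty => simp [expi_zero]
  | insert a s ha ih => rw [sum_insert ha, prod_insert ha, expi_add, ih]

theorem expi_natCast_mul (n : ℕ) (t : ℝ) : expi (n * t) = expi t ^ n := by
  rw [expi, expi, ← Complex.exp_nat_mul]
  congr 1
  push_cast
  ring

theorem norm_expi_sub_one_ge {t : ℝ} (ht : |t| ≤ 1 / 2) : 4 * |t| ≤ ‖expi t - 1‖ := by
  rw [expi, mul_comm _ Complex.I, Complex.norm_exp_I_mul_ofReal_sub_one, norm_mul]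
  have h1 : 2 * π * t / 2 = π * t := by ring
  rw [h1, Real.norm_eq_abs, Real.norm_eq_abs, abs_of_pos (by norm_num : (0 : ℝ) < 2)]
  have h2 : |Real.sin (π * t)| = Real.sin (π * |t|) := by
    rcases abs_cases t with ⟨h, h'⟩ | ⟨h, h'⟩
    · rw [h]
      apply abs_of_nonneg
      apply Real.sin_nonneg_of_nonneg_of_le_pi (by positivity)
      nlinarith [Real.pi_pos]
    · rw [h, mul_neg, Real.sin_neg]
      apply abs_of_nonpos
      apply Real.sin_nonpos_of_nonpos_of_neg_pi_le
      · nlinarith [Real.pi_pos]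
      · nlinarith [Real.pi_pos]
  rw [h2]
  have h3 := Real.mul_le_sin (x := π * |t|) (by positivity) (by nlinarith [Real.pi_pos])
  have h4 : 2 / π * (π * |t|) = 2 * |t| := by field_simp
  linarith

theorem norm_expi_sub_expi_le (a b : ℝ) : ‖expi a - expi b‖ ≤ 2 * π * |a - b| := by
  have h1 : expi a - expi b = expi b * (expi (a - b) - 1) := by
    rw [mul_sub, ← expi_add, mul_one]
    congr 2
    ring
  rw [h1, norm_mul, norm_expi, one_mul, expi, mul_comm _ Complex.I]
  refine (Real.norm_exp_I_mul_ofReal_sub_one_le).trans ?_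
  rw [Real.norm_eq_abs, abs_mul, abs_of_pos (by positivity : 0 < 2 * π)]

theorem norm_sum_Icc_expi_le (M : ℕ) {t : ℝ} (ht0 : t ≠ 0) (ht : |t| ≤ 1 / 2) :
    ‖∑ l ∈ Icc (-(M : ℤ)) M, expi (t * l)‖ ≤ 1 / (2 * |t|) := by
  have h1 : ∑ l ∈ Icc (-(M : ℤ)) M, expi (t * l) =
      expi (-(t * M)) * ∑ i ∈ range (2 * M + 1), expi t ^ i := by
    rw [mul_sum]
    symm
    refine sum_bij (fun i _ => (i : ℤ) - M) ?_ ?_ ?_ ?_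
    · intro i hi
      simp only [mem_range, mem_Icc] at hi ⊢
      omega
    · intro i _ j _ h
      simpa using h
    · intro l hl
      simp only [mem_Icc] at hl
      refine ⟨(l + M).toNat, ?_, ?_⟩
      · simp only [mem_range]
        omega
      · have : 0 ≤ l + M := by omega
        rw [Int.toNat_of_nonneg this]
        ring
    · intro i _
      rw [← expi_natCast_mul, ← expi_add]
      congr 1
      push_cast
      ring
  have h2 := norm_expi_sub_one_ge ht
  have ht' : 0 < |t| := abs_pos.2 ht0
  have h3 : 0 < ‖expi t - 1‖ := by linarith
  have h4 : expi t ≠ 1 := fun h => by simp [h] at h3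
  rw [h1, norm_mul, norm_expi, one_mul, geom_sum_eq h4, norm_div, div_le_div_iff₀ h3 (by positivity)]
  have h5 : ‖expi t ^ (2 * M + 1) - 1‖ ≤ 2 := by
    refine (norm_sub_le _ _).trans ?_
    rw [norm_pow, norm_expi]
    norm_num
  nlinarith

/-- The double sum attached to one coefficient in the bilinear estimate. -/
noncomputable def boxSum (α : ℝ) (M : ℕ) : ℝ :=
  ∑ l ∈ Icc (-(M : ℤ)) M, ‖∑ r ∈ Icc (-(M : ℤ)) M, expi (α * l * r)‖

theorem boxSum_nonneg (α : ℝ) (M : ℕ) : 0 ≤ boxSum α M := sum_nonneg fun _ _ => norm_nonneg _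

theorem norm_sum_Icc_expi_le_card (M : ℕ) (t : ℝ) :
    ‖∑ r ∈ Icc (-(M : ℤ)) M, expi (t * r)‖ ≤ 2 * M + 1 := by
  refine (norm_sum_le _ _).trans ?_
  simp only [norm_expi, sum_const, Int.card_Icc, nsmul_eq_mul, mul_one]
  have : ((M : ℤ) + 1 - -(M : ℤ)).toNat = 2 * M + 1 := by omega
  rw [this]
  push_cast
  exact le_rfl

theorem boxSum_le (α : ℝ) {M : ℕ} (hM : 1 ≤ M) : boxSum α M ≤ (3 * M) ^ 2 := by
  have hM1 : (1 : ℝ) ≤ M := by exact_mod_cast hM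
  have h1 : boxSum α M ≤ ∑ l ∈ Icc (-(M : ℤ)) M, (2 * M + 1 : ℝ) :=
    sum_le_sum fun l _ => norm_sum_Icc_expi_le_card M _
  have h2 : ((M : ℤ) + 1 - -(M : ℤ)).toNat = 2 * M + 1 := by omega
  rw [sum_const, Int.card_Icc, h2, nsmul_eq_mul] at h1
  push_cast at h1
  nlinarith

theorem boxSum_le_of_small {α : ℝ} {M : ℕ} (hM : 1 ≤ M) (hα : α ≠ 0) (hαM : |α| * M ≤ 1 / 2) :
    boxSum α M ≤ 3 * M + (1 + Real.log M) / |α| := by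
  have hM1 : (1 : ℝ) ≤ M := by exact_mod_cast hM
  have hα0 : 0 < |α| := abs_pos.2 hα
  let g : ℤ → ℝ := fun l => ‖∑ r ∈ Icc (-(M : ℤ)) M, expi (α * l * r)‖
  have hsplit : Icc (-(M : ℤ)) M =
      ({0} ∪ (Icc 1 M).image (fun n : ℕ => (n : ℤ))) ∪ (Icc 1 M).image (fun n : ℕ => -(n : ℤ)) := by
    ext l
    simp only [mem_Icc, mem_union, mem_singleton, mem_image]
    constructor
    · intro h
      rcases lt_trichotomy l 0 with h0 | h0 | h0
      · exact Or.inr ⟨l.natAbs, by omega, by omega⟩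
      · exact Or.inl (Or.inl h0)
      · exact Or.inl (Or.inr ⟨l.natAbs, by omega, by omega⟩)
    · rintro ((h | ⟨a, h, rfl⟩) | ⟨a, h, rfl⟩) <;> omega
  have hg : ∀ l, 0 ≤ g l := fun l => norm_nonneg _
  have hbound : ∀ l : ℤ, l ≠ 0 → |l| ≤ M → g l ≤ 1 / (2 * (|α| * |(l : ℝ)|)) := by
    intro l hl hlM
    have h1 : |(l : ℝ)| ≤ M := by exact_mod_cast hlM
    rw [← abs_mul]
    apply norm_sum_Icc_expi_le M (mul_ne_zero hα (by exact_mod_cast hl))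
    rw [abs_mul]
    exact (mul_le_mul_of_nonneg_left h1 hα0.le).trans hαM
  have hharm : ∑ n ∈ Icc 1 M, (1 / (2 * (|α| * (n : ℝ)))) ≤ (1 + Real.log M) / (2 * |α|) := by
    have h1 := harmonic_le_one_add_log M
    rw [harmonic_eq_sum_Icc] at h1
    push_cast at h1
    calc ∑ n ∈ Icc 1 M, (1 / (2 * (|α| * (n : ℝ)))) = (∑ n ∈ Icc 1 M, (n : ℝ)⁻¹) / (2 * |α|) := by
          rw [sum_div]
          refine sum_congr rfl fun n hn => ?_
          have : (n : ℝ) ≠ 0 := by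
            have := (mem_Icc.1 hn).1
            positivity
          field_simp
      _ ≤ _ := by gcongr
  have hle : boxSum α M ≤ g 0 + ∑ n ∈ Icc 1 M, g (n : ℤ) + ∑ n ∈ Icc 1 M, g (-(n : ℤ)) := by
    have h1 : ∀ A B : Finset ℤ, ∑ l ∈ A ∪ B, g l ≤ ∑ l ∈ A, g l + ∑ l ∈ B, g l := fun A B => by
      rw [← sum_union_inter]
      exact le_add_of_nonneg_right (sum_nonneg fun l _ => hg l)
    have h2 : boxSum α M = ∑ l ∈ Icc (-(M : ℤ)) M, g l := rfl
    rw [h2]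
    conv_lhs => rw [hsplit]
    refine (h1 _ _).trans ?_
    rw [sum_image (by intro a _ b _ h; simpa using h)]
    gcongr
    refine (h1 _ _).trans ?_
    rw [sum_image (by intro a _ b _ h; simpa using h), sum_singleton]
  have hg0 : g 0 ≤ 2 * M + 1 := norm_sum_Icc_expi_le_card M _
  have hpos : ∑ n ∈ Icc 1 M, g (n : ℤ) ≤ (1 + Real.log M) / (2 * |α|) := by
    refine (sum_le_sum fun n hn => ?_).trans hharm
    have hn := mem_Icc.1 hn
    refine (hbound n (by omega) (by rw [abs_of_nonneg] <;> omega)).trans_eq ?_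
    simp
  have hneg : ∑ n ∈ Icc 1 M, g (-(n : ℤ)) ≤ (1 + Real.log M) / (2 * |α|) := by
    refine (sum_le_sum fun n hn => ?_).trans hharm
    have hn := mem_Icc.1 hn
    refine (hbound (-n) (by omega) (by rw [abs_neg, abs_of_nonneg] <;> omega)).trans_eq ?_
    simp
  have hhalf : (1 + Real.log M) / |α| = (1 + Real.log M) / (2 * |α|) +
      (1 + Real.log M) / (2 * |α|) := by field_simp; ring
  linarith

/-- The bilinear phase `∑ⱼ αⱼ uⱼ wⱼ` as a character in the first integer vector. -/
noncomputable def biChar {k : ℕ} (α : Fin k → ℝ) (w : Fin k → ℤ) : AddChar (Fin k → ℤ) ℂ where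
  toFun u := expi (∑ j, α j * u j * w j)
  map_zero_eq_one' := by simp [expi_zero]
  map_add_eq_mul' u v := by
    rw [← expi_add, ← sum_add_distrib]
    congr 1
    refine sum_congr rfl fun j _ => ?_
    simp only [Pi.add_apply]
    push_cast
    ring

theorem biChar_apply {k : ℕ} (α : Fin k → ℝ) (w u : Fin k → ℤ) :
    biChar α w u = expi (∑ j, α j * u j * w j) := rfl

theorem biChar_comm {k : ℕ} (α : Fin k → ℝ) (w u : Fin k → ℤ) :
    biChar α w u = biChar α u w := by
  rw [biChar_apply, biChar_apply]
  congr 1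
  exact sum_congr rfl fun j _ => by ring

theorem norm_sum_biChar_pow {k : ℕ} (α : Fin k → ℝ) (w : Fin k → ℤ) (Q s : ℕ) :
    ((‖∑ a ∈ range Q, biChar α w (powVec k a)‖ ^ (2 * s) : ℝ) : ℂ) =
      ∑ q ∈ (Fintype.piFinset fun _ : Fin s => range Q) ×ˢ
        (Fintype.piFinset fun _ : Fin s => range Q),
        biChar α w (∑ i, powVec k (q.1 i) - ∑ i, powVec k (q.2 i)) := by
  rw [mul_comm, pow_mul, ← norm_pow, addChar_sum_pow (biChar α w) Q s (fun a => powVec k a),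
    Complex.ofReal_pow, ← Complex.mul_conj', map_sum, sum_mul_sum, sum_product]
  refine sum_congr rfl fun x _ => sum_congr rfl fun y _ => ?_
  rw [sub_eq_add_neg, AddChar.map_add_eq_mul]
  congr 1
  rw [biChar_apply, biChar_apply, conj_expi, ← sum_neg_distrib]
  congr 1
  refine sum_congr rfl fun j _ => ?_
  simp only [Pi.neg_apply]
  push_cast
  ring

/-- The box containing all differences of the Vinogradov system. -/
noncomputable def diffBox (k s Q : ℕ) : Finset (Fin k → ℤ) :=
  Fintype.piFinset fun j : Fin k =>
    Icc (-((s * Q ^ (j.val + 1) : ℕ) : ℤ)) ((s * Q ^ (j.val + 1) : ℕ) : ℤ)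

theorem sub_mem_diffBox {k s Q : ℕ} {x y : Fin s → ℕ}
    (hx : x ∈ Fintype.piFinset fun _ : Fin s => range Q)
    (hy : y ∈ Fintype.piFinset fun _ : Fin s => range Q) :
    ∑ i, powVec k (x i) - ∑ i, powVec k (y i) ∈ diffBox k s Q := by
  rw [diffBox, Fintype.mem_piFinset]
  intro j
  have hb : ∀ x ∈ Fintype.piFinset fun _ : Fin s => range Q,
      0 ≤ ∑ i, powVec k (x i) j ∧ ∑ i, powVec k (x i) j ≤ ((s * Q ^ (j.val + 1) : ℕ) : ℤ) := by
    intro x hx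
    refine ⟨sum_nonneg fun i _ => by unfold powVec; positivity, ?_⟩
    have : ∀ i ∈ (univ : Finset (Fin s)), powVec k (x i) j ≤ (Q : ℤ) ^ (j.val + 1) := by
      intro i _
      unfold powVec
      have := mem_range.1 (Fintype.mem_piFinset.1 hx i)
      gcongr
    refine (sum_le_sum this).trans ?_
    simp
  have h1 := hb x hx
  have h2 := hb y hy
  rw [mem_Icc]
  simp only [Pi.sub_apply, Finset.sum_apply]
  constructor <;> linarith

theorem sum_sub_le_vinogradovCount_mul {k s Q : ℕ} (f : (Fin k → ℤ) → ℝ) (hf : ∀ w, 0 ≤ f w) :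
    ∑ q ∈ (Fintype.piFinset fun _ : Fin s => range Q) ×ˢ
        (Fintype.piFinset fun _ : Fin s => range Q),
        f (∑ i, powVec k (q.1 i) - ∑ i, powVec k (q.2 i)) ≤
      vinogradovCount k s Q * ∑ w ∈ diffBox k s Q, f w := by
  classical
  rw [← sum_fiberwise_of_maps_to (t := diffBox k s Q)
    (g := fun q => ∑ i, powVec k (q.1 i) - ∑ i, powVec k (q.2 i))
    (fun q hq => sub_mem_diffBox (mem_product.1 hq).1 (mem_product.1 hq).2), mul_sum]
  refine sum_le_sum fun w _ => ?_
  have h1 : ∀ q ∈ {q ∈ (Fintype.piFinset fun _ : Fin s => range Q) ×ˢ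
        (Fintype.piFinset fun _ : Fin s => range Q) |
        ∑ i, powVec k (q.1 i) - ∑ i, powVec k (q.2 i) = w},
      f (∑ i, powVec k (q.1 i) - ∑ i, powVec k (q.2 i)) = f w := fun q hq => by
    rw [(mem_filter.1 hq).2]
  rw [sum_congr rfl h1, sum_const, nsmul_eq_mul]
  refine mul_le_mul_of_nonneg_right ?_ (hf w)
  have := card_sub_eq_le_coincidences (Fintype.piFinset fun _ : Fin s => range Q)
    (fun x => ∑ i, powVec k (x i)) w
  refine le_trans (le_of_eq ?_) (Nat.cast_le.2 this)
  congr!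

theorem sum_norm_biChar_diffBox {k s Q : ℕ} (α : Fin k → ℝ) :
    ∑ u ∈ diffBox k s Q, ‖∑ w ∈ diffBox k s Q, biChar α w u‖ =
      ∏ j : Fin k, boxSum (α j) (s * Q ^ (j.val + 1)) := by
  unfold boxSum
  rw [Finset.prod_univ_sum]
  refine sum_congr rfl fun u _ => ?_
  rw [← norm_prod, Finset.prod_univ_sum]
  congr 1
  refine sum_congr rfl fun w _ => ?_
  rw [biChar_apply, expi_sum]

/-- The bilinear estimate obtained from two applications of Hölder's inequality. -/
theorem norm_bilinear_pow_le {k s Q : ℕ} (hs : 0 < s) (α : Fin k → ℝ) :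
    ‖∑ a ∈ range Q, ∑ b ∈ range Q, biChar α (powVec k a) (powVec k b)‖ ^ (4 * s ^ 2) ≤
      (Q : ℝ) ^ (8 * s ^ 2 - 4 * s) * vinogradovCount k s Q ^ 2 *
        ∏ j : Fin k, boxSum (α j) (s * Q ^ (j.val + 1)) := by
  set T := (Fintype.piFinset fun _ : Fin s => range Q) with hT
  set J : ℝ := (vinogradovCount k s Q : ℝ) with hJ
  have hTcard : (#(T ×ˢ T) : ℝ) = (Q : ℝ) ^ (2 * s) := by
    rw [card_product, hT, Fintype.card_piFinset]
    push_cast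
    simp only [card_range, prod_const, card_univ, Fintype.card_fin]
    ring
  let V : (Fin s → ℕ) → Fin k → ℤ := fun x => ∑ i, powVec k (x i)
  let A : (Fin k → ℤ) → ℝ := fun w => ‖∑ a ∈ range Q, biChar α w (powVec k a)‖
  have hA : ∀ w, 0 ≤ A w := fun w => norm_nonneg _
  have real_le : ∀ (x : ℝ) (z : ℂ), (x : ℂ) = z → x ≤ ‖z‖ := fun x z h => by
    rw [← h, Complex.norm_real]
    exact le_abs_self x
  have hholderFst : ‖∑ a ∈ range Q, ∑ b ∈ range Q, biChar α (powVec k a) (powVec k b)‖ ^ (2 * s) ≤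
      (Q : ℝ) ^ (2 * s - 1) * ∑ q ∈ T ×ˢ T, A (V q.1 - V q.2) := by
    have h1 := pow_sum_le_card_pow_mul (range Q) (fun a => A (powVec k a)) (fun a _ => hA _)
      (2 * s) (by omega)
    rw [card_range] at h1
    refine ((pow_le_pow_left₀ (norm_nonneg _) (norm_sum_le _ _) _).trans h1).trans ?_
    gcongr
    refine (real_le _ (∑ q ∈ T ×ˢ T, ∑ a ∈ range Q,
      biChar α (V q.1 - V q.2) (powVec k a)) ?_).trans (norm_sum_le _ _)
    rw [Complex.ofReal_sum, sum_comm]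
    refine sum_congr rfl fun a _ => ?_
    rw [norm_sum_biChar_pow]
    exact sum_congr rfl fun q _ => biChar_comm _ _ _
  have hholderSnd : (∑ q ∈ T ×ˢ T, A (V q.1 - V q.2)) ^ (2 * s) ≤
      ((Q : ℝ) ^ (2 * s)) ^ (2 * s - 1) * (J * ∑ w ∈ diffBox k s Q, A w ^ (2 * s)) := by
    have h1 := pow_sum_le_card_pow_mul (T ×ˢ T) (fun q => A (V q.1 - V q.2)) (fun a _ => hA _)
      (2 * s) (by omega)
    rw [hTcard] at h1
    refine h1.trans ?_
    gcongr
    exact sum_sub_le_vinogradovCount_mul (fun w => A w ^ (2 * s)) fun w => pow_nonneg (hA w) _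
  have hdiffSum : ∑ w ∈ diffBox k s Q, A w ^ (2 * s) ≤
      J * ∏ j : Fin k, boxSum (α j) (s * Q ^ (j.val + 1)) := by
    have h1 := sum_sub_le_vinogradovCount_mul (s := s) (Q := Q)
      (fun u => ‖∑ w ∈ diffBox k s Q, biChar α w u‖) fun _ => norm_nonneg _
    rw [sum_norm_biChar_diffBox] at h1
    refine le_trans ?_ h1
    refine (real_le _ (∑ q ∈ T ×ˢ T, ∑ w ∈ diffBox k s Q, biChar α w (V q.1 - V q.2)) ?_).trans
      (norm_sum_le _ _)
    rw [Complex.ofReal_sum, sum_comm]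
    exact sum_congr rfl fun w _ => norm_sum_biChar_pow _ _ _ _
  have hJ0 : 0 ≤ J := by positivity
  calc ‖∑ a ∈ range Q, ∑ b ∈ range Q, biChar α (powVec k a) (powVec k b)‖ ^ (4 * s ^ 2) =
      (‖∑ a ∈ range Q, ∑ b ∈ range Q, biChar α (powVec k a) (powVec k b)‖ ^ (2 * s)) ^ (2 * s) := by
        rw [← pow_mul]
        congr 1
        ring
    _ ≤ ((Q : ℝ) ^ (2 * s - 1) * ∑ q ∈ T ×ˢ T, A (V q.1 - V q.2)) ^ (2 * s) := by gcongr
    _ = ((Q : ℝ) ^ (2 * s - 1)) ^ (2 * s) * (∑ q ∈ T ×ˢ T, A (V q.1 - V q.2)) ^ (2 * s) := by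
        rw [mul_pow]
    _ ≤ ((Q : ℝ) ^ (2 * s - 1)) ^ (2 * s) * (((Q : ℝ) ^ (2 * s)) ^ (2 * s - 1) * (J *
        (J * ∏ j : Fin k, boxSum (α j) (s * Q ^ (j.val + 1))))) := by
      gcongr
      exact hholderSnd.trans (by gcongr)
    _ = _ := by
      have h1 : (2 * s - 1) * (2 * s) + 2 * s * (2 * s - 1) = 8 * s ^ 2 - 4 * s := by
        obtain ⟨a, rfl⟩ : ∃ a, s = a + 1 := ⟨s - 1, by omega⟩
        rw [show 2 * (a + 1) - 1 = 2 * a + 1 by omega]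
        have : 8 * (a + 1) ^ 2 = 4 * (a + 1) + ((2 * a + 1) * (2 * (a + 1)) +
          2 * (a + 1) * (2 * a + 1)) := by ring
        omega
      rw [← h1, pow_add, pow_mul, pow_mul]
      ring

/-- The degree used for exponent parameter `R`. -/
def degreeOf (R : ℕ) : ℕ := 16 * (R + 1)

/-- The number of variables used for exponent parameter `R`. -/
def varsOf (R : ℕ) : ℕ := iterCount (degreeOf R) (16 * degreeOf R)

theorem varsOf_eq (R : ℕ) : varsOf R = 17 * degreeOf R ^ 2 := by
  unfold varsOf iterCount
  ring

theorem degreeOf_le {R : ℕ} (hR : 2 ≤ R) : (degreeOf R : ℝ) ≤ 24 * R := by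
  have : (2 : ℝ) ≤ R := by exact_mod_cast hR
  unfold degreeOf
  push_cast
  linarith

theorem varsOf_le {R : ℕ} (hR : 2 ≤ R) : (varsOf R : ℝ) ≤ 9792 * R ^ 2 := by
  have h := degreeOf_le hR
  rw [varsOf_eq]
  push_cast
  have : (degreeOf R : ℝ) ^ 2 ≤ (24 * R) ^ 2 := by gcongr
  linarith

theorem meanExponent_degreeOf_le {R : ℕ} (hR : 2 ≤ R) :
    2 * meanExponent (degreeOf R) (16 * degreeOf R) ≤
      4 * varsOf R - degreeOf R * (degreeOf R + 1) + R ^ 2 / 50 := by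
  have hR2 : (2 : ℝ) ≤ R := by exact_mod_cast hR
  have hk := degreeOf_le hR
  unfold meanExponent
  change 2 * (2 * (varsOf R : ℝ) - _) ≤ _
  set k := degreeOf R with hkdef
  have hk1 : 1 ≤ k := by rw [hkdef]; unfold degreeOf; omega
  have hk1' : (1 : ℝ) ≤ k := by exact_mod_cast hk1
  have h1 : (1 - 1 / (k : ℝ)) ^ (16 * k) ≤ 1 / 65536 := by
    rw [mul_comm, pow_mul]
    have h2 : (1 - 1 / (k : ℝ)) ^ k ≤ 1 / 2 := by
      refine (Real.one_sub_div_pow_le_exp_neg hk1').trans ?_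
      rw [Real.exp_neg, one_div]
      apply inv_anti₀ (by norm_num)
      have := Real.add_one_le_exp (1 : ℝ)
      linarith
    have h3 : 0 ≤ (1 - 1 / (k : ℝ)) ^ k := by
      apply pow_nonneg
      rw [sub_nonneg, div_le_one (by positivity)]
      exact hk1'
    calc ((1 - 1 / (k : ℝ)) ^ k) ^ 16 ≤ (1 / 2) ^ 16 := by gcongr
      _ = _ := by norm_num
  have h4 : (k : ℝ) * (k + 1) ≤ 1152 * R ^ 2 := by nlinarith
  have h5 : 0 ≤ (k : ℝ) * (k + 1) := by positivity
  nlinarith [mul_le_mul_of_nonneg_left h1 h5]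

set_option maxHeartbeats 400000 in
theorem boxSum_good_le {R : ℕ} (hR : 2 ≤ R) {Λ X α n : ℝ} {Q i : ℕ} (hΛ : 10 ^ 11 * R ^ 2 ≤ Λ)
    (hX1 : rexp ((R - 1 / 10) * Λ) ≤ X) (hX2 : X ≤ rexp ((R + 9 / 10) * Λ))
    (hn1 : rexp Λ ≤ n) (hn2 : n ≤ 2 * rexp Λ) (hα : |α| = X / n ^ (i + 1))
    (hQ1 : (Q : ℝ) ≤ rexp (15 / 32 * Λ)) (hQ2 : rexp (15 / 32 * Λ) / 2 ≤ Q)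
    (hi1 : 2 * R + 2 ≤ i) (hi2 : i ≤ 3 * R + 3) :
    boxSum α (varsOf R * Q ^ i) ≤ Q ^ (2 * i) * rexp (-(R * Λ / 16)) := by
  have hR2 : (2 : ℝ) ≤ R := by exact_mod_cast hR
  have hi1' : 2 * (R : ℝ) + 2 ≤ i := by exact_mod_cast hi1
  have hi2' : (i : ℝ) ≤ 3 * R + 3 := by exact_mod_cast hi2
  have hΛ0 : 4 * 10 ^ 11 ≤ Λ := by nlinarith
  have hΛR : 10 ^ 11 * (R : ℝ) ≤ Λ := by nlinarith
  have hs := varsOf_le hR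
  set s := varsOf R with hsdef
  have hs1 : 1 ≤ s := by
    rw [hsdef, varsOf_eq]
    have : 0 < degreeOf R := by unfold degreeOf; omega
    have : 0 < degreeOf R ^ 2 := by positivity
    omega
  have hs1' : (1 : ℝ) ≤ s := by exact_mod_cast hs1
  have hsΛ : 1000 * (s : ℝ) ≤ Λ := by nlinarith
  clear_value s
  have hp1 : 0 ≤ Λ * (i - (2 * R + 2)) := mul_nonneg (by linarith) (by linarith)
  have hp2 : 0 ≤ Λ * (3 * R + 3 - i) := mul_nonneg (by linarith) (by linarith)
  have hp3 : 0 ≤ Λ * (R - 2) := mul_nonneg (by linarith) (by linarith)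
  have hX0 : 0 < X := (Real.exp_pos _).trans_le hX1
  have hn0 : 0 < n := (Real.exp_pos _).trans_le hn1
  have hQlow : rexp (Λ / 4) ≤ Q := by
    refine le_trans ?_ hQ2
    rw [le_div_iff₀ (by norm_num)]
    calc rexp (Λ / 4) * 2 ≤ rexp (Λ / 4) * rexp 1 := by
          gcongr
          have := Real.add_one_le_exp (1 : ℝ)
          linarith
      _ = rexp (Λ / 4 + 1) := by rw [Real.exp_add]
      _ ≤ _ := Real.exp_le_exp.2 (by linarith)
  have hQ1' : (1 : ℝ) ≤ Q := (Real.one_le_exp (by linarith)).trans hQlow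
  have hQ1n : 1 ≤ Q := by exact_mod_cast hQ1'
  have hM : 1 ≤ s * Q ^ i := Nat.mul_pos hs1 (pow_pos hQ1n i)
  have hα0 : α ≠ 0 := by
    rw [← abs_pos, hα]
    positivity
  have hQi : (Q : ℝ) ^ i ≤ rexp (15 / 32 * Λ * i) := by
    rw [mul_comm _ (i : ℝ), Real.exp_nat_mul]
    gcongr
  have hni : rexp (Λ * (i + 1)) ≤ n ^ (i + 1) := by
    have : rexp (Λ * (i + 1)) = rexp Λ ^ (i + 1) := by
      rw [← Real.exp_nat_mul]
      push_cast
      ring_nf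
    rw [this]
    gcongr
  have hsmall : |α| * ((s * Q ^ i : ℕ) : ℝ) ≤ 1 / 2 := by
    push_cast
    rw [hα, div_mul_eq_mul_div, div_le_iff₀ (by positivity)]
    calc X * (s * (Q : ℝ) ^ i) ≤ rexp ((R + 9 / 10) * Λ) * (s * rexp (15 / 32 * Λ * i)) := by gcongr
      _ = s * rexp ((R + 9 / 10) * Λ + 15 / 32 * Λ * i) := by rw [Real.exp_add]; ring
      _ ≤ s * (rexp (-Λ) * rexp (Λ * (i + 1))) := by
        rw [← Real.exp_add]
        refine mul_le_mul_of_nonneg_left (Real.exp_le_exp.2 ?_) (by positivity)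
        linarith
      _ = s * rexp (-Λ) * rexp (Λ * (i + 1)) := by ring
      _ ≤ 1 / 2 * n ^ (i + 1) := by
        gcongr
        rw [Real.exp_neg, ← div_eq_mul_inv, div_le_iff₀ (Real.exp_pos _)]
        have := Real.add_one_le_exp Λ
        linarith
  have hbox := boxSum_le_of_small hM hα0 hsmall
  have hterm1 : 3 * ((s * Q ^ i : ℕ) : ℝ) ≤ Q ^ (2 * i) * rexp (-(R * Λ / 16)) / 2 := by
    have h1 : 6 * s * rexp (R * Λ / 16) ≤ (Q : ℝ) ^ i := by
      calc 6 * s * rexp (R * Λ / 16) ≤ rexp (Λ / 4) * rexp (R * Λ / 16) := by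
            gcongr
            have := Real.add_one_le_exp (Λ / 4)
            linarith
        _ ≤ rexp (i * (Λ / 4)) := by
          rw [← Real.exp_add]
          apply Real.exp_le_exp.2
          linarith
        _ = rexp (Λ / 4) ^ i := by rw [Real.exp_nat_mul]
        _ ≤ _ := by gcongr
    have h2 : 6 * s ≤ (Q : ℝ) ^ i * rexp (-(R * Λ / 16)) := by
      rw [Real.exp_neg, ← div_eq_mul_inv, le_div_iff₀ (Real.exp_pos _)]
      exact h1
    have h3 : 0 ≤ (Q : ℝ) ^ i := by positivity
    push_cast
    have h4 := mul_le_mul_of_nonneg_left h2 h3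
    have h5 : (Q : ℝ) ^ (2 * i) = Q ^ i * Q ^ i := by rw [two_mul, pow_add]
    rw [h5]
    linarith
  have hlog : 1 + Real.log ((s * Q ^ i : ℕ) : ℝ) ≤ Λ ^ 2 := by
    push_cast
    rw [Real.log_mul (by positivity) (by positivity), Real.log_pow]
    have h1 : Real.log s ≤ s := Real.log_le_self (by linarith)
    have h2 : Real.log Q ≤ Λ := by
      rw [Real.log_le_iff_le_exp (by linarith)]
      exact hQ1.trans (Real.exp_le_exp.2 (by linarith))
    have h3 : (i : ℝ) * Real.log Q ≤ i * Λ := by gcongr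
    have h4 : (i : ℝ) + 1 ≤ Λ := by linarith
    nlinarith
  have hΛexp : Λ ^ 2 ≤ rexp (Λ / 10) := by
    have := Real.pow_div_factorial_le_exp (Λ / 10) (by linarith) 3
    simp only [Nat.factorial] at this
    norm_num at this
    nlinarith [sq_nonneg Λ]
  have h2pow : (2 : ℝ) ^ (3 * i + 2) ≤ rexp (Λ / 10) := by
    calc (2 : ℝ) ^ (3 * i + 2) ≤ rexp 1 ^ (3 * i + 2) := by
          gcongr
          have := Real.add_one_le_exp (1 : ℝ)
          linarith
      _ = rexp ((3 * i + 2 : ℕ) * 1) := by rw [Real.exp_nat_mul]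
      _ ≤ _ := by
        apply Real.exp_le_exp.2
        push_cast
        linarith
  have hterm2 : (1 + Real.log ((s * Q ^ i : ℕ) : ℝ)) / |α| ≤
      Q ^ (2 * i) * rexp (-(R * Λ / 16)) / 2 := by
    have hQ2i : rexp (15 / 16 * Λ * i) ≤ 4 ^ i * (Q : ℝ) ^ (2 * i) := by
      calc rexp (15 / 16 * Λ * i) = (rexp (15 / 32 * Λ) ^ 2) ^ i := by
            rw [← Real.exp_nat_mul, ← Real.exp_nat_mul]
            push_cast
            ring_nf
        _ ≤ ((2 * Q) ^ 2) ^ i := by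
          gcongr
          linarith
        _ = _ := by rw [mul_pow, mul_pow, ← pow_mul (Q : ℝ)]; norm_num
    have hn' : n ^ (i + 1) ≤ 2 ^ (i + 1) * rexp (Λ * (i + 1)) := by
      calc n ^ (i + 1) ≤ (2 * rexp Λ) ^ (i + 1) := by gcongr
        _ = _ := by
          rw [mul_pow, ← Real.exp_nat_mul]
          push_cast
          ring_nf
    rw [hα, div_div_eq_mul_div, div_le_iff₀ hX0]
    have hkey : rexp (Λ / 10) * rexp (Λ / 10) * rexp (Λ * (i + 1)) ≤
        rexp (15 / 16 * Λ * i) * rexp (-(R * Λ / 16)) * X := by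
      refine le_trans ?_ (mul_le_mul_of_nonneg_left hX1 (by positivity))
      rw [← Real.exp_add, ← Real.exp_add, ← Real.exp_add, ← Real.exp_add]
      apply Real.exp_le_exp.2
      linarith
    have hpow : (2 : ℝ) ^ (3 * i + 2) = 2 ^ (i + 1) * 4 ^ i * 2 := by
      rw [show (4 : ℝ) = 2 ^ 2 by norm_num, ← pow_mul, ← pow_add, ← pow_succ]
      congr 1
      omega
    have h4i : (0 : ℝ) < 4 ^ i * 2 := by positivity
    refine le_of_mul_le_mul_left ?_ h4i
    calc (4 ^ i * 2) * ((1 + Real.log ((s * Q ^ i : ℕ) : ℝ)) * n ^ (i + 1)) ≤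
        (4 ^ i * 2) * (rexp (Λ / 10) * (2 ^ (i + 1) * rexp (Λ * (i + 1)))) := by
          gcongr
          exact hlog.trans hΛexp
      _ = 2 ^ (3 * i + 2) * (rexp (Λ / 10) * rexp (Λ * (i + 1))) := by rw [hpow]; ring
      _ ≤ rexp (Λ / 10) * (rexp (Λ / 10) * rexp (Λ * (i + 1))) := by gcongr
      _ ≤ rexp (15 / 16 * Λ * i) * rexp (-(R * Λ / 16)) * X := by rw [← mul_assoc]; exact hkey
      _ ≤ (4 ^ i * (Q : ℝ) ^ (2 * i)) * rexp (-(R * Λ / 16)) * X := by gcongr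
      _ = _ := by ring
  linarith

theorem prod_boxSum_le {k s Q m g : ℕ} (hs : 1 ≤ s) (hQ : 1 ≤ Q) (α : Fin k → ℝ) {c : ℝ}
    (hc0 : 0 ≤ c) (hmg : m + g ≤ k)
    (hgood : ∀ j : Fin k, m ≤ j.val → j.val < m + g →
      boxSum (α j) (s * Q ^ (j.val + 1)) ≤ Q ^ (2 * (j.val + 1)) * c) :
    ∏ j : Fin k, boxSum (α j) (s * Q ^ (j.val + 1)) ≤
      Q ^ (k * (k + 1)) * (3 * s : ℝ) ^ (2 * k) * c ^ g := by
  have hs1 : (1 : ℝ) ≤ s := by exact_mod_cast hs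
  have hle : ∀ j : Fin k, boxSum (α j) (s * Q ^ (j.val + 1)) ≤
      (Q : ℝ) ^ (2 * (j.val + 1)) * (3 * s : ℝ) ^ 2 *
        (if m ≤ j.val ∧ j.val < m + g then c else 1) := by
    intro j
    split_ifs with h
    · refine (hgood j h.1 h.2).trans ?_
      have : (1 : ℝ) ≤ (3 * s) ^ 2 := one_le_pow₀ (by linarith)
      have h2 : (0 : ℝ) ≤ Q ^ (2 * (j.val + 1)) * c := by positivity
      nlinarith
    · refine (boxSum_le _ (Nat.mul_pos hs (pow_pos hQ _))).trans_eq ?_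
      push_cast
      ring
  refine (prod_le_prod (fun j _ => boxSum_nonneg _ _) fun j _ => hle j).trans_eq ?_
  rw [prod_mul_distrib, prod_mul_distrib]
  congr 1
  · congr 1
    · rw [prod_pow_eq_pow_sum, Fin.sum_univ_eq_sum_range (fun j => 2 * (j + 1)) k]
      congr 1
      clear hgood hle hmg α
      induction k with
      | zero => rfl
      | succ k ih => rw [sum_range_succ, ih]; ring
    · rw [prod_const, card_univ, Fintype.card_fin, ← pow_mul]
  · rw [Fin.prod_univ_eq_prod_range (fun j => if m ≤ j ∧ j < m + g then c else 1) k, prod_ite,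
      prod_const, prod_const_one, mul_one]
    congr 1
    have : {j ∈ range k | m ≤ j ∧ j < m + g} = Ico m (m + g) := by
      ext j
      simp only [mem_filter, mem_range, mem_Ico]
      omega
    rw [this]
    simp

theorem weyl_assembly {W J P F A B C e h q : ℝ} {T a b d m : ℕ} (hq : 0 < q) (hJ0 : 0 ≤ J)
    (hB : 0 ≤ B) (hC : 0 ≤ C)
    (hW : W ^ T ≤ q ^ a * J ^ 2 * P) (hJ : J ≤ A ^ T * F) (hP : P ≤ q ^ b * B ^ m * C)
    (hFq : F ^ 2 * q ^ b ≤ q ^ d * e) (he : e * C ≤ h ^ T) (hBm : B ^ m ≤ B ^ T)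
    (had : a + d = 2 * T) : W ^ T ≤ (A ^ 2 * B * h * q ^ 2) ^ T := by
  have hJ2 : J ^ 2 ≤ (A ^ T * F) ^ 2 := pow_le_pow_left₀ hJ0 hJ 2
  calc W ^ T ≤ q ^ a * J ^ 2 * P := hW
    _ ≤ q ^ a * J ^ 2 * (q ^ b * B ^ m * C) := mul_le_mul_of_nonneg_left hP (by positivity)
    _ ≤ q ^ a * J ^ 2 * (q ^ b * B ^ T * C) := by
      refine mul_le_mul_of_nonneg_left ?_ (by positivity)
      refine mul_le_mul_of_nonneg_right ?_ hC
      exact mul_le_mul_of_nonneg_left hBm (by positivity)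
    _ ≤ q ^ a * (A ^ T * F) ^ 2 * (q ^ b * B ^ T * C) := by
      refine mul_le_mul_of_nonneg_right ?_ (by positivity)
      exact mul_le_mul_of_nonneg_left hJ2 (by positivity)
    _ = q ^ a * (A ^ T) ^ 2 * B ^ T * C * (F ^ 2 * q ^ b) := by ring
    _ ≤ q ^ a * (A ^ T) ^ 2 * B ^ T * C * (q ^ d * e) :=
      mul_le_mul_of_nonneg_left hFq (by positivity)
    _ = (A ^ T) ^ 2 * B ^ T * q ^ (a + d) * (e * C) := by rw [pow_add]; ring
    _ ≤ (A ^ T) ^ 2 * B ^ T * q ^ (a + d) * h ^ T := mul_le_mul_of_nonneg_left he (by positivity)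
    _ = _ := by
      rw [had, mul_pow, mul_pow, mul_pow, pow_right_comm, pow_mul q]
      ring

set_option maxHeartbeats 400000 in
theorem weyl_bound_of_power {R k s Q : ℕ} {Λ ℓ E J W P : ℝ} (hR2 : (2 : ℝ) ≤ R) (hℓ2 : 0.69 ≤ ℓ)
    (hΛ : 10 ^ 12 * R ^ 2 * ℓ ≤ Λ) (hRℓ : (R : ℝ) ≤ rexp ℓ) (hk : (k : ℝ) ≤ 24 * R)
    (hs : (s : ℝ) ≤ 9792 * R ^ 2) (hE : 2 * E ≤ 4 * s - k * (k + 1) + R ^ 2 / 50)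
    (hk2 : 2 ≤ k) (hQ1r : (1 : ℝ) ≤ Q) (hQ1 : (Q : ℝ) ≤ rexp (15 / 32 * Λ))
    (hsk : k * (k + 16 * k) = s) (hJ0 : 0 ≤ J)
    (hmv : J ≤ (100 * k) ^ (4 * s * (k + 16 * k)) * (Q : ℝ) ^ E)
    (hprod : P ≤ Q ^ (k * (k + 1)) * (3 * s : ℝ) ^ (2 * k) * rexp (-(R * Λ / 16)) ^ R)
    (hbil : W ^ (4 * s ^ 2) ≤ Q ^ (8 * s ^ 2 - 4 * s) * J ^ 2 * P) :
    W ≤ 2 * 10 ^ 11 * rexp (-ℓ) * Q ^ 2 := by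
  have hQpos : 0 < (Q : ℝ) := by linarith
  have hΛ0 : 0 ≤ Λ := le_trans (by positivity) hΛ
  have hks : k ≤ s := by rw [← hsk]; nlinarith
  have hs1 : 1 ≤ s := by omega
  have hk1r : (2 : ℝ) ≤ k := by exact_mod_cast hk2
  have hs1r : (1 : ℝ) ≤ s := by exact_mod_cast hs1
  have hJ : J ≤ (100 * k) ^ (4 * s ^ 2) * (Q : ℝ) ^ E := by
    refine hmv.trans ?_
    refine mul_le_mul_of_nonneg_right (pow_le_pow_right₀ (by linarith) ?_) (by positivity)
    rw [sq, ← mul_assoc]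
    gcongr
    rw [← hsk]
    nlinarith
  have hQE : ((Q : ℝ) ^ E) ^ 2 * Q ^ (k * (k + 1)) ≤ Q ^ (4 * s) * rexp (R ^ 2 * Λ / 100) := by
    have h1 : (Q : ℝ) ^ ((R : ℝ) ^ 2 / 50) ≤ rexp (R ^ 2 * Λ / 100) := by
      calc (Q : ℝ) ^ ((R : ℝ) ^ 2 / 50) ≤ rexp (15 / 32 * Λ) ^ ((R : ℝ) ^ 2 / 50) := by gcongr
        _ = rexp (15 / 32 * Λ * (R ^ 2 / 50)) := by rw [← Real.exp_mul]
        _ ≤ _ := by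
          apply Real.exp_le_exp.2
          have : 0 ≤ Λ * R ^ 2 := by positivity
          linarith
    refine le_trans ?_ (mul_le_mul_of_nonneg_left h1 (by positivity))
    rw [← Real.rpow_natCast, ← Real.rpow_natCast, ← Real.rpow_natCast, ← Real.rpow_mul (by linarith),
      ← Real.rpow_add hQpos, ← Real.rpow_add hQpos]
    apply Real.rpow_le_rpow_of_exponent_le hQ1r
    push_cast
    linarith
  have hmain : W ^ (4 * s ^ 2) ≤
      ((100 * k) ^ 2 * (3 * s) * rexp (-(5 * ℓ)) * Q ^ 2) ^ (4 * s ^ 2) := by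
    have hexp : rexp (R ^ 2 * Λ / 100) * rexp (-(R * Λ / 16)) ^ R ≤ rexp (-(5 * ℓ)) ^ (4 * s ^ 2) := by
      rw [← Real.exp_nat_mul, ← Real.exp_nat_mul, ← Real.exp_add]
      apply Real.exp_le_exp.2
      push_cast
      have h1 : (s : ℝ) ^ 2 ≤ (9792 * R ^ 2) ^ 2 := by gcongr
      have h2 : 4 * (s : ℝ) ^ 2 * (5 * ℓ) ≤ 4 * (9792 * R ^ 2) ^ 2 * (5 * ℓ) := by gcongr
      have h3 : (R : ℝ) ^ 2 * (10 ^ 12 * R ^ 2 * ℓ) ≤ R ^ 2 * Λ := by gcongr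
      have h4 : 0 ≤ (R : ℝ) ^ 4 * ℓ := by positivity
      nlinarith
    have h3s : (3 * s : ℝ) ^ (2 * k) ≤ (3 * s) ^ (4 * s ^ 2) := by
      refine pow_le_pow_right₀ (by linarith) ?_
      nlinarith
    refine weyl_assembly hQpos hJ0 (by positivity) (by positivity) hbil hJ hprod hQE hexp h3s ?_
    have : s ≤ s ^ 2 := Nat.le_self_pow (by norm_num) s
    omega
  have hW := le_of_pow_le_pow_left₀ (by positivity : 4 * s ^ 2 ≠ 0) (by positivity) hmain
  refine hW.trans ?_
  have hconst : (100 * k : ℝ) ^ 2 * (3 * s) ≤ 2 * 10 ^ 11 * R ^ 4 := by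
    calc (100 * k : ℝ) ^ 2 * (3 * s) ≤ (100 * (24 * R)) ^ 2 * (3 * (9792 * R ^ 2)) := by gcongr
      _ ≤ _ := by
        have : (0 : ℝ) ≤ R ^ 4 := by positivity
        nlinarith
  calc (100 * k) ^ 2 * (3 * s) * rexp (-(5 * ℓ)) * Q ^ 2 ≤
      2 * 10 ^ 11 * rexp ℓ ^ 4 * rexp (-(5 * ℓ)) * Q ^ 2 := by
        have h5 : (R : ℝ) ^ 4 ≤ rexp ℓ ^ 4 := pow_le_pow_left₀ (by positivity) hRℓ 4
        refine mul_le_mul_of_nonneg_right ?_ (by positivity)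
        refine mul_le_mul_of_nonneg_right ?_ (by positivity)
        linarith
    _ = _ := by
      rw [← Real.exp_nat_mul, mul_assoc (2 * 10 ^ 11) (rexp _) (rexp _), ← Real.exp_add]
      push_cast
      ring_nf

theorem norm_weyl_sum_le {R : ℕ} (hR : 2 ≤ R) {Λ X n ℓ : ℝ} {Q : ℕ}
    (hℓ : Real.log R ≤ ℓ) (hΛ : 10 ^ 12 * R ^ 2 * ℓ ≤ Λ)
    (hX1 : rexp ((R - 1 / 10) * Λ) ≤ X) (hX2 : X ≤ rexp ((R + 9 / 10) * Λ))
    (hn1 : rexp Λ ≤ n) (hn2 : n ≤ 2 * rexp Λ) (α : Fin (degreeOf R) → ℝ)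
    (hα : ∀ j, |α j| = X / n ^ (j.val + 2))
    (hQ1 : (Q : ℝ) ≤ rexp (15 / 32 * Λ)) (hQ2 : rexp (15 / 32 * Λ) / 2 ≤ Q) :
    ‖∑ a ∈ range Q, ∑ b ∈ range Q,
      biChar α (powVec (degreeOf R) a) (powVec (degreeOf R) b)‖ ≤
      2 * 10 ^ 11 * rexp (-ℓ) * Q ^ 2 := by
  have hR2 : (2 : ℝ) ≤ R := by exact_mod_cast hR
  have hℓ2 : 0.69 ≤ ℓ := by
    have h1 := Real.log_two_gt_d9
    have h2 := Real.log_le_log (by norm_num) hR2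
    linarith
  have hΛ11 : 10 ^ 11 * (R : ℝ) ^ 2 ≤ Λ := by
    have h3 : (0 : ℝ) ≤ R ^ 2 := by positivity
    nlinarith [mul_le_mul_of_nonneg_left hℓ2 h3]
  have hΛ0 : 0 ≤ Λ := le_trans (by positivity) hΛ11
  have hRℓ : (R : ℝ) ≤ rexp ℓ := by
    rw [← Real.log_le_iff_le_exp (by linarith)]
    exact hℓ
  have hs := varsOf_le hR
  have hk := degreeOf_le hR
  have hE := meanExponent_degreeOf_le hR
  have hQpos : 0 < (Q : ℝ) := lt_of_lt_of_le (by positivity) hQ2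
  have hQ1n : 1 ≤ Q := by exact_mod_cast hQpos
  have hQ1r : (1 : ℝ) ≤ Q := by exact_mod_cast hQ1n
  have hk2 : 2 ≤ degreeOf R := by unfold degreeOf; omega
  have hkR : 2 * R + 1 + R ≤ degreeOf R := by unfold degreeOf; omega
  have hmv := vinogradovCount_mean_value hk2 (16 * degreeOf R) hQ1n
  change (vinogradovCount (degreeOf R) (varsOf R) Q : ℝ) ≤ (100 * degreeOf R) ^ (4 * varsOf R * _) * _ at hmv
  have hs1 : 1 ≤ varsOf R := by
    rw [varsOf_eq]
    have : 0 < degreeOf R ^ 2 := by positivity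
    omega
  have hprod := prod_boxSum_le (m := 2 * R + 1) (g := R) hs1 hQ1n α
    (Real.exp_pos (-(R * Λ / 16))).le hkR fun j hj1 hj2 =>
    boxSum_good_le hR hΛ11 hX1 hX2 hn1 hn2 (hα j) hQ1 hQ2 (by omega) (by omega)
  have hbil := norm_bilinear_pow_le (Q := Q) hs1 α
  exact weyl_bound_of_power hR2 hℓ2 hΛ hRℓ hk hs hE hk2 hQ1r hQ1 rfl
    (by positivity) hmv hprod hbil

theorem sum_Ioc_double (f : ℕ → ℂ) (N : ℕ) :
    ∑ n ∈ Ioc N (2 * N), f n = ∑ i ∈ range N, f (N + 1 + i) := by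
  have : Ioc N (2 * N) = Ico (N + 1) (2 * N + 1) := by
    ext n
    simp only [mem_Ioc, mem_Ico]
    omega
  rw [this, sum_Ico_eq_sum_range]
  congr 2
  omega

theorem sum_one_div_Ioc_le (N : ℕ) : ∑ n ∈ Ioc N (2 * N), (1 / n : ℝ) ≤ 1 := by
  rcases Nat.eq_zero_or_pos N with rfl | hN
  · simp
  have hN' : (0 : ℝ) < N := by exact_mod_cast hN
  calc ∑ n ∈ Ioc N (2 * N), (1 / n : ℝ) ≤ ∑ n ∈ Ioc N (2 * N), (1 / N : ℝ) := by
        refine sum_le_sum fun n hn => ?_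
        have : (N : ℝ) ≤ n := by exact_mod_cast (mem_Ioc.1 hn).1.le
        gcongr
    _ = 1 := by
      rw [sum_const, Nat.card_Ioc, nsmul_eq_mul, two_mul, Nat.add_sub_cancel]
      field_simp

theorem norm_sum_shift_one_le {N : ℕ} (hN : 1 ≤ N) (h : ℕ → ℂ) (hh : ∀ n, ‖h n‖ ≤ 1) :
    ‖∑ n ∈ Ioc N (2 * N), h n / n - ∑ n ∈ Ioc N (2 * N), h (n + 1) / n‖ ≤ 3 / N := by
  have hN' : (0 : ℝ) < N := by exact_mod_cast hN
  have hnorm : ∀ m : ℕ, N ≤ m → ‖h m / (m : ℂ)‖ ≤ 1 / N := by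
    intro m hm
    have : (N : ℝ) ≤ m := by exact_mod_cast hm
    rw [norm_div, Complex.norm_natCast]
    exact div_le_div₀ zero_le_one (hh m) hN' this
  have hsplit : ∑ n ∈ Ioc N (2 * N), h n / (n : ℂ) - ∑ n ∈ Ioc N (2 * N), h (n + 1) / (n : ℂ) =
      (h (N + 1) / (N + 1 : ℕ) - h (N + 1 + N) / (N + 1 + N : ℕ)) -
        ∑ n ∈ Ioc N (2 * N), h (n + 1) * (1 / n - 1 / (n + 1 : ℕ)) := by
    have htel := sum_range_sub' (fun i => h (N + 1 + i) / ((N + 1 + i : ℕ) : ℂ)) N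
    rw [add_zero] at htel
    rw [← htel, sum_Ioc_double, sum_Ioc_double, sum_Ioc_double, ← sum_sub_distrib,
      ← sum_sub_distrib]
    refine sum_congr rfl fun i _ => ?_
    rw [← add_assoc (N + 1) i 1]
    ring
  rw [hsplit]
  have hrest : ‖∑ n ∈ Ioc N (2 * N), h (n + 1) * (1 / n - 1 / (n + 1 : ℕ) : ℂ)‖ ≤ 1 / N := by
    refine (norm_sum_le _ _).trans ?_
    calc ∑ n ∈ Ioc N (2 * N), ‖h (n + 1) * (1 / n - 1 / (n + 1 : ℕ) : ℂ)‖ ≤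
        ∑ n ∈ Ioc N (2 * N), (1 / N * (1 / n) : ℝ) := by
          refine sum_le_sum fun n hn => ?_
          have hn1 : N < n := (mem_Ioc.1 hn).1
          have hn2 : (N : ℝ) ≤ n := by exact_mod_cast hn1.le
          have hn0 : (0 : ℝ) < n := by linarith
          have heq : (1 / n - 1 / (n + 1 : ℕ) : ℂ) = ((1 / (n * (n + 1)) : ℝ) : ℂ) := by
            have : (n : ℂ) ≠ 0 := by
              exact_mod_cast hn0.ne'
            have h2 : (n : ℂ) + 1 ≠ 0 := by exact_mod_cast (by positivity : ((n : ℝ) + 1) ≠ 0)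
            push_cast
            field_simp
            ring
          rw [norm_mul, heq, Complex.norm_real, Real.norm_of_nonneg (by positivity)]
          calc ‖h (n + 1)‖ * (1 / (n * (n + 1)) : ℝ) ≤ 1 * (1 / (n * N)) := by
                gcongr
                · exact hh _
                · linarith
            _ = _ := by field_simp
      _ = 1 / N * ∑ n ∈ Ioc N (2 * N), (1 / n : ℝ) := by rw [mul_sum]
      _ ≤ 1 / N * 1 := by gcongr; exact sum_one_div_Ioc_le N
      _ = _ := mul_one _
  refine (norm_sub_le _ _).trans ?_
  have h1 := norm_sub_le (h (N + 1) / (N + 1 : ℕ)) (h (N + 1 + N) / (N + 1 + N : ℕ))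
  have h2 := hnorm (N + 1) (by omega)
  have h3 := hnorm (N + 1 + N) (by omega)
  have h4 : (3 / N : ℝ) = 1 / N + 1 / N + 1 / N := by ring
  linarith

theorem norm_sum_shift_le {N : ℕ} (hN : 1 ≤ N) (h : ℕ → ℂ) (hh : ∀ n, ‖h n‖ ≤ 1) (u : ℕ) :
    ‖∑ n ∈ Ioc N (2 * N), h n / n - ∑ n ∈ Ioc N (2 * N), h (n + u) / n‖ ≤ 3 * u / N := by
  induction u with
  | zero => simp
  | succ u ih =>
    have h1 := norm_sum_shift_one_le hN (fun n => h (n + u)) fun n => hh _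
    have h2 := norm_sub_le_norm_sub_add_norm_sub (∑ n ∈ Ioc N (2 * N), h n / (n : ℂ))
      (∑ n ∈ Ioc N (2 * N), h (n + u) / (n : ℂ)) (∑ n ∈ Ioc N (2 * N), h (n + 1 + u) / (n : ℂ))
    simp_rw [add_right_comm _ 1 u, add_assoc _ u 1] at h1 h2
    refine h2.trans ((add_le_add ih h1).trans_eq ?_)
    push_cast
    ring

/-- The Taylor coefficients of `u ↦ X / (n + u)`, starting from the linear one. -/
noncomputable def taylorCoeff (k : ℕ) (X n : ℝ) (j : Fin k) : ℝ :=
  (-1) ^ (j.val + 1) * X / n ^ (j.val + 2)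

theorem abs_taylorCoeff {k : ℕ} {X n : ℝ} (hX : 0 ≤ X) (hn : 0 ≤ n) (j : Fin k) :
    |taylorCoeff k X n j| = X / n ^ (j.val + 2) := by
  unfold taylorCoeff
  rw [abs_div, abs_mul, abs_neg_one_pow, one_mul, abs_of_nonneg hX, abs_of_nonneg (by positivity)]

theorem div_add_eq_taylor {k : ℕ} {X n u : ℝ} (hn : 0 < n) (hu : 0 ≤ u) :
    X / (n + u) = X / n + ∑ j : Fin k, taylorCoeff k X n j * u ^ (j.val + 1) +
      X * (-u / n) ^ (k + 1) / (n + u) := by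
  unfold taylorCoeff
  rw [Fin.sum_univ_eq_sum_range (fun j => (-1) ^ (j + 1) * X / n ^ (j + 2) * u ^ (j + 1)) k]
  have hnu : n + u ≠ 0 := by positivity
  induction k with
  | zero =>
    simp
    field_simp
    ring
  | succ k ih =>
    rw [sum_range_succ]
    have hstep : (-1) ^ (k + 1) * X / n ^ (k + 2) * u ^ (k + 1) +
        X * (-u / n) ^ (k + 1 + 1) / (n + u) = X * (-u / n) ^ (k + 1) / (n + u) := by
      rw [pow_succ (-u / n) (k + 1), div_pow (-u), neg_pow u]
      field_simp
      ring
    linarith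

theorem norm_expi_sub_biChar_le {k Q a b : ℕ} {X n : ℝ} (hX : 0 ≤ X) (hn : 0 < n) (ha : a < Q)
    (hb : b < Q) :
    ‖expi (X / (n + (a * b : ℕ))) -
      expi (X / n) * biChar (taylorCoeff k X n) (powVec k a) (powVec k b)‖ ≤
      2 * π * (X / n * ((Q : ℝ) ^ 2 / n) ^ (k + 1)) := by
  rw [biChar_apply, ← expi_add]
  refine (norm_expi_sub_expi_le _ _).trans ?_
  have hab : ((a * b : ℕ) : ℝ) ≤ Q ^ 2 := by
    rw [sq]
    exact_mod_cast Nat.mul_le_mul ha.le hb.le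
  have hsum : ∑ j : Fin k, taylorCoeff k X n j * (powVec k b j : ℤ) * (powVec k a j : ℤ) =
      ∑ j : Fin k, taylorCoeff k X n j * ((a * b : ℕ) : ℝ) ^ (j.val + 1) := by
    refine sum_congr rfl fun j _ => ?_
    simp only [powVec]
    push_cast
    ring
  rw [div_add_eq_taylor (k := k) hn (Nat.cast_nonneg (a * b)), hsum, add_sub_cancel_left]
  have hu : (0 : ℝ) ≤ ((a * b : ℕ) : ℝ) := Nat.cast_nonneg _
  set u : ℝ := ((a * b : ℕ) : ℝ)
  rw [abs_div, abs_mul, abs_pow, abs_div, abs_neg, abs_of_nonneg hX, abs_of_nonneg hu,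
    abs_of_pos hn, abs_of_pos (by linarith : 0 < n + u)]
  have h1 : X * (u / n) ^ (k + 1) / (n + u) ≤ X * (u / n) ^ (k + 1) / n := by
    apply div_le_div_of_nonneg_left (by positivity) hn (by linarith)
  have h2 : (u / n) ^ (k + 1) ≤ ((Q : ℝ) ^ 2 / n) ^ (k + 1) :=
    pow_le_pow_left₀ (by positivity) (by gcongr) _
  refine mul_le_mul_of_nonneg_left ?_ (by positivity)
  refine h1.trans ?_
  rw [mul_div_right_comm]
  exact mul_le_mul_of_nonneg_left h2 (by positivity)

theorem norm_sum_expi_shift_le {k Q : ℕ} {X n w : ℝ} (hX : 0 ≤ X) (hn : 0 < n)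
    (hW : ‖∑ a ∈ range Q, ∑ b ∈ range Q,
      biChar (taylorCoeff k X n) (powVec k a) (powVec k b)‖ ≤ w * Q ^ 2) :
    ‖∑ a ∈ range Q, ∑ b ∈ range Q, expi (X / (n + (a * b : ℕ)))‖ ≤
      (w + 2 * π * (X / n * ((Q : ℝ) ^ 2 / n) ^ (k + 1))) * Q ^ 2 := by
  have hsplit : ∑ a ∈ range Q, ∑ b ∈ range Q, expi (X / (n + (a * b : ℕ))) =
      expi (X / n) * ∑ a ∈ range Q, ∑ b ∈ range Q,
        biChar (taylorCoeff k X n) (powVec k a) (powVec k b) +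
      ∑ a ∈ range Q, ∑ b ∈ range Q, (expi (X / (n + (a * b : ℕ))) -
        expi (X / n) * biChar (taylorCoeff k X n) (powVec k a) (powVec k b)) := by
    simp_rw [sum_sub_distrib, mul_sum]
    ring
  rw [hsplit]
  refine (norm_add_le _ _).trans ?_
  rw [norm_mul, norm_expi, one_mul, add_mul]
  refine add_le_add hW ?_
  set e := 2 * π * (X / n * ((Q : ℝ) ^ 2 / n) ^ (k + 1))
  calc _ ≤ ∑ a ∈ range Q, ∑ b ∈ range Q, e := by
        refine (norm_sum_le _ _).trans (sum_le_sum fun a ha => ?_)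
        refine (norm_sum_le _ _).trans (sum_le_sum fun b hb => ?_)
        exact norm_expi_sub_biChar_le hX hn (mem_range.1 ha) (mem_range.1 hb)
    _ = e * Q ^ 2 := by
      simp only [sum_const, card_range, nsmul_eq_mul]
      ring

/-- Averaging over the shifts `a * b` with `a, b < Q`. -/
theorem norm_sum_expi_div_le_of_shift {N Q : ℕ} (hN : 1 ≤ N) (hQ : 1 ≤ Q) {X w : ℝ} (hw : 0 ≤ w)
    (h : ∀ n ∈ Ioc N (2 * N),
      ‖∑ a ∈ range Q, ∑ b ∈ range Q, expi (X / ((n : ℝ) + (a * b : ℕ)))‖ ≤ w * Q ^ 2) :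
    ‖∑ n ∈ Ioc N (2 * N), expi (X / n) / n‖ ≤ w + 3 * (Q ^ 2 : ℝ) / N := by
  have hN' : (0 : ℝ) < N := by exact_mod_cast hN
  have hQ' : (0 : ℝ) < Q := by exact_mod_cast hQ
  set S := ∑ n ∈ Ioc N (2 * N), expi (X / n) / (n : ℂ) with hS
  have hshift : ∀ a ∈ range Q, ∀ b ∈ range Q,
      ‖S - ∑ n ∈ Ioc N (2 * N), expi (X / ((n : ℝ) + (a * b : ℕ))) / (n : ℂ)‖ ≤
        3 * (Q ^ 2 : ℝ) / N := by
    intro a ha b hb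
    have h1 := norm_sum_shift_le hN (fun n => expi (X / n)) (fun n => (norm_expi _).le) (a * b)
    have hab : ((a * b : ℕ) : ℝ) ≤ Q ^ 2 := by
      rw [sq]
      exact_mod_cast Nat.mul_le_mul (mem_range.1 ha).le (mem_range.1 hb).le
    simp only [Nat.cast_add] at h1
    refine h1.trans ?_
    gcongr
  have hsum : (Q : ℂ) ^ 2 * S =
      ∑ a ∈ range Q, ∑ b ∈ range Q,
        (S - ∑ n ∈ Ioc N (2 * N), expi (X / ((n : ℝ) + (a * b : ℕ))) / (n : ℂ)) +
      ∑ n ∈ Ioc N (2 * N), (∑ a ∈ range Q, ∑ b ∈ range Q,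
        expi (X / ((n : ℝ) + (a * b : ℕ)))) / (n : ℂ) := by
    simp_rw [sum_sub_distrib, sum_const, card_range, nsmul_eq_mul, sum_div]
    rw [sum_comm (s := Ioc N (2 * N))]
    simp_rw [sum_comm (s := Ioc N (2 * N))]
    ring
  have hnorm : (Q : ℝ) ^ 2 * ‖S‖ ≤ Q ^ 2 * (3 * (Q ^ 2 : ℝ) / N) + w * Q ^ 2 := by
    have h0 : (Q : ℝ) ^ 2 * ‖S‖ = ‖(Q : ℂ) ^ 2 * S‖ := by
      rw [norm_mul, norm_pow, Complex.norm_natCast]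
    rw [h0, hsum]
    refine (norm_add_le _ _).trans (add_le_add ?_ ?_)
    · calc _ ≤ ∑ a ∈ range Q, ∑ b ∈ range Q, (3 * (Q ^ 2 : ℝ) / N) := by
            refine (norm_sum_le _ _).trans (sum_le_sum fun a ha => ?_)
            exact (norm_sum_le _ _).trans (sum_le_sum fun b hb => hshift a ha b hb)
        _ = _ := by
          simp only [sum_const, card_range, nsmul_eq_mul]
          ring
    · calc _ ≤ ∑ n ∈ Ioc N (2 * N), w * Q ^ 2 * (1 / n : ℝ) := by
            refine (norm_sum_le _ _).trans (sum_le_sum fun n hn => ?_)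
            rw [norm_div, Complex.norm_natCast, mul_one_div]
            gcongr
            exact h n hn
        _ = w * Q ^ 2 * ∑ n ∈ Ioc N (2 * N), (1 / n : ℝ) := by rw [mul_sum]
        _ ≤ w * Q ^ 2 * 1 := by gcongr; exact sum_one_div_Ioc_le N
        _ = _ := mul_one _
  have hQ2 : (0 : ℝ) < Q ^ 2 := by positivity
  refine le_of_mul_le_mul_left ?_ hQ2
  linarith

theorem norm_sum_expi_div_le {R N : ℕ} (hR : 2 ≤ R) {X ℓ : ℝ} (hN : 1 ≤ N)
    (hℓ : Real.log R ≤ ℓ) (hΛ : 10 ^ 12 * R ^ 2 * ℓ ≤ Real.log N)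
    (hX1 : rexp ((R - 1 / 10) * Real.log N) ≤ X) (hX2 : X ≤ rexp ((R + 9 / 10) * Real.log N)) :
    ‖∑ n ∈ Ioc N (2 * N), expi (X / n) / n‖ ≤ 3 * 10 ^ 11 * rexp (-ℓ) := by
  have hN' : (0 : ℝ) < N := by exact_mod_cast hN
  have hR2 : (2 : ℝ) ≤ R := by exact_mod_cast hR
  have hℓ2 : 0.69 ≤ ℓ := by
    have h1 := Real.log_two_gt_d9
    have h2 := Real.log_le_log (by norm_num) hR2
    linarith
  set Λ := Real.log N with hΛdef
  have hexpΛ : rexp Λ = N := Real.exp_log hN'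
  have hΛℓ : 10 ^ 12 * ℓ ≤ Λ := by
    refine le_trans ?_ hΛ
    have h3 : (1 : ℝ) ≤ R ^ 2 := by nlinarith
    have h4 : 0 ≤ (10 : ℝ) ^ 12 * ℓ := by positivity
    linarith [mul_le_mul_of_nonneg_left h3 h4]
  have hX0 : 0 ≤ X := (Real.exp_pos _).le.trans hX1
  set q := rexp (15 / 32 * Λ) with hq
  have hq1 : 1 ≤ q := Real.one_le_exp (by linarith)
  have hQ1 : (⌊q⌋₊ : ℝ) ≤ q := Nat.floor_le (by linarith)
  have hQpos : 1 ≤ ⌊q⌋₊ := Nat.le_floor (by simpa using hq1)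
  have hQ2 : q / 2 ≤ ⌊q⌋₊ := by
    have h1 := Nat.lt_floor_add_one q
    have h2 : (1 : ℝ) ≤ ⌊q⌋₊ := by exact_mod_cast hQpos
    linarith
  set Q := ⌊q⌋₊
  have hQN : (Q : ℝ) ^ 2 / N ≤ rexp (-(Λ / 16)) := by
    rw [div_le_iff₀ hN', ← hexpΛ, ← Real.exp_add]
    calc (Q : ℝ) ^ 2 ≤ q ^ 2 := by gcongr
      _ = rexp (-(Λ / 16) + Λ) := by
        rw [hq, ← Real.exp_nat_mul]
        congr 1
        push_cast
        ring
  have hsmall : rexp (-(Λ / 16)) ≤ rexp (-ℓ) := Real.exp_le_exp.2 (by linarith)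
  have htail : ∀ n ∈ Ioc N (2 * N),
      X / n * ((Q : ℝ) ^ 2 / n) ^ (degreeOf R + 1) ≤ rexp (-ℓ) := by
    intro n hn
    have hn1 : (N : ℝ) ≤ n := by exact_mod_cast (mem_Ioc.1 hn).1.le
    have h1 : (Q : ℝ) ^ 2 / n ≤ rexp (-(Λ / 16)) :=
      (div_le_div_of_nonneg_left (by positivity) hN' hn1).trans hQN
    have h2 : X / n ≤ rexp ((R + 9 / 10) * Λ - Λ) := by
      rw [Real.exp_sub, hexpΛ]
      gcongr
    calc X / n * ((Q : ℝ) ^ 2 / n) ^ (degreeOf R + 1) ≤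
        rexp ((R + 9 / 10) * Λ - Λ) * rexp (-(Λ / 16)) ^ (degreeOf R + 1) := by
          refine mul_le_mul h2 (pow_le_pow_left₀ (by positivity) h1 _) (by positivity)
            (by positivity)
      _ ≤ rexp (-ℓ) := by
        rw [← Real.exp_nat_mul, ← Real.exp_add]
        apply Real.exp_le_exp.2
        unfold degreeOf
        push_cast
        nlinarith
  have hpi : 2 * π ≤ 7 := by linarith [Real.pi_lt_d2]
  have hbound := norm_sum_expi_div_le_of_shift (X := X)
    (w := 2 * 10 ^ 11 * rexp (-ℓ) + 7 * rexp (-ℓ)) hN hQpos (by positivity) ?_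
  · have h3 : 3 * (Q ^ 2 : ℝ) / N ≤ 3 * rexp (-ℓ) := by
      rw [mul_div_assoc]
      linarith
    have h4 := Real.exp_pos (-ℓ)
    linarith
  · intro n hn
    have hn1 : (N : ℝ) ≤ n := by exact_mod_cast (mem_Ioc.1 hn).1.le
    have hn2 : (n : ℝ) ≤ 2 * N := by exact_mod_cast (mem_Ioc.1 hn).2
    have hn0 : (0 : ℝ) < n := by linarith
    have hW := norm_weyl_sum_le hR hℓ hΛ hX1 hX2 (hexpΛ.trans_le hn1) (by rw [hexpΛ]; exact hn2)
      (taylorCoeff (degreeOf R) X n) (abs_taylorCoeff hX0 hn0.le) hQ1 hQ2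
    refine (norm_sum_expi_shift_le hX0 hn0 hW).trans ?_
    refine mul_le_mul_of_nonneg_right (add_le_add_right ?_ _) (by positivity)
    exact mul_le_mul hpi (htail n hn) (by positivity) (by norm_num)

/-- The sawtooth function. -/
noncomputable def saw (t : ℝ) : ℝ := Int.fract t - 1 / 2

/-- The periodic primitive of the sawtooth function with mean zero. -/
noncomputable def sawPrim (t : ℝ) : ℝ := (Int.fract t ^ 2 - Int.fract t + 1 / 6) / 2

theorem saw_le {t η : ℝ} (h0 : 0 < η) (h1 : η ≤ 1) :
    saw t ≤ (sawPrim t - sawPrim (t - η)) / η + η := by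
  have hf0 := Int.fract_nonneg t
  have hf1 := Int.fract_lt_one t
  rw [← sub_le_iff_le_add, le_div_iff₀ h0]
  unfold saw sawPrim
  rcases le_or_gt η (Int.fract t) with h | h
  · have : Int.fract (t - η) = Int.fract t - η := by
      rw [Int.fract_eq_iff]
      refine ⟨by linarith, by linarith, ⌊t⌋, ?_⟩
      have := Int.floor_add_fract t
      linarith
    rw [this]
    nlinarith
  · have : Int.fract (t - η) = Int.fract t - η + 1 := by
      rw [Int.fract_eq_iff]
      refine ⟨by linarith, by linarith, ⌊t⌋ - 1, ?_⟩
      have := Int.floor_add_fract t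
      push_cast
      linarith
    rw [this]
    nlinarith

theorem le_saw {t η : ℝ} (h0 : 0 < η) (h1 : η ≤ 1) :
    (sawPrim (t + η) - sawPrim t) / η - η ≤ saw t := by
  have hf0 := Int.fract_nonneg t
  have hf1 := Int.fract_lt_one t
  rw [sub_le_iff_le_add, div_le_iff₀ h0]
  unfold saw sawPrim
  rcases lt_or_ge (Int.fract t + η) 1 with h | h
  · have : Int.fract (t + η) = Int.fract t + η := by
      rw [Int.fract_eq_iff]
      refine ⟨by linarith, by linarith, ⌊t⌋, ?_⟩
      have := Int.floor_add_fract t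
      linarith
    rw [this]
    nlinarith
  · have : Int.fract (t + η) = Int.fract t + η - 1 := by
      rw [Int.fract_eq_iff]
      refine ⟨by linarith, by linarith, ⌊t⌋ + 1, ?_⟩
      have := Int.floor_add_fract t
      push_cast
      linarith
    rw [this]
    nlinarith

theorem re_expi (t : ℝ) : (expi t).re = cos (2 * π * t) := by
  rw [expi, Complex.exp_ofReal_mul_I_re]

theorem hasSum_sawPrim (t : ℝ) :
    HasSum (fun h : ℕ => 1 / (2 * π ^ 2) * (1 / (h : ℝ) ^ 2 * (expi (h * t)).re)) (sawPrim t) := by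
  have h := hasSum_one_div_nat_pow_mul_cos one_ne_zero
    (x := Int.fract t) ⟨Int.fract_nonneg t, (Int.fract_lt_one t).le⟩
  have h2 := h.mul_left (1 / (2 * π ^ 2))
  have hB : (Polynomial.map (algebraMap ℚ ℝ) (Polynomial.bernoulli (2 * 1))).eval (Int.fract t) =
      Int.fract t ^ 2 - Int.fract t + 6⁻¹ := bernoulliFun_two _
  rw [hB] at h2
  convert! h2 using 1
  · ext m
    rw [re_expi]
    congr 2
    have h3 : 2 * π * (m * t) = 2 * π * m * Int.fract t + (m * ⌊t⌋ : ℤ) * (2 * π) := by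
      nth_rewrite 1 [← Int.floor_add_fract t]
      push_cast
      ring
    rw [h3, Real.cos_add_int_mul_two_pi]
  · unfold sawPrim
    have := Real.pi_ne_zero
    norm_num
    field_simp

theorem abs_sum_sawPrim_le {ι : Type*} (s : Finset ι) (w t : ι → ℝ) (hw : ∀ i ∈ s, 0 ≤ w i)
    (hw1 : ∑ i ∈ s, w i ≤ 1) {B : ℝ} {H : ℕ} (hB : 0 ≤ B)
    (h : ∀ h : ℕ, 1 ≤ h → h ≤ H → ‖∑ i ∈ s, expi (h * t i) * w i‖ ≤ B) (δ : ℝ) :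
    |∑ i ∈ s, w i * sawPrim (t i + δ)| ≤ B + 1 / (H + 1) := by
  have hlim := (hasSum_sum fun i (_ : i ∈ s) => (hasSum_sawPrim (t i + δ)).mul_left (w i)).tendsto_sum_nat
  refine le_of_tendsto hlim.abs (Eventually.of_forall fun M => ?_)
  have hpi : 1 / (2 * π ^ 2) ≤ 1 / 18 := by
    have := Real.pi_gt_three
    apply one_div_le_one_div_of_le (by norm_num)
    nlinarith
  have hterm : ∀ m ∈ range M, |∑ i ∈ s, w i *
      (1 / (2 * π ^ 2) * (1 / (m : ℝ) ^ 2 * (expi (m * (t i + δ))).re))| ≤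
      1 / 18 * ((if m ∈ Ioo 0 M then ((m : ℝ) ^ 2)⁻¹ else 0) * B +
        (if m ∈ Ioo H M then ((m : ℝ) ^ 2)⁻¹ else 0)) := by
    intro m hm
    rcases Nat.eq_zero_or_pos m with rfl | hm0
    · simp
    have hm2 : (0 : ℝ) < (m : ℝ) ^ 2 := by positivity
    have heq : ∑ i ∈ s, w i *
        (1 / (2 * π ^ 2) * (1 / (m : ℝ) ^ 2 * (expi (m * (t i + δ))).re)) =
        1 / (2 * π ^ 2) * (((m : ℝ) ^ 2)⁻¹ * (expi (m * δ) * ∑ i ∈ s, expi (m * t i) * w i).re) := by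
      rw [mul_sum, Complex.re_sum, mul_sum, mul_sum]
      refine sum_congr rfl fun i _ => ?_
      rw [mul_add, expi_add, mul_comm (expi (m * t i)), ← mul_assoc (expi (m * δ)),
        Complex.re_mul_ofReal]
      ring
    have hS : |(expi (m * δ) * ∑ i ∈ s, expi (m * t i) * w i).re| ≤
        B + (if m ∈ Ioo H M then 1 else 0) := by
      refine (Complex.abs_re_le_norm _).trans ?_
      rw [norm_mul, norm_expi, one_mul]
      split_ifs with hmH
      · have : ‖∑ i ∈ s, expi (m * t i) * w i‖ ≤ ∑ i ∈ s, w i := by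
          refine (norm_sum_le _ _).trans (sum_le_sum fun i hi => ?_)
          rw [norm_mul, norm_expi, one_mul, Complex.norm_real, Real.norm_of_nonneg (hw i hi)]
        linarith
      · rw [add_zero]
        refine h m hm0 ?_
        simp only [mem_Ioo, mem_range] at hmH hm
        omega
    rw [heq, abs_mul, abs_mul, abs_of_pos (by positivity), abs_of_pos (by positivity)]
    refine mul_le_mul hpi ?_ (by positivity) (by norm_num)
    rw [if_pos (mem_Ioo.2 ⟨hm0, mem_range.1 hm⟩)]
    refine (mul_le_mul_of_nonneg_left hS (by positivity)).trans_eq ?_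
    split_ifs <;> ring
  have hsum : ∀ K : ℕ, ∑ m ∈ range M, (if m ∈ Ioo K M then ((m : ℝ) ^ 2)⁻¹ else 0) ≤
      2 / (K + 1) := by
    intro K
    rw [← sum_filter]
    have : {m ∈ range M | m ∈ Ioo K M} = Ioo K M := by
      ext m
      simp only [mem_filter, mem_range, mem_Ioo]
      omega
    rw [this]
    exact sum_Ioo_inv_sq_le K M
  refine (abs_sum_le_sum_abs _ _).trans ((sum_le_sum hterm).trans ?_)
  rw [← mul_sum, sum_add_distrib, ← sum_mul]
  have h1 := hsum 0
  have h2 := hsum H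
  rw [Nat.cast_zero, zero_add, div_one] at h1
  have h3 := mul_le_mul_of_nonneg_right h1 hB
  have h4 : (2 : ℝ) / (H + 1) = 2 * (1 / (H + 1)) := by ring
  have h5 : (0 : ℝ) < 1 / (H + 1) := by positivity
  linarith

theorem abs_sum_saw_le {ι : Type*} (s : Finset ι) (w t : ι → ℝ) (hw : ∀ i ∈ s, 0 ≤ w i)
    (hw1 : ∑ i ∈ s, w i ≤ 1) {B η : ℝ} {H : ℕ} (hB : 0 ≤ B) (h0 : 0 < η) (h1 : η ≤ 1)
    (h : ∀ h : ℕ, 1 ≤ h → h ≤ H → ‖∑ i ∈ s, expi (h * t i) * w i‖ ≤ B) :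
    |∑ i ∈ s, w i * saw (t i)| ≤ η + 2 / η * (B + 1 / (H + 1)) := by
  have hF := abs_sum_sawPrim_le s w t hw hw1 hB h
  have hF0 := abs_le.1 (hF 0)
  have hFp := abs_le.1 (hF η)
  have hFm := abs_le.1 (hF (-η))
  simp only [add_zero] at hF0
  set D := B + 1 / ((H : ℝ) + 1)
  have hηw : η * ∑ i ∈ s, w i ≤ η := mul_le_of_le_one_right h0.le hw1
  have hD : 2 / η * D = (2 * D) / η := by ring
  rw [hD, abs_le]
  constructor
  · have hle : ∑ i ∈ s, w i * ((sawPrim (t i + η) - sawPrim (t i)) / η - η) ≤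
        ∑ i ∈ s, w i * saw (t i) :=
      sum_le_sum fun i hi => mul_le_mul_of_nonneg_left (le_saw h0 h1) (hw i hi)
    have heq : ∑ i ∈ s, w i * ((sawPrim (t i + η) - sawPrim (t i)) / η - η) =
        (∑ i ∈ s, w i * sawPrim (t i + η) - ∑ i ∈ s, w i * sawPrim (t i)) / η -
          η * ∑ i ∈ s, w i := by
      rw [← sum_sub_distrib, sum_div, mul_sum, ← sum_sub_distrib]
      exact sum_congr rfl fun i _ => by ring
    have h2 : -(2 * D) / η ≤
        (∑ i ∈ s, w i * sawPrim (t i + η) - ∑ i ∈ s, w i * sawPrim (t i)) / η := by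
      gcongr
      linarith
    rw [neg_div] at h2
    linarith
  · have hle : ∑ i ∈ s, w i * saw (t i) ≤
        ∑ i ∈ s, w i * ((sawPrim (t i) - sawPrim (t i + -η)) / η + η) :=
      sum_le_sum fun i hi => mul_le_mul_of_nonneg_left (saw_le h0 h1) (hw i hi)
    have heq : ∑ i ∈ s, w i * ((sawPrim (t i) - sawPrim (t i + -η)) / η + η) =
        (∑ i ∈ s, w i * sawPrim (t i) - ∑ i ∈ s, w i * sawPrim (t i + -η)) / η +
          η * ∑ i ∈ s, w i := by
      rw [← sum_sub_distrib, sum_div, mul_sum, ← sum_add_distrib]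
      exact sum_congr rfl fun i _ => by ring
    have h2 : (∑ i ∈ s, w i * sawPrim (t i) - ∑ i ∈ s, w i * sawPrim (t i + -η)) / η ≤
        (2 * D) / η := by
      gcongr
      linarith
    linarith

theorem norm_sum_expi_div_le_of_log {N : ℕ} {X ℓ : ℝ} (hN : 1 ≤ Real.log N) (hX : 0 < X)
    (hNX : 19 / 10 * Real.log N ≤ Real.log X) (hℓ : 2 * Real.log X ≤ rexp ℓ)
    (hX3 : 4 * 10 ^ 12 * Real.log X ^ 2 * ℓ ≤ Real.log N ^ 3) :
    ‖∑ n ∈ Ioc N (2 * N), expi (X / n) / n‖ ≤ 3 * 10 ^ 11 * rexp (-ℓ) := by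
  have hN1 : 1 ≤ N := by
    rcases Nat.eq_zero_or_pos N with rfl | h
    · norm_num at hN
    · exact h
  have hℓ0 : 0 ≤ ℓ := by
    by_contra! h
    have := Real.exp_lt_one_iff.2 h
    linarith
  set Λ := Real.log N
  set r := Real.log X / Λ with hr
  have hrΛ : r * Λ = Real.log X := by
    rw [hr]
    field_simp
  have hr19 : 19 / 10 ≤ r := by rwa [hr, le_div_iff₀ (by linarith)]
  have hRle : (⌊r + 1 / 10⌋₊ : ℝ) ≤ r + 1 / 10 := Nat.floor_le (by linarith)
  have hRlt := Nat.lt_floor_add_one (r + 1 / 10)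
  have hR2 : 2 ≤ ⌊r + 1 / 10⌋₊ := Nat.le_floor (by push_cast; linarith)
  set R := ⌊r + 1 / 10⌋₊
  have hR2' : (2 : ℝ) ≤ R := by exact_mod_cast hR2
  have hR : (R : ℝ) ≤ 2 * r := by linarith
  have hRX : (R : ℝ) * Λ ≤ 2 * Real.log X := by
    rw [← hrΛ, ← mul_assoc]
    gcongr
  refine norm_sum_expi_div_le hR2 hN1 ?_ ?_ ?_ ?_
  · rw [Real.log_le_iff_le_exp (by linarith)]
    refine le_trans ?_ (hRX.trans hℓ)
    exact le_mul_of_one_le_right (by linarith) hN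
  · have hΛ2 : (0 : ℝ) < Λ ^ 2 := by positivity
    refine le_of_mul_le_mul_right ?_ hΛ2
    have h1 : ((R : ℝ) * Λ) ^ 2 ≤ (2 * Real.log X) ^ 2 := by gcongr
    calc 10 ^ 12 * (R : ℝ) ^ 2 * ℓ * Λ ^ 2 = 10 ^ 12 * (R * Λ) ^ 2 * ℓ := by ring
      _ ≤ 10 ^ 12 * (2 * Real.log X) ^ 2 * ℓ := by gcongr
      _ = 4 * 10 ^ 12 * Real.log X ^ 2 * ℓ := by ring
      _ ≤ Λ ^ 3 := hX3
      _ = _ := by ring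
  · rw [← Real.le_log_iff_exp_le hX, ← hrΛ]
    exact mul_le_mul_of_nonneg_right (by linarith) (by linarith)
  · rw [← Real.log_le_iff_le_exp hX, ← hrΛ]
    exact mul_le_mul_of_nonneg_right (by linarith) (by linarith)

theorem log_le_div_four {L : ℝ} (hL : 100 ≤ L) : Real.log L ≤ L / 4 := by
  have h1 := Real.log_sqrt (by linarith : 0 ≤ L)
  have h2 := Real.log_le_sub_one_of_pos (Real.sqrt_pos.2 (by linarith : 0 < L))
  have h3 := Real.sq_sqrt (by linarith : 0 ≤ L)
  have h4 : 10 ≤ √L := Real.le_sqrt_of_sq_le (by norm_num; exact hL)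
  nlinarith

theorem abs_sum_saw_block_le {N d : ℕ} {x : ℝ} (hx : 0 < x) (c : ℝ) (hL : 100 ≤ Real.log x) (hd1 : 1 ≤ d)
    (hd : Real.log d ≤ Real.log x / 20) (hN2 : Real.log N ≤ Real.log x / 2)
    (hN1 : 1 ≤ Real.log N)
    (hN3 : 10 ^ 14 * (Real.log x ^ 2 * Real.log (Real.log x)) ≤ Real.log N ^ 3) :
    |∑ n ∈ Ioc N (2 * N), 1 / (n : ℝ) * saw (x / n / d - c)| ≤ 10 ^ 12 / Real.log x ^ 2 := by
  set L := Real.log x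
  have hL0 : 0 < L := by linarith
  have hd' : (0 : ℝ) < d := by exact_mod_cast hd1
  have hlogL := log_le_div_four hL
  have hlogL0 : 0 ≤ Real.log L := Real.log_nonneg (by linarith)
  have hexp : rexp (4 * Real.log L) = L ^ 4 := by
    rw [← Real.log_rpow hL0, Real.exp_log (by positivity)]
    norm_cast
  have hH := Nat.lt_floor_add_one (L ^ 4)
  have hbound : ∀ h : ℕ, 1 ≤ h → h ≤ ⌊L ^ 4⌋₊ →
      ‖∑ n ∈ Ioc N (2 * N), expi (h * (x / n / d - c)) * ((1 / (n : ℝ) : ℝ) : ℂ)‖ ≤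
        3 * 10 ^ 11 / L ^ 4 := by
    intro h h1 hH
    have h1' : (1 : ℝ) ≤ h := by exact_mod_cast h1
    have hL4 : (h : ℝ) ≤ L ^ 4 := (Nat.le_floor_iff (by positivity)).1 hH
    have hlogh : Real.log h ≤ 4 * Real.log L := by
      rw [Real.log_le_iff_le_exp (by linarith), hexp]
      exact hL4
    have hlogX : Real.log (h * x / d) = Real.log h + L - Real.log d := by
      rw [Real.log_div (by positivity) (by positivity), Real.log_mul (by positivity) (by positivity)]
    have hlogh0 := Real.log_nonneg h1'
    have hlogd0 := Real.log_nonneg (by exact_mod_cast hd1 : (1 : ℝ) ≤ d)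
    have hkey := norm_sum_expi_div_le_of_log (N := N) (X := h * x / d) (ℓ := 4 * Real.log L) hN1
      (by positivity) (by rw [hlogX]; linarith) ?_ ?_
    · have heq : ∑ n ∈ Ioc N (2 * N), expi (h * (x / n / d - c)) * ((1 / (n : ℝ) : ℝ) : ℂ) =
          expi (-(h * c)) * ∑ n ∈ Ioc N (2 * N), expi (h * x / d / n) / n := by
        rw [mul_sum]
        refine sum_congr rfl fun n _ => ?_
        have : (h : ℝ) * (x / n / d - c) = -(h * c) + h * x / d / n := by ring
        rw [this, expi_add]
        push_cast
        ring
      rw [heq, norm_mul, norm_expi, one_mul]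
      refine hkey.trans_eq ?_
      rw [Real.exp_neg, hexp]
      ring
    · rw [hlogX, hexp]
      have h2 : (100 : ℝ) ^ 3 ≤ L ^ 3 := by gcongr
      have h3 : L ^ 4 = L ^ 3 * L := by ring
      have h4 := mul_le_mul_of_nonneg_right h2 hL0.le
      linarith
    · refine le_trans ?_ hN3
      rw [hlogX]
      have h2 : (Real.log h + L - Real.log d) ^ 2 ≤ (2 * L) ^ 2 := by
        apply pow_le_pow_left₀ <;> linarith
      have h3 : 0 ≤ L ^ 2 * Real.log L := by positivity
      have h4 := mul_le_mul_of_nonneg_right h2 hlogL0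
      linarith
  have hη1 : 1 / L ^ 2 ≤ 1 := by
    rw [div_le_one (by positivity)]
    nlinarith
  have hsaw := abs_sum_saw_le (Ioc N (2 * N)) (fun n => 1 / (n : ℝ)) (fun n => x / n / d - c)
    (fun n _ => by positivity) (sum_one_div_Ioc_le N) (by positivity) (by positivity) hη1 hbound
  refine hsaw.trans ?_
  have hH' : 1 / ((⌊L ^ 4⌋₊ : ℝ) + 1) ≤ 1 / L ^ 4 :=
    one_div_le_one_div_of_le (by positivity) hH.le
  calc 1 / L ^ 2 + 2 / (1 / L ^ 2) * (3 * 10 ^ 11 / L ^ 4 + 1 / ((⌊L ^ 4⌋₊ : ℝ) + 1)) ≤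
      1 / L ^ 2 + 2 / (1 / L ^ 2) * (3 * 10 ^ 11 / L ^ 4 + 1 / L ^ 4) := by gcongr
    _ = (1 + 2 * (3 * 10 ^ 11 + 1)) / L ^ 2 := by field_simp
    _ ≤ _ := by
      gcongr
      norm_num

theorem dvd_floor_eq_saw {d : ℕ} (hd : 1 ≤ d) {t : ℝ} (ht : 1 ≤ t) :
    (if d ∣ ⌊t⌋₊ then 1 else 0 : ℝ) = 1 / d - saw (t / d) + saw (t / d - 1 / d) := by
  have hd' : (0 : ℝ) < d := by exact_mod_cast hd
  have h1 : (⌊t⌋₊ / d : ℕ) = (⌊t / d⌋ : ℤ) := by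
    rw [← Nat.floor_div_natCast, Int.natCast_floor_eq_floor (by positivity)]
  have h2 : ((⌊t⌋₊ - 1) / d : ℕ) = (⌊t / d - 1 / d⌋ : ℤ) := by
    have h3 : t / d - 1 / d = (t - 1) / d := by ring
    have h4 : 0 ≤ (t - 1) / d := div_nonneg (by linarith) hd'.le
    rw [h3, ← Int.natCast_floor_eq_floor h4, Nat.floor_div_natCast, Nat.floor_sub_one]
  have h3 : 1 ≤ ⌊t⌋₊ := Nat.le_floor (by simpa using ht)
  have h4 := Nat.succ_div (a := ⌊t⌋₊ - 1) (b := d)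
  rw [Nat.sub_add_cancel h3] at h4
  have h5 : ((⌊t / d⌋ : ℤ) : ℝ) = (⌊t / d - 1 / d⌋ : ℤ) + (if d ∣ ⌊t⌋₊ then 1 else 0 : ℝ) := by
    rw [← h1, ← h2, h4]
    push_cast
    rfl
  unfold saw Int.fract
  rw [h5]
  ring

/-- The Möbius function with real values. -/
noncomputable def mob (d : ℕ) : ℝ := (ArithmeticFunction.moebius d : ℝ)

theorem abs_mob_le_one (d : ℕ) : |mob d| ≤ 1 := by
  unfold mob
  exact_mod_cast ArithmeticFunction.abs_moebius_le_one

theorem totient_div_eq_sum {m : ℕ} (hm : 1 ≤ m) :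
    (Nat.totient m : ℝ) / m = ∑ d ∈ m.divisors, mob d / d := by
  have h := (ArithmeticFunction.sum_eq_iff_sum_mul_moebius_eq (R := ℝ)
    (f := fun n => (Nat.totient n : ℝ)) (g := fun n => (n : ℝ))).1
    (fun n _ => by exact_mod_cast Nat.sum_totient n) m hm
  have hm' : (m : ℝ) ≠ 0 := by positivity
  rw [← h, Nat.sum_divisorsAntidiagonal (fun a b => ((ArithmeticFunction.moebius a : ℤ) : ℝ) * (b : ℝ)),
    sum_div]
  refine sum_congr rfl fun d hd => ?_
  have hdm := Nat.dvd_of_mem_divisors hd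
  have hd0 : (d : ℝ) ≠ 0 := by
    have := Nat.pos_of_mem_divisors hd
    positivity
  rw [Nat.cast_div hdm hd0]
  unfold mob
  field_simp

theorem hasSum_mob : HasSum (fun d : ℕ => mob d / (d : ℝ) ^ 2) (6 / π ^ 2) := by
  have hs : 1 < (2 : ℂ).re := by norm_num
  have h1 := (ArithmeticFunction.LSeriesSummable_moebius_iff.2 hs).LSeriesHasSum
  have h2 := ArithmeticFunction.LSeries_zeta_mul_Lseries_moebius hs
  rw [ArithmeticFunction.LSeries_zeta_eq_riemannZeta hs, riemannZeta_two] at h2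
  have hpi : (π : ℂ) ≠ 0 := by exact_mod_cast Real.pi_ne_zero
  have h3 : LSeries (fun n => ((ArithmeticFunction.moebius n : ℤ) : ℂ)) 2 =
      ((6 / π ^ 2 : ℝ) : ℂ) := by
    push_cast
    field_simp at h2 ⊢
    exact h2
  rw [← Complex.hasSum_ofReal, ← h3]
  unfold LSeriesHasSum at h1
  convert! h1 using 1
  ext d
  rw [LSeries.term_of_ne_zero' two_ne_zero]
  unfold mob
  push_cast
  congr 1
  exact_mod_cast (Complex.cpow_natCast (d : ℂ) 2).symm

theorem abs_sum_mob_sub_le (D : ℕ) :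
    |∑ d ∈ Icc 1 D, mob d / (d : ℝ) ^ 2 - 6 / π ^ 2| ≤ 2 / (D + 1 : ℝ) := by
  have hlim := hasSum_mob.tendsto_sum_nat
  have hlim2 := (tendsto_const_nhds (x := ∑ d ∈ Icc 1 D, mob d / (d : ℝ) ^ 2)).sub hlim
  refine le_of_tendsto hlim2.abs ?_
  filter_upwards [eventually_gt_atTop D] with M hM
  have hsplit : ∑ d ∈ range M, mob d / (d : ℝ) ^ 2 =
      ∑ d ∈ Icc 1 D, mob d / (d : ℝ) ^ 2 + ∑ d ∈ Ioo D M, mob d / (d : ℝ) ^ 2 := by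
    have hdisj : Disjoint (Icc 1 D) (Ioo D M) := by
      rw [Finset.disjoint_left]
      intro a ha hb
      simp only [mem_Icc, mem_Ioo] at ha hb
      omega
    rw [← sum_union hdisj]
    symm
    apply sum_subset
    · intro a ha
      simp only [mem_union, mem_Icc, mem_Ioo, mem_range] at ha ⊢
      omega
    · intro a ha hb
      have : a = 0 := by
        simp only [mem_union, mem_Icc, mem_Ioo, mem_range] at ha hb
        omega
      simp [this]
  rw [hsplit, sub_add_cancel_left, abs_neg]
  refine (abs_sum_le_sum_abs _ _).trans (le_trans (sum_le_sum fun d _ => ?_) (sum_Ioo_inv_sq_le D M))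
  rw [abs_div, abs_of_nonneg (sq_nonneg (d : ℝ)), inv_eq_one_div]
  gcongr
  exact abs_mob_le_one d

theorem exists_two_pow_card_primeFactors_le :
    ∃ C : ℝ, 0 < C ∧ ∀ m : ℕ, 1 ≤ m → (2 : ℝ) ^ #m.primeFactors ≤ C * (m : ℝ) ^ (1 / 40 : ℝ) := by
  have h1 := (tendsto_rpow_atTop (by norm_num : (0 : ℝ) < 1 / 40)).comp tendsto_natCast_atTop_atTop
  obtain ⟨P, hP⟩ := eventually_atTop.1 (h1.eventually_ge_atTop 2)
  refine ⟨2 ^ P, by positivity, fun m hm => ?_⟩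
  have hpos : ∀ p ∈ m.primeFactors, (1 : ℝ) ≤ (p : ℝ) ^ (1 / 40 : ℝ) := fun p hp =>
    Real.one_le_rpow (by exact_mod_cast (Nat.prime_of_mem_primeFactors hp).one_le) (by norm_num)
  calc (2 : ℝ) ^ #m.primeFactors = ∏ p ∈ m.primeFactors, 2 := by rw [prod_const]
    _ ≤ ∏ p ∈ m.primeFactors, ((if p < P then 2 else 1) * (p : ℝ) ^ (1 / 40 : ℝ)) := by
      refine prod_le_prod (fun _ _ => by norm_num) fun p hp => ?_
      split_ifs with h
      · linarith [hpos p hp]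
      · rw [one_mul]
        exact hP p (not_lt.1 h)
    _ = (∏ p ∈ m.primeFactors, if p < P then (2 : ℝ) else 1) *
        ((∏ p ∈ m.primeFactors, p : ℕ) : ℝ) ^ (1 / 40 : ℝ) := by
      rw [prod_mul_distrib, Nat.cast_prod, Real.finsetProd_rpow _ _ fun p _ => Nat.cast_nonneg p]
    _ ≤ 2 ^ P * (m : ℝ) ^ (1 / 40 : ℝ) := by
      gcongr
      · rw [prod_ite, prod_const, prod_const_one, mul_one]
        refine pow_le_pow_right₀ (by norm_num) ?_
        calc #{p ∈ m.primeFactors | p < P} ≤ #(range P) := by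
              refine card_le_card fun p hp => ?_
              exact mem_range.2 (mem_filter.1 hp).2
          _ = P := card_range P
      · exact Nat.le_of_dvd hm (Nat.prod_primeFactors_dvd m)

theorem card_squarefree_divisors {m : ℕ} (hm : m ≠ 0) :
    #{d ∈ m.divisors | Squarefree d} = 2 ^ #m.primeFactors := by
  rw [card_eq_sum_ones, Nat.sum_divisors_filter_squarefree hm, ← card_eq_sum_ones, card_powerset]
  congr 2
  ext p
  simp [Nat.factors_eq]

theorem exists_abs_totient_div_sub_le :
    ∃ C : ℝ, 0 < C ∧ ∀ m D : ℕ, 1 ≤ m → |(Nat.totient m : ℝ) / m -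
      ∑ d ∈ Icc 1 D, mob d / d * (if d ∣ m then 1 else 0)| ≤ C * (m : ℝ) ^ (1 / 40 : ℝ) / (D + 1) := by
  obtain ⟨C, hC0, hC⟩ := exists_two_pow_card_primeFactors_le
  refine ⟨C, hC0, fun m D hm => ?_⟩
  have h1 : ∑ d ∈ Icc 1 D, mob d / d * (if d ∣ m then 1 else 0 : ℝ) =
      ∑ d ∈ m.divisors with d ≤ D, mob d / d := by
    simp_rw [mul_ite, mul_one, mul_zero]
    rw [← sum_filter]
    refine sum_congr ?_ fun _ _ => rfl
    ext d
    simp only [mem_filter, mem_Icc, Nat.mem_divisors]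
    constructor
    · rintro ⟨⟨_, h2⟩, h3⟩
      exact ⟨⟨h3, by omega⟩, h2⟩
    · rintro ⟨⟨h3, _⟩, h2⟩
      exact ⟨⟨Nat.pos_of_dvd_of_pos h3 hm, h2⟩, h3⟩
  rw [totient_div_eq_sum hm, h1, ← sum_filter_add_sum_filter_not m.divisors (fun d => d ≤ D),
    add_sub_cancel_left]
  refine (abs_sum_le_sum_abs _ _).trans ?_
  calc ∑ d ∈ m.divisors with ¬ d ≤ D, |mob d / d| ≤
      ∑ d ∈ m.divisors with ¬ d ≤ D, (if Squarefree d then 1 / (D + 1 : ℝ) else 0) := by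
        refine sum_le_sum fun d hd => ?_
        have hd2 : (D : ℝ) + 1 ≤ d := by
          exact_mod_cast not_le.1 (mem_filter.1 hd).2
        split_ifs with h
        · rw [abs_div, Nat.abs_cast]
          exact div_le_div₀ zero_le_one (abs_mob_le_one d) (by positivity) hd2
        · rw [mob, ArithmeticFunction.moebius_eq_zero_of_not_squarefree h]
          simp
    _ ≤ ∑ d ∈ m.divisors, (if Squarefree d then 1 / (D + 1 : ℝ) else 0) := by
      refine sum_le_sum_of_subset_of_nonneg (filter_subset _ _) fun d _ _ => ?_
      split_ifs <;> positivity
    _ = 2 ^ #m.primeFactors * (1 / (D + 1 : ℝ)) := by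
      rw [← sum_filter, sum_const, card_squarefree_divisors (by omega), nsmul_eq_mul]
      push_cast
      rfl
    _ ≤ C * (m : ℝ) ^ (1 / 40 : ℝ) * (1 / (D + 1 : ℝ)) := by
      gcongr
      exact hC m hm
    _ = _ := by ring

theorem sum_one_div_Icc_le {D : ℕ} {y : ℝ} (hy : 0 ≤ y) (hD : (D : ℝ) ≤ rexp y) :
    ∑ d ∈ Icc 1 D, (1 / d : ℝ) ≤ 1 + y := by
  have h1 := harmonic_le_one_add_log D
  have h2 : Real.log D ≤ y := by
    rcases Nat.eq_zero_or_pos D with rfl | h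
    · simpa using hy
    · rwa [Real.log_le_iff_le_exp (by exact_mod_cast h)]
  rw [harmonic_eq_sum_Icc] at h1
  push_cast at h1
  simp_rw [one_div]
  linarith

theorem abs_sum_mob_saw_block_le {N D : ℕ} {x : ℝ} (hx : 0 < x) (hL : 100 ≤ Real.log x)
    (hD : (D : ℝ) ≤ rexp (Real.log x / 20)) (hN2 : Real.log N ≤ Real.log x / 2)
    (hN1 : 1 ≤ Real.log N)
    (hN3 : 10 ^ 14 * (Real.log x ^ 2 * Real.log (Real.log x)) ≤ Real.log N ^ 3) :
    |∑ d ∈ Icc 1 D, mob d / d * ∑ n ∈ Ioc N (2 * N),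
      1 / (n : ℝ) * (saw (x / n / d - 1 / d) - saw (x / n / d))| ≤ 2 * 10 ^ 12 / Real.log x := by
  set L := Real.log x
  have hL0 : 0 < L := by linarith
  refine (abs_sum_le_sum_abs _ _).trans ?_
  calc _ ≤ ∑ d ∈ Icc 1 D, (1 / d : ℝ) * (2 * 10 ^ 12 / L ^ 2) := by
        refine sum_le_sum fun d hd => ?_
        obtain ⟨hd1, hdD⟩ := mem_Icc.1 hd
        have hd' : (0 : ℝ) < d := by exact_mod_cast hd1
        have hlogd : Real.log d ≤ L / 20 := by
          rw [Real.log_le_iff_le_exp hd']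
          exact (by exact_mod_cast hdD : (d : ℝ) ≤ D).trans hD
        have h1 := abs_sum_saw_block_le hx (1 / d) hL hd1 hlogd hN2 hN1 hN3
        have h2 := abs_sum_saw_block_le hx 0 hL hd1 hlogd hN2 hN1 hN3
        simp only [sub_zero] at h2
        rw [abs_mul]
        refine mul_le_mul ?_ ?_ (abs_nonneg _) (by positivity)
        · rw [abs_div, Nat.abs_cast]
          gcongr
          exact abs_mob_le_one d
        · simp_rw [mul_sub, sum_sub_distrib]
          refine (abs_sub _ _).trans ?_
          rw [mul_div_assoc]
          linarith
    _ = (∑ d ∈ Icc 1 D, (1 / d : ℝ)) * (2 * 10 ^ 12 / L ^ 2) := by rw [sum_mul]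
    _ ≤ L * (2 * 10 ^ 12 / L ^ 2) := by
      gcongr
      exact (sum_one_div_Icc_le (by positivity) hD).trans (by linarith)
    _ = _ := by field_simp

theorem exists_abs_sum_totient_block_le :
    ∃ C : ℝ, 0 < C ∧ ∀ (x : ℝ) (N : ℕ), 0 < x → 100 ≤ Real.log x → Real.log N ≤ Real.log x / 2 →
      1 ≤ Real.log N → 10 ^ 14 * (Real.log x ^ 2 * Real.log (Real.log x)) ≤ Real.log N ^ 3 →
      2 * (N : ℝ) ≤ x →
      |∑ n ∈ Ioc N (2 * N), 1 / (n : ℝ) *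
        ((Nat.totient ⌊x / n⌋₊ : ℝ) / ⌊x / n⌋₊ - 6 / π ^ 2)| ≤ C / Real.log x := by
  obtain ⟨C, hC0, hC⟩ := exists_abs_totient_div_sub_le
  refine ⟨40 * C + 2 * 10 ^ 12 + 40, by positivity, fun x N hx hL hN2 hN1 hN3 hNx => ?_⟩
  set L := Real.log x
  have hL0 : 0 < L := by linarith
  have hxL : x = rexp L := (Real.exp_log hx).symm
  have hNpos : 0 < N := by
    rcases Nat.eq_zero_or_pos N with rfl | h
    · norm_num at hN1
    · exact h
  set D := ⌊rexp (L / 20)⌋₊ with hDdef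
  have hD1 : (D : ℝ) ≤ rexp (L / 20) := Nat.floor_le (Real.exp_pos _).le
  have hD2 : rexp (L / 20) ≤ D + 1 := (Nat.lt_floor_add_one _).le
  have hsum1 := sum_one_div_Ioc_le N
  have hsum0 : 0 ≤ ∑ n ∈ Ioc N (2 * N), (1 / n : ℝ) := sum_nonneg fun _ _ => by positivity
  have hquot : ∀ n ∈ Ioc N (2 * N), 1 ≤ x / n ∧ x / n ≤ x := by
    intro n hn
    obtain ⟨hn1, hn2⟩ := mem_Ioc.1 hn
    have h1 : (1 : ℝ) ≤ n := by exact_mod_cast (by omega : 1 ≤ n)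
    have h2 : (n : ℝ) ≤ 2 * N := by exact_mod_cast hn2
    refine ⟨?_, div_le_self hx.le h1⟩
    rw [le_div_iff₀ (by linarith)]
    linarith
  have hsaw := abs_sum_mob_saw_block_le hx hL hD1 hN2 hN1 hN3
  have hmob := abs_sum_mob_sub_le D
  have hdecomp : ∑ n ∈ Ioc N (2 * N), 1 / (n : ℝ) *
      ((Nat.totient ⌊x / n⌋₊ : ℝ) / ⌊x / n⌋₊ - 6 / π ^ 2) =
      ∑ n ∈ Ioc N (2 * N), 1 / (n : ℝ) * ((Nat.totient ⌊x / n⌋₊ : ℝ) / ⌊x / n⌋₊ -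
        ∑ d ∈ Icc 1 D, mob d / d * (if d ∣ ⌊x / n⌋₊ then 1 else 0)) +
      ∑ d ∈ Icc 1 D, mob d / d * ∑ n ∈ Ioc N (2 * N),
        1 / (n : ℝ) * (saw (x / n / d - 1 / d) - saw (x / n / d)) +
      (∑ d ∈ Icc 1 D, mob d / (d : ℝ) ^ 2 - 6 / π ^ 2) * ∑ n ∈ Ioc N (2 * N), (1 / n : ℝ) := by
    have hind : ∀ n ∈ Ioc N (2 * N), ∑ d ∈ Icc 1 D, mob d / d *
        (if d ∣ ⌊x / n⌋₊ then 1 else 0 : ℝ) = ∑ d ∈ Icc 1 D, mob d / (d : ℝ) ^ 2 +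
          ∑ d ∈ Icc 1 D, mob d / d * (saw (x / n / d - 1 / d) - saw (x / n / d)) := by
      intro n hn
      rw [← sum_add_distrib]
      refine sum_congr rfl fun d hd => ?_
      rw [dvd_floor_eq_saw (mem_Icc.1 hd).1 (hquot n hn).1]
      ring
    have hswap : ∑ d ∈ Icc 1 D, mob d / d * ∑ n ∈ Ioc N (2 * N),
        1 / (n : ℝ) * (saw (x / n / d - 1 / d) - saw (x / n / d)) =
        ∑ n ∈ Ioc N (2 * N), 1 / (n : ℝ) * ∑ d ∈ Icc 1 D,
          mob d / d * (saw (x / n / d - 1 / d) - saw (x / n / d)) := by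
      simp_rw [mul_sum]
      rw [sum_comm]
      exact sum_congr rfl fun _ _ => sum_congr rfl fun _ _ => by ring
    rw [hswap, mul_sum, ← sum_add_distrib, ← sum_add_distrib]
    refine sum_congr rfl fun n hn => ?_
    rw [hind n hn]
    ring
  have hexp : ∀ c : ℝ, 0 < c → rexp (-(L / c)) ≤ c / L := by
    intro c hc
    rw [Real.exp_neg, inv_le_comm₀ (Real.exp_pos _) (by positivity), inv_div]
    linarith [Real.add_one_le_exp (L / c)]
  have hDinv : 1 / ((D : ℝ) + 1) ≤ rexp (-(L / 20)) := by
    rw [Real.exp_neg, ← one_div]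
    exact one_div_le_one_div_of_le (Real.exp_pos _) hD2
  have htrunc : |∑ n ∈ Ioc N (2 * N), 1 / (n : ℝ) * ((Nat.totient ⌊x / n⌋₊ : ℝ) / ⌊x / n⌋₊ -
      ∑ d ∈ Icc 1 D, mob d / d * (if d ∣ ⌊x / n⌋₊ then 1 else 0))| ≤ 40 * C / L := by
    refine (abs_sum_le_sum_abs _ _).trans ?_
    calc _ ≤ ∑ n ∈ Ioc N (2 * N), (1 / n : ℝ) * (C * rexp (-(L / 40))) := by
          refine sum_le_sum fun n hn => ?_
          obtain ⟨hq1, hq2⟩ := hquot n hn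
          have hm := hC ⌊x / n⌋₊ D (Nat.le_floor (by simpa using hq1))
          rw [abs_mul, abs_of_nonneg (by positivity : (0 : ℝ) ≤ 1 / n)]
          refine mul_le_mul_of_nonneg_left (hm.trans ?_) (by positivity)
          have h1 : (⌊x / n⌋₊ : ℝ) ^ (1 / 40 : ℝ) ≤ rexp (L / 40) := by
            calc (⌊x / n⌋₊ : ℝ) ^ (1 / 40 : ℝ) ≤ x ^ (1 / 40 : ℝ) := by
                  gcongr
                  exact (Nat.floor_le (by linarith)).trans hq2
              _ = _ := by
                rw [hxL, ← Real.exp_mul]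
                ring_nf
          calc C * (⌊x / n⌋₊ : ℝ) ^ (1 / 40 : ℝ) / (D + 1) =
              C * ((⌊x / n⌋₊ : ℝ) ^ (1 / 40 : ℝ) * (1 / ((D : ℝ) + 1))) := by ring
            _ ≤ C * (rexp (L / 40) * rexp (-(L / 20))) := by gcongr
            _ = _ := by
              rw [← Real.exp_add]
              ring_nf
      _ = (∑ n ∈ Ioc N (2 * N), (1 / n : ℝ)) * (C * rexp (-(L / 40))) := by rw [sum_mul]
      _ ≤ 1 * (C * (40 / L)) := by
        gcongr
        exact hexp 40 (by norm_num)
      _ = _ := by ring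
  have hlast : |(∑ d ∈ Icc 1 D, mob d / (d : ℝ) ^ 2 - 6 / π ^ 2) *
      ∑ n ∈ Ioc N (2 * N), (1 / n : ℝ)| ≤ 40 / L := by
    rw [abs_mul, abs_of_nonneg hsum0]
    calc _ ≤ 2 / ((D : ℝ) + 1) * 1 := by gcongr
      _ = 2 * (1 / ((D : ℝ) + 1)) := by ring
      _ ≤ 2 * (20 / L) := by
        have := hexp 20 (by norm_num)
        linarith
      _ = _ := by ring
  rw [hdecomp]
  refine (abs_add_three _ _ _).trans ?_
  rw [add_div, add_div]
  linarith

theorem sum_Ioc_pow_two {i j : ℕ} (hij : i ≤ j) (f : ℕ → ℝ) :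
    ∑ n ∈ Ioc (2 ^ i) (2 ^ j), f n = ∑ k ∈ Ico i j, ∑ n ∈ Ioc (2 ^ k) (2 * 2 ^ k), f n := by
  induction j, hij using Nat.le_induction with
  | base => simp
  | succ j hij ih =>
    have h1 : (2 : ℕ) ^ i ≤ 2 ^ j := pow_le_pow_right₀ (by norm_num) hij
    have h2 : (2 : ℕ) ^ j ≤ 2 ^ (j + 1) := pow_le_pow_right₀ (by norm_num) (by omega)
    rw [sum_Ico_succ_top hij, ← ih, ← pow_succ', sum_Ioc_consecutive f h1 h2]

theorem abs_totient_floor_sub_le {t : ℝ} (ht : 1 ≤ t) :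
    |(Nat.totient ⌊t⌋₊ : ℝ) - t * ((Nat.totient ⌊t⌋₊ : ℝ) / ⌊t⌋₊)| ≤ 1 := by
  have h1 : 1 ≤ ⌊t⌋₊ := Nat.le_floor (by simpa using ht)
  have h1' : (0 : ℝ) < ⌊t⌋₊ := by exact_mod_cast h1
  have hle : (⌊t⌋₊ : ℝ) ≤ t := Nat.floor_le (by linarith)
  have hlt := Nat.lt_floor_add_one t
  have hφ : (Nat.totient ⌊t⌋₊ : ℝ) / ⌊t⌋₊ ≤ 1 := by
    rw [div_le_one h1']
    exact_mod_cast Nat.totient_le _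
  have heq : (Nat.totient ⌊t⌋₊ : ℝ) - t * ((Nat.totient ⌊t⌋₊ : ℝ) / ⌊t⌋₊) =
      -((t - ⌊t⌋₊) * ((Nat.totient ⌊t⌋₊ : ℝ) / ⌊t⌋₊)) := by
    field_simp
    ring
  rw [heq, abs_neg, abs_of_nonneg (mul_nonneg (by linarith) (by positivity))]
  exact mul_le_one₀ (by linarith) (by positivity) hφ

theorem exists_abs_sum_totient_middle_le :
    ∃ C : ℝ, 0 < C ∧ ∀ (x : ℝ) (i j : ℕ), 0 < x → 100 ≤ Real.log x → i ≤ j → 2 ≤ i →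
      (2 : ℝ) ^ j ≤ √x →
      10 ^ 14 * (Real.log x ^ 2 * Real.log (Real.log x)) ≤ Real.log (2 ^ i) ^ 3 →
      |∑ n ∈ Ioc ((2 : ℕ) ^ i) (2 ^ j), (Nat.totient ⌊x / (n : ℝ)⌋₊ : ℝ) -
        6 / π ^ 2 * x * ∑ n ∈ Ioc ((2 : ℕ) ^ i) (2 ^ j), (1 / n : ℝ)| ≤ C * x := by
  obtain ⟨C, hC0, hC⟩ := exists_abs_sum_totient_block_le
  refine ⟨C + 1, by positivity, fun x i j hx hL hij hi hj h3 => ?_⟩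
  set L := Real.log x with hLdef
  have hL0 : 0 < L := by linarith
  have hx1 : 1 ≤ x := by
    rw [← Real.exp_log hx]
    exact Real.one_le_exp hL0.le
  have hsqrt : √x ≤ x := by
    rw [Real.sqrt_le_left hx.le]
    nlinarith
  have hlog2 := Real.log_two_gt_d9
  have hjL : (j : ℝ) ≤ L := by
    have h1 := Real.log_le_log (by positivity) hj
    rw [Real.log_sqrt hx.le, Real.log_pow] at h1
    nlinarith [mul_le_mul_of_nonneg_left hlog2.le (Nat.cast_nonneg (α := ℝ) j)]
  have hblock : ∀ k ∈ Ico i j, |∑ n ∈ Ioc ((2 : ℕ) ^ k) (2 * 2 ^ k), 1 / (n : ℝ) *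
      ((Nat.totient ⌊x / n⌋₊ : ℝ) / ⌊x / n⌋₊ - 6 / π ^ 2)| ≤ C / L := by
    intro k hk
    obtain ⟨hk1, hk2⟩ := mem_Ico.1 hk
    have hkj : (2 : ℝ) ^ (k + 1) ≤ 2 ^ j := pow_le_pow_right₀ (by norm_num) hk2
    have hki : (2 : ℝ) ^ i ≤ 2 ^ k := pow_le_pow_right₀ (by norm_num) hk1
    have hlogi : 0 ≤ Real.log (2 ^ i) := Real.log_nonneg (one_le_pow₀ (by norm_num))
    have hlogki : Real.log (2 ^ i) ≤ Real.log (2 ^ k) := Real.log_le_log (by positivity) hki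
    have h4 : (2 : ℝ) ^ (k + 1) = 2 * 2 ^ k := pow_succ' _ _
    refine hC x (2 ^ k) hx hL ?_ ?_ ?_ ?_ <;> push_cast
    · have h5 : (2 : ℝ) ^ k ≤ √x := by
        have : (0 : ℝ) < 2 ^ k := by positivity
        linarith
      have h6 := Real.log_le_log (by positivity) h5
      rwa [Real.log_sqrt hx.le] at h6
    · refine le_trans ?_ hlogki
      rw [Real.log_pow]
      have : (2 : ℝ) ≤ i := by exact_mod_cast hi
      nlinarith
    · exact h3.trans (pow_le_pow_left₀ hlogi hlogki 3)
    · linarith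
  have hsum : |∑ n ∈ Ioc ((2 : ℕ) ^ i) (2 ^ j), 1 / (n : ℝ) *
      ((Nat.totient ⌊x / n⌋₊ : ℝ) / ⌊x / n⌋₊ - 6 / π ^ 2)| ≤ C := by
    rw [sum_Ioc_pow_two hij]
    refine (abs_sum_le_sum_abs _ _).trans ((sum_le_sum hblock).trans ?_)
    rw [sum_const, Nat.card_Ico, nsmul_eq_mul, mul_div_left_comm]
    refine mul_le_of_le_one_right hC0.le ?_
    rw [div_le_one hL0]
    refine le_trans ?_ hjL
    exact_mod_cast Nat.sub_le j i
  have hround : |∑ n ∈ Ioc ((2 : ℕ) ^ i) (2 ^ j), ((Nat.totient ⌊x / (n : ℝ)⌋₊ : ℝ) -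
      x / n * ((Nat.totient ⌊x / (n : ℝ)⌋₊ : ℝ) / ⌊x / (n : ℝ)⌋₊))| ≤ x := by
    refine (abs_sum_le_sum_abs _ _).trans ?_
    calc _ ≤ ∑ n ∈ Ioc ((2 : ℕ) ^ i) (2 ^ j), (1 : ℝ) := by
          refine sum_le_sum fun n hn => abs_totient_floor_sub_le ?_
          obtain ⟨hn1, hn2⟩ := mem_Ioc.1 hn
          have hn0 : (0 : ℝ) < n := by exact_mod_cast (Nat.zero_le _).trans_lt hn1
          rw [one_le_div hn0]
          have : (n : ℝ) ≤ 2 ^ j := by exact_mod_cast hn2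
          linarith
      _ ≤ (2 : ℝ) ^ j := by
        rw [sum_const, Nat.card_Ioc, nsmul_eq_mul, mul_one]
        exact_mod_cast Nat.sub_le (2 ^ j) (2 ^ i)
      _ ≤ x := hj.trans hsqrt
  have hdecomp : ∑ n ∈ Ioc ((2 : ℕ) ^ i) (2 ^ j), (Nat.totient ⌊x / (n : ℝ)⌋₊ : ℝ) -
      6 / π ^ 2 * x * ∑ n ∈ Ioc ((2 : ℕ) ^ i) (2 ^ j), (1 / n : ℝ) =
      ∑ n ∈ Ioc ((2 : ℕ) ^ i) (2 ^ j), ((Nat.totient ⌊x / (n : ℝ)⌋₊ : ℝ) -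
        x / n * ((Nat.totient ⌊x / (n : ℝ)⌋₊ : ℝ) / ⌊x / (n : ℝ)⌋₊)) +
      x * ∑ n ∈ Ioc ((2 : ℕ) ^ i) (2 ^ j), 1 / (n : ℝ) *
        ((Nat.totient ⌊x / n⌋₊ : ℝ) / ⌊x / n⌋₊ - 6 / π ^ 2) := by
    rw [mul_sum, mul_sum, ← sum_sub_distrib, ← sum_add_distrib]
    exact sum_congr rfl fun n _ => by ring
  rw [hdecomp]
  refine (abs_add_le _ _).trans ?_
  rw [abs_mul, abs_of_pos hx]
  have := mul_le_mul_of_nonneg_left hsum hx.le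
  linarith

/-- The number of `n > y` with `⌊x / n⌋ = m`. -/
noncomputable def fiberCount (x : ℝ) (y m : ℕ) : ℕ :=
  #((Ioc y ⌊x⌋₊).filter fun n : ℕ => ⌊x / (n : ℝ)⌋₊ = m)

theorem floor_div_eq_iff {x : ℝ} (hx : 0 ≤ x) {m n : ℕ} (hm : 1 ≤ m) (hn : 1 ≤ n) :
    ⌊x / (n : ℝ)⌋₊ = m ↔ n ∈ Ioc ⌊x / (m + 1 : ℝ)⌋₊ ⌊x / (m : ℝ)⌋₊ := by
  have hm' : (0 : ℝ) < m := by exact_mod_cast hm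
  have hn' : (0 : ℝ) < n := by exact_mod_cast hn
  rw [Nat.floor_eq_iff (by positivity), mem_Ioc, Nat.floor_lt (by positivity),
    Nat.le_floor_iff (by positivity), le_div_iff₀ hn', div_lt_iff₀ hn', le_div_iff₀ hm',
    div_lt_iff₀ (by positivity), mul_comm (m : ℝ), mul_comm ((m : ℝ) + 1)]
  tauto

theorem fiberCount_le {x : ℝ} (hx : 0 ≤ x) {y m : ℕ} (hm : 1 ≤ m) :
    (fiberCount x y m : ℝ) ≤ x / (m * (m + 1)) + 1 := by
  have hm' : (0 : ℝ) < m := by exact_mod_cast hm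
  have h1 : fiberCount x y m ≤ #(Ioc ⌊x / (m + 1 : ℝ)⌋₊ ⌊x / (m : ℝ)⌋₊) := by
    refine card_le_card fun n hn => ?_
    obtain ⟨hn1, hn2⟩ := mem_filter.1 hn
    exact (floor_div_eq_iff hx hm (by have := (mem_Ioc.1 hn1).1; omega)).1 hn2
  rw [Nat.card_Ioc] at h1
  have hle : x / (m + 1 : ℝ) ≤ x / m := by gcongr; linarith
  have h2 : ⌊x / (m + 1 : ℝ)⌋₊ ≤ ⌊x / (m : ℝ)⌋₊ := Nat.floor_le_floor hle
  have h3 : (fiberCount x y m : ℝ) ≤ (⌊x / (m : ℝ)⌋₊ : ℝ) - ⌊x / (m + 1 : ℝ)⌋₊ := by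
    rw [← Nat.cast_sub h2]
    exact_mod_cast h1
  have h4 : (⌊x / (m : ℝ)⌋₊ : ℝ) ≤ x / m := Nat.floor_le (by positivity)
  have h5 := Nat.lt_floor_add_one (x / (m + 1 : ℝ))
  have h6 : x / (m * (m + 1) : ℝ) = x / m - x / (m + 1) := by
    field_simp
    ring
  linarith

theorem le_fiberCount {x : ℝ} (hx : 0 ≤ x) {y m : ℕ} (hm : 1 ≤ m) (hy : y * (m + 1 : ℝ) ≤ x) :
    x / (m * (m + 1)) - 1 ≤ (fiberCount x y m : ℝ) := by
  have hm' : (1 : ℝ) ≤ m := by exact_mod_cast hm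
  have hle : x / (m + 1 : ℝ) ≤ x / m := by gcongr; linarith
  have h2 : ⌊x / (m + 1 : ℝ)⌋₊ ≤ ⌊x / (m : ℝ)⌋₊ := Nat.floor_le_floor hle
  have hyf : y ≤ ⌊x / (m + 1 : ℝ)⌋₊ := Nat.le_floor (by rwa [le_div_iff₀ (by positivity)])
  have h1 : #(Ioc ⌊x / (m + 1 : ℝ)⌋₊ ⌊x / (m : ℝ)⌋₊) ≤ fiberCount x y m := by
    refine card_le_card fun n hn => ?_
    have hn' := mem_Ioc.1 hn
    refine mem_filter.2 ⟨mem_Ioc.2 ⟨by omega, ?_⟩, (floor_div_eq_iff hx hm (by omega)).2 hn⟩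
    exact hn'.2.trans (Nat.floor_le_floor (div_le_self hx hm'))
  rw [Nat.card_Ioc] at h1
  have h3 : (⌊x / (m : ℝ)⌋₊ : ℝ) - ⌊x / (m + 1 : ℝ)⌋₊ ≤ fiberCount x y m := by
    rw [← Nat.cast_sub h2]
    exact_mod_cast h1
  have h4 : (⌊x / (m + 1 : ℝ)⌋₊ : ℝ) ≤ x / (m + 1) := Nat.floor_le (by positivity)
  have h5 := Nat.lt_floor_add_one (x / (m : ℝ))
  have h6 : x / (m * (m + 1) : ℝ) = x / m - x / (m + 1) := by
    field_simp
    ring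
  linarith

theorem sum_totient_eq_sum_fiberCount {x : ℝ} (hx : 0 ≤ x) {y : ℕ} (hy : 1 ≤ y) :
    ∑ n ∈ Ioc y ⌊x⌋₊, (Nat.totient ⌊x / (n : ℝ)⌋₊ : ℝ) =
      ∑ m ∈ Icc 1 ⌊x / y⌋₊, (Nat.totient m : ℝ) * fiberCount x y m := by
  have hmaps : ∀ n ∈ Ioc y ⌊x⌋₊, ⌊x / (n : ℝ)⌋₊ ∈ Icc 1 ⌊x / (y : ℝ)⌋₊ := by
    intro n hn
    obtain ⟨hn1, hn2⟩ := mem_Ioc.1 hn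
    have hy' : (0 : ℝ) < y := by exact_mod_cast hy
    have hyn : (y : ℝ) ≤ n := by exact_mod_cast hn1.le
    have hnx : (n : ℝ) ≤ x := (Nat.le_floor_iff hx).1 hn2
    refine mem_Icc.2 ⟨Nat.le_floor ?_, Nat.floor_le_floor (by gcongr)⟩
    rw [Nat.cast_one, one_le_div (by linarith)]
    exact hnx
  rw [← sum_fiberwise_of_maps_to hmaps]
  refine sum_congr rfl fun m _ => ?_
  rw [sum_congr rfl fun n hn => by rw [(mem_filter.1 hn).2], sum_const, nsmul_eq_mul, mul_comm]
  rfl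

theorem abs_sum_totient_large_sub_le {x : ℝ} {y : ℕ} (hy : 1 ≤ y) (hyx : y ≤ x) :
    |∑ n ∈ Ioc y ⌊x⌋₊, (Nat.totient ⌊x / (n : ℝ)⌋₊ : ℝ) -
      x * ∑ m ∈ Icc 1 ⌊x / y⌋₊, (Nat.totient m : ℝ) / (m * (m + 1))| ≤ (x / y) ^ 2 + x := by
  have hy' : (0 : ℝ) < y := by exact_mod_cast hy
  have hx : 0 ≤ x := by linarith
  rw [sum_totient_eq_sum_fiberCount hx hy, mul_sum, ← sum_sub_distrib]
  have hT1 : (⌊x / y⌋₊ : ℝ) ≤ x / y := Nat.floor_le (by positivity)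
  have hTpos : 1 ≤ ⌊x / y⌋₊ := Nat.le_floor (by rwa [Nat.cast_one, one_le_div hy'])
  set T := ⌊x / y⌋₊
  have hT0 : (0 : ℝ) < T := by exact_mod_cast hTpos
  refine (abs_sum_le_sum_abs _ _).trans ?_
  calc _ ≤ ∑ m ∈ Icc 1 T, ((T : ℝ) + if m = T then x else 0) := by
        refine sum_le_sum fun m hm => ?_
        obtain ⟨hm1, hmT⟩ := mem_Icc.1 hm
        have hm0 : (0 : ℝ) < m := by exact_mod_cast hm1
        have hφ : (Nat.totient m : ℝ) ≤ m := by exact_mod_cast Nat.totient_le m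
        have hmT' : (m : ℝ) ≤ T := by exact_mod_cast hmT
        have heq : (Nat.totient m : ℝ) * fiberCount x y m - x * (Nat.totient m / (m * (m + 1))) =
            Nat.totient m * (fiberCount x y m - x / (m * (m + 1))) := by ring
        rw [heq, abs_mul, Nat.abs_cast]
        have hup := fiberCount_le (y := y) hx hm1
        split_ifs with h
        · have hpos : 0 ≤ x / (m * (m + 1) : ℝ) := by positivity
          have h1 : |(fiberCount x y m : ℝ) - x / (m * (m + 1))| ≤ 1 + x / (m * (m + 1)) := by
            rw [abs_le]
            constructor <;> linarith [Nat.cast_nonneg (α := ℝ) (fiberCount x y m)]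
          have h2 : (m : ℝ) * (x / (m * (m + 1))) ≤ x := by
            rw [← mul_div_assoc, mul_div_mul_left _ _ hm0.ne']
            exact div_le_self hx (by linarith)
          calc _ ≤ (m : ℝ) * (1 + x / (m * (m + 1))) :=
                mul_le_mul hφ h1 (abs_nonneg _) hm0.le
            _ = m + m * (x / (m * (m + 1))) := by ring
            _ ≤ _ := by linarith
        · have hlt : m + 1 ≤ T := by omega
          have hlt' : (m : ℝ) + 1 ≤ x / y := le_trans (by exact_mod_cast hlt) hT1
          have hlo := le_fiberCount (y := y) hx hm1 (by
            rw [le_div_iff₀ hy'] at hlt'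
            linarith)
          have h1 : |(fiberCount x y m : ℝ) - x / (m * (m + 1))| ≤ 1 := by
            rw [abs_le]
            constructor <;> linarith
          calc _ ≤ (m : ℝ) * 1 := mul_le_mul hφ h1 (abs_nonneg _) hm0.le
            _ ≤ _ := by linarith
    _ = (T : ℝ) ^ 2 + x := by
      rw [sum_add_distrib, sum_const, Nat.card_Icc, sum_ite_eq', if_pos (mem_Icc.2 ⟨hTpos, le_rfl⟩),
        nsmul_eq_mul, Nat.add_sub_cancel, sq]
    _ ≤ _ := by gcongr

theorem sum_inv_sq_Icc_le_two (T : ℕ) : ∑ m ∈ Icc 1 T, (1 / (m : ℝ) ^ 2) ≤ 2 := by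
  have h := sum_Ioo_inv_sq_le (α := ℝ) 0 (T + 1)
  have heq : Icc 1 T = Ioo 0 (T + 1) := by
    ext m
    simp only [mem_Icc, mem_Ioo]
    omega
  rw [heq]
  simpa using h

theorem log_le_sum_one_div_Icc {t : ℝ} (ht : 1 ≤ t) :
    Real.log t ≤ ∑ k ∈ Icc 1 ⌊t⌋₊, (1 / k : ℝ) := by
  have h := log_add_one_le_harmonic ⌊t⌋₊
  rw [harmonic_eq_sum_Icc] at h
  push_cast at h
  have h2 : Real.log t ≤ Real.log (⌊t⌋₊ + 1) :=
    Real.log_le_log (by linarith) (Nat.lt_floor_add_one t).le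
  simpa using h2.trans h

theorem sum_one_div_Icc_floor_le {t : ℝ} (ht : 1 ≤ t) :
    ∑ k ∈ Icc 1 ⌊t⌋₊, (1 / k : ℝ) ≤ 1 + Real.log t :=
  sum_one_div_Icc_le (Real.log_nonneg ht) (by
    rw [Real.exp_log (by linarith)]
    exact Nat.floor_le (by linarith))

theorem sum_totient_div_sq_eq (T : ℕ) :
    ∑ m ∈ Icc 1 T, (Nat.totient m : ℝ) / m / m =
      ∑ d ∈ Icc 1 T, mob d / (d : ℝ) ^ 2 * ∑ k ∈ Icc 1 (T / d), (1 / k : ℝ) := by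
  have h1 : ∑ m ∈ Icc 1 T, (Nat.totient m : ℝ) / m / m =
      ∑ m ∈ Icc 1 T, ∑ p ∈ m.divisorsAntidiagonal, mob p.1 / (p.1 : ℝ) ^ 2 * (1 / p.2) := by
    refine sum_congr rfl fun m hm => ?_
    have hm1 := (mem_Icc.1 hm).1
    rw [totient_div_eq_sum hm1, sum_div,
      ← Nat.sum_divisorsAntidiagonal (fun d _ => mob d / (d : ℝ) / (m : ℝ))]
    refine sum_congr rfl fun p hp => ?_
    rw [← (Nat.mem_divisorsAntidiagonal.1 hp).1]
    push_cast
    rw [div_div, div_mul_div_comm, mul_one]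
    congr 1
    ring
  rw [h1]
  simp_rw [mul_sum]
  rw [sum_sigma', sum_sigma']
  refine sum_bij' (fun a _ => ⟨a.2.1, a.2.2⟩) (fun b _ => ⟨b.1 * b.2, (b.1, b.2)⟩) ?_ ?_ ?_ ?_ ?_
  · rintro ⟨m, d, k⟩ h
    simp only [mem_sigma, mem_Icc, Nat.mem_divisorsAntidiagonal] at h ⊢
    obtain ⟨⟨hm1, hmT⟩, hdk, -⟩ := h
    subst hdk
    have hd : 0 < d := Nat.pos_of_mul_pos_right hm1
    have hk : 0 < k := Nat.pos_of_mul_pos_left hm1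
    exact ⟨⟨hd, (Nat.le_mul_of_pos_right d hk).trans hmT⟩, hk,
      (Nat.le_div_iff_mul_le hd).2 (by rwa [mul_comm])⟩
  · rintro ⟨d, k⟩ h
    simp only [mem_sigma, mem_Icc, Nat.mem_divisorsAntidiagonal] at h ⊢
    obtain ⟨⟨hd, -⟩, hk, hkT⟩ := h
    have h2 := (Nat.le_div_iff_mul_le hd).1 hkT
    have h3 : 0 < d * k := Nat.mul_pos hd hk
    exact ⟨⟨h3, by rwa [mul_comm]⟩, trivial, h3.ne'⟩
  · rintro ⟨m, d, k⟩ h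
    simp only [mem_sigma, Nat.mem_divisorsAntidiagonal] at h
    obtain ⟨-, hdk, -⟩ := h
    subst hdk
    rfl
  · rintro ⟨d, k⟩ _
    rfl
  · rintro ⟨m, d, k⟩ _
    rfl

theorem exists_sum_log_div_sq_le :
    ∃ C : ℝ, 0 < C ∧ ∀ T : ℕ, ∑ d ∈ Icc 1 T, Real.log d / (d : ℝ) ^ 2 ≤ C := by
  have hs : Summable fun d : ℕ => 2 * (1 / (d : ℝ) ^ (3 / 2 : ℝ)) :=
    (Real.summable_one_div_nat_rpow.2 (by norm_num)).mul_left 2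
  have h0 : ∀ d : ℕ, 0 ≤ 2 * (1 / (d : ℝ) ^ (3 / 2 : ℝ)) := fun d => by positivity
  refine ⟨∑' d : ℕ, 2 * (1 / (d : ℝ) ^ (3 / 2 : ℝ)) + 1,
    add_pos_of_nonneg_of_pos (tsum_nonneg h0) one_pos, fun T => ?_⟩
  refine (sum_le_sum fun d hd => ?_).trans
    ((hs.sum_le_tsum (Icc 1 T) fun d _ => h0 d).trans (by linarith))
  have hd0 : (0 : ℝ) < d := by exact_mod_cast (mem_Icc.1 hd).1
  have hlog : Real.log d ≤ (d : ℝ) ^ (1 / 2 : ℝ) / (1 / 2) :=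
    Real.log_le_rpow_div hd0.le (by norm_num)
  have hsq : (d : ℝ) ^ 2 = (d : ℝ) ^ (1 / 2 : ℝ) * (d : ℝ) ^ (3 / 2 : ℝ) := by
    rw [← Real.rpow_add hd0, ← Real.rpow_natCast]
    norm_num
  have hp : 0 < (d : ℝ) ^ (1 / 2 : ℝ) := by positivity
  have hq : 0 < (d : ℝ) ^ (3 / 2 : ℝ) := by positivity
  rw [hsq, div_le_iff₀ (by positivity)]
  calc Real.log d ≤ 2 * (d : ℝ) ^ (1 / 2 : ℝ) := by linarith
    _ = _ := by field_simp

theorem exists_abs_sum_totient_div_sub_log_le :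
    ∃ C : ℝ, 0 < C ∧ ∀ T : ℕ, 1 ≤ T →
      |∑ m ∈ Icc 1 T, (Nat.totient m : ℝ) / (m * (m + 1)) - 6 / π ^ 2 * Real.log T| ≤ C := by
  obtain ⟨C, hC0, hC⟩ := exists_sum_log_div_sq_le
  refine ⟨C + 6, by positivity, fun T hT => ?_⟩
  have hT' : (1 : ℝ) ≤ T := by exact_mod_cast hT
  have hT0 : (0 : ℝ) < T := by linarith
  have hshift : |∑ m ∈ Icc 1 T, (Nat.totient m : ℝ) / (m * (m + 1)) -
      ∑ m ∈ Icc 1 T, (Nat.totient m : ℝ) / m / m| ≤ 2 := by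
    rw [← sum_sub_distrib]
    refine (abs_sum_le_sum_abs _ _).trans ((sum_le_sum fun m hm => ?_).trans
      (sum_inv_sq_Icc_le_two T))
    have hm0 : (0 : ℝ) < m := by exact_mod_cast (mem_Icc.1 hm).1
    have hφ : (Nat.totient m : ℝ) ≤ m := by exact_mod_cast Nat.totient_le m
    have heq : (Nat.totient m : ℝ) / (m * (m + 1)) - (Nat.totient m : ℝ) / m / m =
        -(Nat.totient m / (m ^ 2 * (m + 1))) := by
      field_simp
      ring
    rw [heq, abs_neg, abs_of_nonneg (by positivity), div_le_div_iff₀ (by positivity) (by positivity)]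
    have : (Nat.totient m : ℝ) ≤ m + 1 := by linarith
    nlinarith [mul_le_mul_of_nonneg_right this (sq_nonneg (m : ℝ))]
  have hterm : |∑ d ∈ Icc 1 T, mob d / (d : ℝ) ^ 2 * ∑ k ∈ Icc 1 (T / d), (1 / k : ℝ) -
      (∑ d ∈ Icc 1 T, mob d / (d : ℝ) ^ 2) * Real.log T| ≤ 2 + C := by
    rw [sum_mul, ← sum_sub_distrib]
    refine (abs_sum_le_sum_abs _ _).trans ?_
    calc _ ≤ ∑ d ∈ Icc 1 T, (1 / (d : ℝ) ^ 2 + Real.log d / (d : ℝ) ^ 2) := by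
          refine sum_le_sum fun d hd => ?_
          obtain ⟨hd1, hdT⟩ := mem_Icc.1 hd
          have hd1' : (1 : ℝ) ≤ d := by exact_mod_cast hd1
          have hd0 : (0 : ℝ) < d := by linarith
          have hquot : (1 : ℝ) ≤ T / d := by
            rw [one_le_div hd0]
            exact_mod_cast hdT
          have hlo := log_le_sum_one_div_Icc hquot
          have hup := sum_one_div_Icc_floor_le hquot
          rw [Nat.floor_div_eq_div, Real.log_div hT0.ne' hd0.ne'] at hlo hup
          have hlogd := Real.log_nonneg hd1'
          rw [← mul_sub, abs_mul, abs_div, abs_of_pos (by positivity : (0 : ℝ) < d ^ 2), ← add_div,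
            div_mul_eq_mul_div]
          gcongr
          refine (mul_le_of_le_one_left (abs_nonneg _) (abs_mob_le_one d)).trans ?_
          rw [abs_le]
          constructor <;> linarith
      _ ≤ _ := by
        rw [sum_add_distrib]
        exact add_le_add (sum_inv_sq_Icc_le_two T) (hC T)
  have hmain : |(∑ d ∈ Icc 1 T, mob d / (d : ℝ) ^ 2) * Real.log T - 6 / π ^ 2 * Real.log T| ≤ 2 := by
    rw [← sub_mul, abs_mul, abs_of_nonneg (Real.log_nonneg hT')]
    have hlogT : Real.log T ≤ T + 1 := (Real.log_le_sub_one_of_pos hT0).trans (by linarith)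
    calc _ ≤ 2 / (T + 1 : ℝ) * (T + 1) :=
          mul_le_mul (abs_sum_mob_sub_le T) hlogT (Real.log_nonneg hT') (by positivity)
      _ = 2 := by field_simp
  rw [sum_totient_div_sq_eq] at hshift
  rw [abs_le] at *
  constructor <;> linarith [hshift.1, hshift.2, hterm.1, hterm.2, hmain.1, hmain.2]

theorem sum_Icc_eq_add_add {a b c : ℕ} (hab : a ≤ b) (hbc : b ≤ c) (f : ℕ → ℝ) :
    ∑ n ∈ Icc 1 c, f n = ∑ n ∈ Icc 1 a, f n + ∑ n ∈ Ioc a b, f n + ∑ n ∈ Ioc b c, f n := by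
  have h (k : ℕ) : Icc 1 k = Ioc 0 k := by
    ext
    simp only [mem_Icc, mem_Ioc]
    omega
  rw [h, h, sum_Ioc_consecutive f (Nat.zero_le a) hab,
    sum_Ioc_consecutive f (Nat.zero_le b) hbc]

theorem sum_totient_floor_Icc_le {x : ℝ} (hx : 0 ≤ x) {a : ℕ} (ha : 1 ≤ a) :
    ∑ n ∈ Icc 1 a, (Nat.totient ⌊x / (n : ℝ)⌋₊ : ℝ) ≤ x * (1 + Real.log a) := by
  have ha' : (1 : ℝ) ≤ a := by exact_mod_cast ha
  have hH := sum_one_div_Icc_floor_le ha'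
  rw [Nat.floor_natCast] at hH
  refine le_trans ?_ (mul_le_mul_of_nonneg_left hH hx)
  rw [mul_sum]
  refine sum_le_sum fun n _ => ?_
  rw [mul_one_div]
  exact le_trans (by exact_mod_cast Nat.totient_le _) (Nat.floor_le (by positivity))

theorem abs_sum_one_div_Ioc_sub_le {a b : ℕ} (ha : 1 ≤ a) (hab : a ≤ b) :
    |∑ n ∈ Ioc a b, (1 / n : ℝ) - (Real.log b - Real.log a)| ≤ 1 := by
  have ha' : (1 : ℝ) ≤ a := by exact_mod_cast ha
  have hb' : (1 : ℝ) ≤ b := by exact_mod_cast ha.trans hab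
  have h1 := sum_one_div_Icc_floor_le ha'
  have h2 := sum_one_div_Icc_floor_le hb'
  have h3 := log_le_sum_one_div_Icc ha'
  have h4 := log_le_sum_one_div_Icc hb'
  rw [Nat.floor_natCast] at h1 h2 h3 h4
  have h5 := sum_Icc_eq_add_add hab le_rfl fun n => (1 / n : ℝ)
  rw [Ioc_self, sum_empty, add_zero] at h5
  rw [abs_le]
  constructor <;> linarith

theorem six_div_pi_sq_le_one : 6 / π ^ 2 ≤ 1 := by
  rw [div_le_one (by positivity)]
  nlinarith [Real.pi_gt_three]

theorem abs_log_floor_sub_le {t : ℝ} (ht : 1 ≤ t) : |Real.log ⌊t⌋₊ - Real.log t| ≤ 1 := by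
  have h1 : (1 : ℝ) ≤ ⌊t⌋₊ := by exact_mod_cast Nat.le_floor (by simpa using ht)
  have hle : (⌊t⌋₊ : ℝ) ≤ t := Nat.floor_le (by linarith)
  have hlt := Nat.lt_floor_add_one t
  have hup := Real.log_le_log (by linarith) hle
  have hlo := Real.log_le_log (by linarith) (by linarith : t ≤ 2 * ⌊t⌋₊)
  rw [Real.log_mul (by norm_num) (by linarith)] at hlo
  have := Real.log_two_lt_d9
  rw [abs_le]
  constructor <;> linarith

theorem exists_abs_sum_totient_floor_sub_le :
    ∃ C : ℝ, 0 < C ∧ ∀ (x : ℝ) (i j : ℕ), 0 < x → 100 ≤ Real.log x → i ≤ j → 2 ≤ i →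
      (2 : ℝ) ^ j ≤ √x → √x ≤ 2 ^ (j + 1) →
      10 ^ 14 * (Real.log x ^ 2 * Real.log (Real.log x)) ≤ Real.log (2 ^ i) ^ 3 →
      |∑ n ∈ Icc 1 ⌊x⌋₊, (Nat.totient ⌊x / (n : ℝ)⌋₊ : ℝ) - 6 / π ^ 2 * x * Real.log x| ≤
        x * (C + 2 * Real.log (2 ^ i)) := by
  obtain ⟨C₁, hC₁, hmid⟩ := exists_abs_sum_totient_middle_le
  obtain ⟨C₂, hC₂, hlarge⟩ := exists_abs_sum_totient_div_sub_log_le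
  refine ⟨C₁ + C₂ + 8, by positivity, fun x i j hx hL hij hi hj hj' h3 => ?_⟩
  have hx1 : 1 ≤ x := by
    rw [← Real.exp_log hx]
    exact Real.one_le_exp (by linarith)
  have hsqrt : √x ≤ x := by
    rw [Real.sqrt_le_left hx.le]
    nlinarith
  have hpi : (1 : ℕ) ≤ 2 ^ i := Nat.one_le_two_pow
  have hpj : (1 : ℕ) ≤ 2 ^ j := Nat.one_le_two_pow
  have hpij : (2 : ℕ) ^ i ≤ 2 ^ j := pow_le_pow_right₀ (by norm_num) hij
  have hjx : (2 : ℝ) ^ j ≤ x := hj.trans hsqrt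
  have hjx' : ((2 ^ j : ℕ) : ℝ) ≤ x := by exact_mod_cast hjx
  have hsplit := sum_Icc_eq_add_add hpij (Nat.le_floor hjx')
    fun n => (Nat.totient ⌊x / (n : ℝ)⌋₊ : ℝ)
  have hS1 := sum_totient_floor_Icc_le hx.le hpi
  have hS1' : 0 ≤ ∑ n ∈ Icc 1 ((2 : ℕ) ^ i), (Nat.totient ⌊x / (n : ℝ)⌋₊ : ℝ) := by positivity
  have hS2 := hmid x i j hx hL hij hi hj h3
  have hH := abs_sum_one_div_Ioc_sub_le hpi hpij
  have hS3 := abs_sum_totient_large_sub_le hpj hjx'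
  have hquot : 1 ≤ x / ((2 ^ j : ℕ) : ℝ) := by rwa [one_le_div (by positivity)]
  have hG := hlarge ⌊x / ((2 ^ j : ℕ) : ℝ)⌋₊ (Nat.le_floor (by simpa using hquot))
  have hfl := abs_log_floor_sub_le hquot
  rw [Real.log_div hx.ne' (by positivity)] at hfl
  have hquot4 : (x / ((2 ^ j : ℕ) : ℝ)) ^ 2 ≤ 4 * x := by
    have h4 : x / ((2 ^ j : ℕ) : ℝ) ≤ 2 * √x := by
      rw [div_le_iff₀ (by positivity)]
      push_cast
      rw [pow_succ] at hj'
      nlinarith [Real.mul_self_sqrt hx.le, Real.sqrt_nonneg x]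
    calc _ ≤ (2 * √x) ^ 2 := by gcongr
      _ = 4 * x := by rw [mul_pow, Real.sq_sqrt hx.le]; norm_num
  push_cast at hS1 hH hS3 hG hfl hquot4 hsplit
  rw [hsplit]
  set S₁ := ∑ n ∈ Icc 1 ((2 : ℕ) ^ i), (Nat.totient ⌊x / (n : ℝ)⌋₊ : ℝ)
  set S₂ := ∑ n ∈ Ioc ((2 : ℕ) ^ i) (2 ^ j), (Nat.totient ⌊x / (n : ℝ)⌋₊ : ℝ)
  set S₃ := ∑ n ∈ Ioc ((2 : ℕ) ^ j) ⌊x⌋₊, (Nat.totient ⌊x / (n : ℝ)⌋₊ : ℝ)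
  set H := ∑ n ∈ Ioc ((2 : ℕ) ^ i) (2 ^ j), (1 / n : ℝ)
  set T := ⌊x / (2 : ℝ) ^ j⌋₊
  set G := ∑ m ∈ Icc 1 T, (Nat.totient m : ℝ) / (m * (m + 1))
  set κ := 6 / π ^ 2 with hκ
  have hκ0 : 0 ≤ κ := by positivity
  have hκ1 : κ ≤ 1 := six_div_pi_sq_le_one
  have hlogi : 0 ≤ Real.log (2 ^ i) := Real.log_nonneg (one_le_pow₀ (by norm_num))
  have hcomb : |H + Real.log T - Real.log x| ≤ 2 + Real.log (2 ^ i) := by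
    rw [abs_le] at *
    constructor <;> linarith [hH.1, hH.2, hfl.1, hfl.2]
  have hcomb' : |κ * x * (H + Real.log T - Real.log x)| ≤ x * (2 + Real.log (2 ^ i)) := by
    rw [abs_mul, abs_of_nonneg (by positivity)]
    exact mul_le_mul (mul_le_of_le_one_left hx.le hκ1) hcomb (abs_nonneg _) hx.le
  have hG' : |x * (G - κ * Real.log T)| ≤ x * C₂ := by
    rw [abs_mul, abs_of_pos hx]
    exact mul_le_mul_of_nonneg_left hG hx.le
  have heq : S₁ + S₂ + S₃ - κ * x * Real.log x = S₁ + (S₂ - κ * x * H) + (S₃ - x * G) +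
      x * (G - κ * Real.log T) + κ * x * (H + Real.log T - Real.log x) := by ring
  rw [heq]
  rw [abs_le] at hS2 hS3 hG' hcomb' ⊢
  constructor <;>
    nlinarith [hS2.1, hS2.2, hS3.1, hS3.2, hG'.1, hG'.2, hcomb'.1, hcomb'.2,
      mul_nonneg hx.le hlogi]

theorem eventually_log_log_le {ε : ℝ} (hε : 0 < ε) :
    ∀ᶠ x : ℝ in atTop, Real.log (Real.log x) ≤ ε * Real.log x := by
  filter_upwards [Real.tendsto_log_atTop.eventually (Real.isLittleO_log_id_atTop.def hε),
    Real.tendsto_log_atTop.eventually_ge_atTop 0] with x hx h0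
  simp only [Real.norm_eq_abs, id] at hx
  rw [abs_of_nonneg h0] at hx
  exact (le_abs_self _).trans hx

end TotientFloor

/-- Zhai's theorem: `∑_{n ≤ x} φ(⌊x/n⌋) = (6/π²) x log x + O(x (log x)^{2/3} (log log x)^{1/3})`. -/
theorem sum_totient_floor_div_asymptotic :
    (fun x : ℝ => (∑ n ∈ Finset.Icc 1 ⌊x⌋₊, (Nat.totient ⌊x / (n : ℝ)⌋₊ : ℝ)) -
      6 / π ^ 2 * x * Real.log x)
    =O[atTop] fun x : ℝ =>
      x * Real.log x ^ ((2 : ℝ) / 3) * Real.log (Real.log x) ^ ((1 : ℝ) / 3) := by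
  obtain ⟨C, hC0, hC⟩ := TotientFloor.exists_abs_sum_totient_floor_sub_le
  refine Asymptotics.IsBigO.of_bound (C + 2 * (10 ^ 5 + 1)) ?_
  filter_upwards [eventually_gt_atTop 0, Real.tendsto_log_atTop.eventually_ge_atTop 100,
    (Real.tendsto_log_atTop.comp Real.tendsto_log_atTop).eventually_ge_atTop 1,
    TotientFloor.eventually_log_log_le (by norm_num : (0 : ℝ) < 1 / (64 * 10 ^ 15))]
    with x hx hL hLL hLL'
  rw [Function.comp_apply] at hLL
  set L := Real.log x with hLdef
  set E := L ^ ((2 : ℝ) / 3) * Real.log L ^ ((1 : ℝ) / 3) with hEdef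
  have hL0 : 0 ≤ L := by linarith
  have hE0 : 0 ≤ E := by positivity
  have hE1 : 1 ≤ E := one_le_mul_of_one_le_of_one_le
    (Real.one_le_rpow (by linarith) (by norm_num)) (Real.one_le_rpow hLL (by norm_num))
  have hE3 : E ^ 3 = L ^ 2 * Real.log L := by
    rw [hEdef, mul_pow, ← Real.rpow_mul_natCast hL0, ← Real.rpow_mul_natCast (by linarith)]
    norm_num
  have hEL : 10 ^ 5 * E ≤ L / 4 := by
    refine le_of_pow_le_pow_left₀ three_ne_zero (by positivity) ?_
    rw [mul_pow, hE3]
    nlinarith [mul_le_mul_of_nonneg_left hLL' (sq_nonneg L)]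
  have hlog2 := Real.log_two_gt_d9
  have hlog2' := Real.log_two_lt_d9
  obtain ⟨i, hi⟩ : ∃ i, i = ⌈10 ^ 5 * E / Real.log 2⌉₊ := ⟨_, rfl⟩
  have hilo : 10 ^ 5 * E ≤ i * Real.log 2 := by
    rw [← div_le_iff₀ (by linarith), hi]
    exact Nat.le_ceil _
  have hiup : i * Real.log 2 ≤ 10 ^ 5 * E + 1 := by
    have h1 : (i : ℝ) < 10 ^ 5 * E / Real.log 2 + 1 := hi ▸ Nat.ceil_lt_add_one (by positivity)
    have h2 := mul_le_mul_of_nonneg_right h1.le (by linarith : 0 ≤ Real.log 2)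
    rw [add_mul, div_mul_cancel₀ _ (by linarith)] at h2
    linarith
  have hi2 : 2 ≤ i := by
    have : (2 : ℝ) ≤ i := by nlinarith [Nat.cast_nonneg (α := ℝ) i]
    exact_mod_cast this
  have hsqrt1 : 1 ≤ √x := by
    rw [Real.one_le_sqrt, ← Real.exp_log hx]
    exact Real.one_le_exp hL0
  have hfl : ⌊√x⌋₊ ≠ 0 := (Nat.floor_pos.2 hsqrt1).ne'
  set j := Nat.log 2 ⌊√x⌋₊ with hj
  have hjlo : (2 : ℝ) ^ j ≤ √x :=
    le_trans (by exact_mod_cast Nat.pow_log_le_self 2 hfl) (Nat.floor_le (Real.sqrt_nonneg x))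
  have hjup : √x ≤ 2 ^ (j + 1) := by
    refine (Nat.lt_floor_add_one √x).le.trans ?_
    exact_mod_cast Nat.lt_pow_succ_log_self one_lt_two ⌊√x⌋₊
  have hij : i ≤ j := by
    by_contra! hlt
    have h1 : ((j + 1 : ℕ) : ℝ) ≤ i := by exact_mod_cast hlt
    have h2 := Real.log_le_log (by linarith) hjup
    rw [Real.log_sqrt hx.le, Real.log_pow] at h2
    have h3 := mul_le_mul_of_nonneg_right h1 (by linarith : 0 ≤ Real.log 2)
    linarith
  have key := hC x i j hx hL hij hi2 hjlo hjup (by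
    rw [Real.log_pow, ← hLdef, ← hE3]
    calc 10 ^ 14 * E ^ 3 ≤ (10 ^ 5 * E) ^ 3 := by nlinarith [pow_nonneg hE0 3]
      _ ≤ _ := by gcongr)
  rw [Real.log_pow] at key
  rw [Real.norm_eq_abs, mul_assoc x, ← hEdef, Real.norm_of_nonneg (by positivity)]
  refine key.trans ?_
  calc x * (C + 2 * (i * Real.log 2)) ≤ x * ((C + 2 * (10 ^ 5 + 1)) * E) := by
        gcongr
        nlinarith
    _ = _ := by ring
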